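/- Let A, A', B, B' be convex polyhedral cones in ℝ³ with apex the origin O and non-empty interior, such that A, A', −B, −B' ⊂ {x : x₃ ≥ 0} and A ∩ {x₃ = 0} = B ∩ {x₃ = 0} = A' ∩ {x₃ = 0} = B' ∩ {x₃ = 0} = {O}. Set F = A ∩ {x₃ = 1}, G = (−B) ∩ {x₃ = 1}, F' = A' ∩ {x₃ = 1}, G' = (−B') ∩ {x₃ = 1}. Assume g_{A,B} = g_{A',B'} (which implies H := conv(F ∪ G) = conv(F' ∪ G')), and let z₁,…,z_n denote the vertices of H in counterclockwise order. Assume for each i = 1,…,n: (1) z_i ∈ F ∩ G if and only if z_i ∈ F' ∩ G'; (2) the segment [z_i, z_{i+1}] is an edge of F or of G if and only if it is an edge of F' or of G'; (3) if z_i ∉ F ∩ G, then the polygon among F and G which contains z_i coincides in a neighbourhood of z_i with the polygon among F' and G' which contains z_i. Then either A = A' and B = B', or A = −B' and B = −A'. -/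

import Mathlib

open MeasureTheory Pointwise

/-- The cross covariogram of sets `K, L ⊆ ℝ³`: `g_{K,L}(x) = λ₃(K ∩ (L + x))`. -/
noncomputable def crossCovariogram (K L : Set (EuclideanSpace ℝ (Fin 3)))
    (x : EuclideanSpace ℝ (Fin 3)) : ℝ :=
  (volume (K ∩ ((x + ·) '' L))).toReal

/-- A convex polyhedral cone with apex the origin: a finite intersection of closed
half-spaces whose boundary planes pass through the origin. -/
def IsPolyhedralCone (C : Set (EuclideanSpace ℝ (Fin 3))) : Prop :=
  ∃ S : Finset (EuclideanSpace ℝ (Fin 3)),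
    C = {x | ∀ s ∈ S, @inner ℝ _ _ s x ≤ (0 : ℝ)}

/-- The exposed face of a convex set `Q` in direction `w`. -/
def exposedFace (Q : Set (EuclideanSpace ℝ (Fin 3)))
    (w : EuclideanSpace ℝ (Fin 3)) : Set (EuclideanSpace ℝ (Fin 3)) :=
  {x ∈ Q | ∀ y ∈ Q, @inner ℝ _ _ w y ≤ @inner ℝ _ _ w x}

/-- `S` is an edge (a one-dimensional exposed face) of `Q`. -/
def IsEdgeOf (Q S : Set (EuclideanSpace ℝ (Fin 3))) : Prop :=
  (∃ w : EuclideanSpace ℝ (Fin 3), w ≠ 0 ∧ S = exposedFace Q w) ∧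
    Module.finrank ℝ (vectorSpan ℝ S) = 1

section

open MeasureTheory Pointwise

namespace CC

/-- the plane -/
abbrev Pl := ℝ × ℝ

/-- evaluation of an affine functional -/
def ev (l : ℝ × ℝ × ℝ) (p : Pl) : ℝ := l.1 * p.1 + l.2.1 * p.2 + l.2.2

/-- oriented area -/
def dt (a b c : Pl) : ℝ := (b.1 - a.1) * (c.2 - a.2) - (b.2 - a.2) * (c.1 - a.1)

/-- the functional `dt a b` -/
def dl (a b : Pl) : ℝ × ℝ × ℝ :=
  (-(b.2 - a.2), b.1 - a.1, (b.2 - a.2) * a.1 - (b.1 - a.1) * a.2)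

lemma ev_dl (a b c : Pl) : ev (dl a b) c = dt a b c := by
  simp only [ev, dl, dt]; ring

lemma dt_self_left (a b : Pl) : dt a b a = 0 := by simp only [dt]; ring
lemma dt_self_right (a b : Pl) : dt a b b = 0 := by simp only [dt]; ring
lemma dt_self (a b : Pl) : dt a a b = 0 := by simp only [dt]; ring
lemma dt_swap (a b c : Pl) : dt b a c = - dt a b c := by simp only [dt]; ring
lemma dt_rot (a b c : Pl) : dt b c a = dt a b c := by simp only [dt]; ring
lemma dt_swap' (a b c : Pl) : dt a c b = - dt a b c := by simp only [dt]; ring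

/-- polygons with interior -/
def IsPoly (K : Set Pl) : Prop :=
  (∃ V : Finset Pl, K = convexHull ℝ (V : Set Pl)) ∧ (interior K).Nonempty

lemma ev_combo (l : ℝ × ℝ × ℝ) (p q : Pl) {a b : ℝ} (h : a + b = 1) :
    ev l (a • p + b • q) = a * ev l p + b * ev l q := by
  simp only [ev, Prod.fst_add, Prod.snd_add, Prod.smul_fst, Prod.smul_snd, smul_eq_mul]
  linear_combination - l.2.2 * h

lemma ev_cont (l : ℝ × ℝ × ℝ) : Continuous (ev l) := by unfold ev; fun_prop

lemma ev_cont2 (p : Pl) : Continuous (fun l => ev l p) := by unfold ev; fun_prop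

lemma ev_sub (l m : ℝ × ℝ × ℝ) (p : Pl) : ev (l - m) p = ev l p - ev m p := by
  simp only [ev, Prod.fst_sub, Prod.snd_sub]; ring
lemma ev_add (l m : ℝ × ℝ × ℝ) (p : Pl) : ev (l + m) p = ev l p + ev m p := by
  simp only [ev, Prod.fst_add, Prod.snd_add]; ring
lemma ev_smul (c : ℝ) (m : ℝ × ℝ × ℝ) (p : Pl) : ev (c • m) p = c * ev m p := by
  simp only [ev, Prod.smul_fst, Prod.smul_snd, smul_eq_mul]; ring
lemma ev_neg (m : ℝ × ℝ × ℝ) (p : Pl) : ev (-m) p = - ev m p := by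
  simp only [ev, Prod.fst_neg, Prod.snd_neg]; ring

lemma convex_ge (l : ℝ × ℝ × ℝ) (c : ℝ) : Convex ℝ {p : Pl | c ≤ ev l p} := by
  intro p hp q hq a b ha hb hab
  simp only [Set.mem_ofPred_eq] at *
  rw [ev_combo l p q hab]
  have h1 := mul_le_mul_of_nonneg_left hp ha
  have h2 := mul_le_mul_of_nonneg_left hq hb
  have : c = a * c + b * c := by rw [← add_mul, hab, one_mul]
  linarith

lemma convex_le (l : ℝ × ℝ × ℝ) (c : ℝ) : Convex ℝ {p : Pl | ev l p ≤ c} := by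
  have := convex_ge (-l) (-c)
  simpa [ev_neg] using this

lemma convex_gt (l : ℝ × ℝ × ℝ) (c : ℝ) : Convex ℝ {p : Pl | c < ev l p} := by
  intro p hp q hq a b ha hb hab
  simp only [Set.mem_ofPred_eq] at *
  rw [ev_combo l p q hab]
  rcases ha.eq_or_lt with h | h
  · subst h
    have : b = 1 := by linarith
    subst this; linarith
  · have h1 := mul_lt_mul_of_pos_left hp h
    have h2 := mul_le_mul_of_nonneg_left hq.le hb
    have : c = a * c + b * c := by rw [← add_mul, hab, one_mul]
    linarith

lemma convex_lt (l : ℝ × ℝ × ℝ) (c : ℝ) : Convex ℝ {p : Pl | ev l p < c} := by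
  have := convex_gt (-l) (-c)
  simpa [ev_neg] using this

lemma convex_eq (l : ℝ × ℝ × ℝ) (c : ℝ) : Convex ℝ {p : Pl | ev l p = c} := by
  have := (convex_ge l c).inter (convex_le l c)
  convert this using 1
  ext p; simp only [Set.mem_ofPred_eq, Set.mem_inter_iff]
  exact ⟨fun h => ⟨h.ge, h.le⟩, fun h => le_antisymm h.2 h.1⟩

lemma closed_ge (l : ℝ × ℝ × ℝ) (c : ℝ) : IsClosed {p : Pl | c ≤ ev l p} :=
  isClosed_le continuous_const (ev_cont l)
lemma closed_le (l : ℝ × ℝ × ℝ) (c : ℝ) : IsClosed {p : Pl | ev l p ≤ c} :=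
  isClosed_le (ev_cont l) continuous_const
lemma closed_eq (l : ℝ × ℝ × ℝ) (c : ℝ) : IsClosed {p : Pl | ev l p = c} :=
  isClosed_eq (ev_cont l) continuous_const

lemma IsPoly.convex {K : Set Pl} (h : IsPoly K) : Convex ℝ K := by
  obtain ⟨⟨V, rfl⟩, _⟩ := h; exact convex_convexHull _ _

lemma IsPoly.compact {K : Set Pl} (h : IsPoly K) : IsCompact K := by
  obtain ⟨⟨V, rfl⟩, _⟩ := h
  exact V.finite_toSet.isCompact_convexHull ℝ

lemma IsPoly.closed {K : Set Pl} (h : IsPoly K) : IsClosed K := h.compact.isClosed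

lemma IsPoly.ext_finite {K : Set Pl} (h : IsPoly K) : (Set.extremePoints ℝ K).Finite := by
  obtain ⟨⟨V, rfl⟩, _⟩ := h
  exact V.finite_toSet.subset extremePoints_convexHull_subset

lemma IsPoly.hull_ext {K : Set Pl} (h : IsPoly K) :
    convexHull ℝ (Set.extremePoints ℝ K) = K := by
  have h1 := closure_convexHull_extremePoints h.compact h.convex
  rwa [(h.ext_finite.isCompact_convexHull ℝ).isClosed.closure_eq] at h1

lemma IsPoly.nonempty {K : Set Pl} (h : IsPoly K) : K.Nonempty :=
  h.2.mono interior_subset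

lemma IsPoly.subset_of_ext {K L : Set Pl} (h : IsPoly K) (hL : Convex ℝ L)
    (hs : Set.extremePoints ℝ K ⊆ L) : K ⊆ L := by
  rw [← h.hull_ext]; exact convexHull_min hs hL

lemma ext_not_mem_hull {K S : Set Pl} (hK : Convex ℝ K) {z : Pl}
    (hz : z ∈ Set.extremePoints ℝ K) (hS : S ⊆ K) (hzS : z ∉ S) : z ∉ convexHull ℝ S := by
  have h1 := (hK.mem_extremePoints_iff_convex_sdiff.1 hz).2
  intro h
  have : convexHull ℝ S ⊆ K \ {z} := convexHull_min
    (fun x hx => ⟨hS hx, fun e => hzS (by rw [Set.mem_singleton_iff] at e; exact e ▸ hx)⟩) h1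
  exact (this h).2 rfl

/-- strict separation -/
lemma sep {K : Set Pl} (hc : IsCompact K) (hK : Convex ℝ K) {x : Pl} (hx : x ∉ K) :
    ∃ l, ev l x < 0 ∧ ∀ p ∈ K, 0 < ev l p := by
  obtain ⟨f, u, h1, h2⟩ := geometric_hahn_banach_point_closed hK hc.isClosed hx
  refine ⟨(f (1,0), f (0,1), -u), ?_⟩
  have : ∀ p : Pl, ev (f (1,0), f (0,1), -u) p = f p - u := by
    intro p
    have : p = p.1 • ((1:ℝ),(0:ℝ)) + p.2 • ((0:ℝ),(1:ℝ)) := by ext <;> simp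
    conv_rhs => rw [this, map_add, map_smul, map_smul]
    simp only [ev, smul_eq_mul]; ring
  refine ⟨by rw [this]; linarith, fun p hp => by rw [this]; linarith [h2 p hp]⟩

/-- exposing functional at a vertex -/
lemma IsPoly.expose {K : Set Pl} (h : IsPoly K) {z : Pl} (hz : z ∈ Set.extremePoints ℝ K) :
    ∃ l, ev l z = 0 ∧ ∀ p ∈ K, p ≠ z → 0 < ev l p := by
  set S := Set.extremePoints ℝ K \ {z} with hS
  have hSf : S.Finite := h.ext_finite.subset Set.sdiff_subset
  have hzS : z ∉ convexHull ℝ S := ext_not_mem_hull h.convex hz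
    (fun x hx => hx.1.1) (fun h => h.2 rfl)
  obtain ⟨l, h1, h2⟩ := sep (hSf.isCompact_convexHull ℝ) (convex_convexHull ℝ S) hzS
  refine ⟨l - (0, 0, ev l z), by rw [ev_sub]; simp [ev], ?_⟩
  intro p hp hpz
  have e : ∀ q, ev (l - (0, 0, ev l z)) q = ev l q - ev l z := by
    intro q; rw [ev_sub]; congr 1; simp [ev]
  rw [e]
  have hK : K = convexHull ℝ (insert z S) := by
    rw [hS, Set.insert_sdiff_singleton, Set.insert_eq_of_mem hz, h.hull_ext]
  rw [hK] at hp
  rcases S.eq_empty_or_nonempty with h0 | h0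
  · rw [h0] at hp; simp at hp; exact absurd hp hpz
  rw [convexHull_insert h0, mem_convexJoin] at hp
  obtain ⟨a, ha, b, hb, hpab⟩ := hp
  rw [Set.mem_singleton_iff] at ha; subst ha
  obtain ⟨s, t, hs, ht, hst, rfl⟩ := hpab
  rw [ev_combo l _ _ hst]
  have hb := h2 b hb
  have ht0 : t ≠ 0 := by
    rintro rfl
    apply hpz
    have : s = 1 := by linarith
    subst this; simp
  have : 0 < t := lt_of_le_of_ne ht (Ne.symm ht0)
  have hs' : s = 1 - t := by linarith
  subst hs'
  nlinarith

/-- an affine functional vanishing on a set with interior is zero -/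
lemma ev_zero_of_interior {K : Set Pl} (hK : (interior K).Nonempty) {l : ℝ × ℝ × ℝ}
    (h : ∀ p ∈ K, ev l p = 0) : l = 0 := by
  obtain ⟨p, hp⟩ := hK
  obtain ⟨ε, he, hb⟩ := Metric.isOpen_iff.1 isOpen_interior p hp
  have hh : ∀ q : Pl, dist q p < ε → ev l q = 0 := fun q hq => h q (interior_subset (hb hq))
  have h0 := hh p (by simpa using he)
  have h1 := hh (p.1 + ε/2, p.2) (by
    rw [Prod.dist_eq]; simp [abs_of_pos he, he])
  have h2 := hh (p.1, p.2 + ε/2) (by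
    rw [Prod.dist_eq]; simp [abs_of_pos he, he])
  simp only [ev] at h0 h1 h2
  have e1 : l.1 * (ε/2) = 0 := by linarith
  have e2 : l.2.1 * (ε/2) = 0 := by linarith
  have hne : ε/2 ≠ 0 := by positivity
  have a1 : l.1 = 0 := by simpa [hne, he.ne'] using e1
  have a2 : l.2.1 = 0 := by simpa [hne, he.ne'] using e2
  rw [a1, a2] at h0
  ext <;> simp [a1, a2]; linarith

end CC

end

section

open MeasureTheory Pointwise

namespace CC

/-- the integral attached to a planar set -/
noncomputable def Phi (K : Set Pl) (l : ℝ × ℝ × ℝ) : ℝ := ∫ p in K, ((ev l p)⁻¹) ^ 3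

/-- linear part of affine coordinates -/
noncomputable def lmap (u v : Pl) : Pl →L[ℝ] Pl :=
  (ContinuousLinearMap.fst ℝ ℝ ℝ).smulRight u + (ContinuousLinearMap.snd ℝ ℝ ℝ).smulRight v

lemma lmap_apply (u v p : Pl) : lmap u v p = p.1 • u + p.2 • v := by
  simp [lmap]

lemma lmap_det (u v : Pl) : (lmap u v).det = u.1 * v.2 - v.1 * u.2 := by
  have : ((lmap u v : Pl →L[ℝ] Pl) : Pl →ₗ[ℝ] Pl) =
      Matrix.toLin (Module.Basis.finTwoProd ℝ) (Module.Basis.finTwoProd ℝ) !![u.1, v.1; u.2, v.2] := by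
    ext <;> simp [lmap, Matrix.toLin_finTwoProd_apply]
  rw [ContinuousLinearMap.det, this, LinearMap.det_toLin, Matrix.det_fin_two_of]

/-- change of variables for affine maps -/
lemma integral_affine (a u v : Pl) (h : u.1 * v.2 - v.1 * u.2 ≠ 0) (s : Set Pl)
    (hs : MeasurableSet s) (g : Pl → ℝ) :
    ∫ p in (fun x : Pl => a + (x.1 • u + x.2 • v)) '' s, g p =
      |u.1 * v.2 - v.1 * u.2| * ∫ x in s, g (a + (x.1 • u + x.2 • v)) := by
  have hd : ∀ x ∈ s, HasFDerivWithinAt (fun x : Pl => a + (x.1 • u + x.2 • v)) (lmap u v) s x := by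
    intro x _
    have : (fun x : Pl => a + (x.1 • u + x.2 • v)) = fun x => a + lmap u v x := by
      ext x <;> simp [lmap_apply]
    rw [this]
    exact ((lmap u v).hasFDerivAt.const_add a).hasFDerivWithinAt
  have hi : Set.InjOn (fun x : Pl => a + (x.1 • u + x.2 • v)) s := by
    intro x _ y _ hxy
    have h0 := add_left_cancel hxy
    have e1 := congrArg Prod.fst h0
    have e2 := congrArg Prod.snd h0
    simp only [Prod.fst_add, Prod.snd_add, Prod.smul_fst, Prod.smul_snd, smul_eq_mul] at e1 e2
    ext
    · have : (x.1 - y.1) * (u.1 * v.2 - v.1 * u.2) = 0 := by linear_combination v.2 * e1 - v.1 * e2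
      rcases mul_eq_zero.1 this with h' | h'
      · linarith
      · exact absurd h' h
    · have : (x.2 - y.2) * (u.1 * v.2 - v.1 * u.2) = 0 := by linear_combination -u.2 * e1 + u.1 * e2
      rcases mul_eq_zero.1 this with h' | h'
      · linarith
      · exact absurd h' h
  rw [integral_image_eq_integral_abs_det_fderiv_smul volume hs hd hi, lmap_det]
  simp only [smul_eq_mul]
  rw [integral_const_mul]

/-- standard triangle -/
def stdTri : Set Pl := {p | 0 ≤ p.1 ∧ 0 ≤ p.2 ∧ p.1 + p.2 ≤ 1}

lemma stdTri_closed : IsClosed stdTri := by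
  have : stdTri = {p : Pl | 0 ≤ p.1} ∩ ({p : Pl | 0 ≤ p.2} ∩ {p : Pl | p.1 + p.2 ≤ 1}) := by
    ext; simp [stdTri]
  rw [this]
  exact (isClosed_le continuous_const continuous_fst).inter
    ((isClosed_le continuous_const continuous_snd).inter
      (isClosed_le (continuous_fst.add continuous_snd) continuous_const))

lemma stdTri_compact : IsCompact stdTri := by
  apply (isCompact_Icc (a := ((0:ℝ),(0:ℝ))) (b := (1,1))).of_isClosed_subset stdTri_closed
  rintro ⟨x, y⟩ ⟨h1, h2, h3⟩
  simp only at h1 h2 h3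
  exact ⟨⟨h1, h2⟩, ⟨by simp only; linarith, by simp only; linarith⟩⟩

lemma tri_image (a b c : Pl) : convexHull ℝ {a, b, c} =
    (fun x : Pl => a + (x.1 • (b - a) + x.2 • (c - a))) '' stdTri := by
  ext p
  rw [convexHull_insert (by simp), mem_convexJoin, convexHull_pair]
  simp only [Set.mem_singleton_iff, exists_eq_left, Set.mem_image]
  constructor
  · rintro ⟨q, ⟨s, t, hs, ht, hst, rfl⟩, ⟨s', t', hs', ht', hst', rfl⟩⟩
    refine ⟨(t' * s, t' * t), ⟨by simp only; positivity, by simp only; positivity, ?_⟩, ?_⟩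
    · simp only; rw [← mul_add, hst]; linarith
    · have e1 : s' = 1 - t' := by linarith
      have e2 : s = 1 - t := by linarith
      subst e1 e2
      ext <;> simp <;> ring
  · rintro ⟨⟨x, y⟩, ⟨h1, h2, h3⟩, rfl⟩
    simp only at h1 h2 h3
    rcases (add_nonneg h1 h2).eq_or_lt with h | h
    · have hx : x = 0 := by linarith
      have hy : y = 0 := by linarith
      refine ⟨b, left_mem_segment _ _ _, ?_⟩
      simp [hx, hy, left_mem_segment]
    · refine ⟨(x/(x+y)) • b + (y/(x+y)) • c, ⟨_, _, by positivity, by positivity, by field_simp, rfl⟩,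
        ⟨1 - (x+y), x + y, by linarith, by linarith, by ring, ?_⟩⟩
      ext <;> simp <;> field_simp <;> ring

lemma inner_int (K m T : ℝ) (hT : 0 ≤ T) (hK : 0 < K) (hK' : 0 < K + m * T) :
    ∫ t in (0:ℝ)..T, ((K + t * m)⁻¹) ^ 3 = T * (2 * K + m * T) / (2 * K^2 * (K + m*T)^2) := by
  have hpos : ∀ t ∈ Set.Icc 0 T, 0 < K + t * m := by
    intro t ht
    rcases le_or_gt 0 m with h | h
    · nlinarith [ht.1]
    · nlinarith [ht.2]
  rw [intervalIntegral.integral_eq_sub_of_hasDerivAt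
    (f := fun t => t * (2 * K + m * t) / (2 * K^2 * (K + m*t)^2))]
  · simp
  · intro t ht
    rw [Set.uIcc_of_le hT] at ht
    have hp := hpos t ht
    have hp' : K + m * t ≠ 0 := by rw [mul_comm]; exact hp.ne'
    have d1 : HasDerivAt (fun t : ℝ => t * (2 * K + m * t)) (1 * (2*K+m*t) + t * (m * 1)) t :=
      (hasDerivAt_id t).mul (((hasDerivAt_id t).const_mul m).const_add (2*K))
    have d2 : HasDerivAt (fun t : ℝ => 2 * K^2 * (K + m*t)^2)
        (2 * K^2 * (((2:ℕ):ℝ) * (K+m*t)^(2-1) * (m*1))) t :=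
      ((((hasDerivAt_id t).const_mul m).const_add K).pow 2).const_mul _
    have d3 := d1.div d2 (by positivity)
    refine d3.congr_deriv ?_
    rw [mul_comm t m]
    field_simp
    ring
  · apply ContinuousOn.intervalIntegrable
    rw [Set.uIcc_of_le hT]
    apply ContinuousOn.pow
    apply ContinuousOn.inv₀ (by fun_prop)
    intro t ht
    exact (hpos t ht).ne'

lemma outer_int (A B C : ℝ) (hA : 0 < A) (hB : 0 < B) (hC : 0 < C) :
    ∫ s in (0:ℝ)..1, (1 - s) * ((A + s*(B-A)) + (C + s*(B-C))) /
      (2 * (A + s*(B-A))^2 * (C + s*(B-C))^2) = 1 / (2 * A * B * C) := by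
  have hpos : ∀ X : ℝ, 0 < X → ∀ t ∈ Set.Icc (0:ℝ) 1, 0 < X + t * (B - X) := by
    intro X hX t ht
    have : X + t * (B - X) = (1-t)*X + t*B := by ring
    rw [this]
    rcases ht.1.eq_or_lt with h | h
    · rw [← h]; simpa using hX
    · have := mul_nonneg (sub_nonneg.2 ht.2) hX.le
      have := mul_pos h hB
      linarith
  rw [intervalIntegral.integral_eq_sub_of_hasDerivAt
    (f := fun s => - (1-s)^2 / (2 * B * ((A + s*(B-A)) * (C + s*(B-C)))))]
  · simp; field_simp
  · intro t ht
    rw [Set.uIcc_of_le zero_le_one] at ht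
    have h1 := hpos A hA t ht
    have h2 := hpos C hC t ht
    have d1 : HasDerivAt (fun s : ℝ => -(1 - s)^2) (-(((2:ℕ):ℝ) * (1-t)^(2-1) * (-1))) t :=
      (((hasDerivAt_id t).const_sub 1).pow 2).neg
    have d2 : HasDerivAt (fun s : ℝ => 2 * B * ((A + s*(B-A)) * (C + s*(B-C))))
        (2 * B * ((1*(B-A)) * (C + t*(B-C)) + (A + t*(B-A)) * (1*(B-C)))) t :=
      ((((hasDerivAt_id t).mul_const _).const_add A).mul
        (((hasDerivAt_id t).mul_const _).const_add C)).const_mul _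
    have d3 := d1.div d2 (by positivity)
    refine d3.congr_deriv ?_
    have hk : ((A + t*(B-A)) * (C + t*(B-C))) ≠ 0 := by positivity
    field_simp
    ring
  · apply ContinuousOn.intervalIntegrable
    rw [Set.uIcc_of_le zero_le_one]
    apply ContinuousOn.div (by fun_prop) (by fun_prop)
    intro t ht
    have h1 := hpos A hA t ht
    have h2 := hpos C hC t ht
    positivity

lemma stdTri_int (A B C : ℝ) (hA : 0 < A) (hB : 0 < B) (hC : 0 < C) :
    ∫ x in stdTri, ((A + x.1 * (B - A) + x.2 * (C - A))⁻¹) ^ 3 = 1 / (2 * A * B * C) := by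
  have hpos : ∀ x ∈ stdTri, 0 < A + x.1 * (B - A) + x.2 * (C - A) := by
    rintro ⟨x, y⟩ ⟨h1, h2, h3⟩
    simp only at *
    have : A + x * (B - A) + y * (C - A) = (1-x-y)*A + x*B + y*C := by ring
    rw [this]
    have a1 := mul_nonneg (show 0 ≤ 1-x-y by linarith) hA.le
    have a2 := mul_nonneg h1 hB.le
    have a3 := mul_nonneg h2 hC.le
    by_contra hcon
    have e1 : (1-x-y)*A = 0 := by linarith
    have e2 : x*B = 0 := by linarith
    have e3 : y*C = 0 := by linarith
    have f1 := (mul_eq_zero.1 e1).resolve_right hA.ne'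
    have f2 := (mul_eq_zero.1 e2).resolve_right hB.ne'
    have f3 := (mul_eq_zero.1 e3).resolve_right hC.ne'
    linarith
  have hcont : ContinuousOn (fun x : Pl => ((A + x.1 * (B - A) + x.2 * (C - A))⁻¹) ^ 3) stdTri := by
    apply ContinuousOn.pow
    apply ContinuousOn.inv₀ (by fun_prop)
    intro x hx; exact (hpos x hx).ne'
  have hitg := hcont.integrableOn_compact (μ := volume) stdTri_compact
  rw [← integral_indicator stdTri_closed.measurableSet, Measure.volume_eq_prod, integral_prod]
  · have h1 : ∀ s : ℝ, (∫ t : ℝ, stdTri.indicator (fun x : Pl =>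
        ((A + x.1 * (B - A) + x.2 * (C - A))⁻¹) ^ 3) (s, t)) =
        (Set.Icc (0:ℝ) 1).indicator (fun s => (1 - s) * ((A + s*(B-A)) + (C + s*(B-C))) /
          (2 * (A + s*(B-A))^2 * (C + s*(B-C))^2)) s := by
      intro s
      by_cases hs : s ∈ Set.Icc (0:ℝ) 1
      · rw [Set.indicator_of_mem hs]
        have : ∀ t : ℝ, stdTri.indicator (fun x : Pl =>
            ((A + x.1 * (B - A) + x.2 * (C - A))⁻¹) ^ 3) (s, t) =
            (Set.Icc (0:ℝ) (1-s)).indicator (fun t => ((A + s*(B-A) + t * (C-A))⁻¹)^3) t := by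
          intro t
          by_cases ht : t ∈ Set.Icc (0:ℝ) (1-s)
          · rw [Set.indicator_of_mem ht, Set.indicator_of_mem]
            exact ⟨hs.1, ht.1, by have := ht.2; simp only; linarith⟩
          · rw [Set.indicator_of_notMem ht, Set.indicator_of_notMem]
            rintro ⟨_, h2, h3⟩
            exact ht ⟨h2, by simp only at h3; linarith⟩
        simp_rw [this]
        rw [integral_indicator measurableSet_Icc, integral_Icc_eq_integral_Ioc,
          ← intervalIntegral.integral_of_le (by linarith [hs.2])]
        have hh0 := hpos (s, 0) ⟨hs.1, le_rfl, by have := hs.2; simp only; linarith⟩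
        have hh1 := hpos (s, 1 - s) ⟨hs.1, by have := hs.2; simp only; linarith,
          by simp only; linarith⟩
        simp only at hh0 hh1
        rw [inner_int _ _ _ (by linarith [hs.2]) (by linarith) (by linarith)]
        have e : A + s*(B-A) + (C - A)*(1-s) = C + s*(B-C) := by ring
        rw [e]
        congr 1
        ring
      · rw [Set.indicator_of_notMem hs]
        have : ∀ t : ℝ, stdTri.indicator (fun x : Pl =>
            ((A + x.1 * (B - A) + x.2 * (C - A))⁻¹) ^ 3) (s, t) = 0 := by
          intro t
          rw [Set.indicator_of_notMem]
          rintro ⟨h1, h2, h3⟩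
          exact hs ⟨h1, by simp only at h2 h3; linarith⟩
        simp_rw [this]; simp
    simp_rw [h1]
    rw [integral_indicator measurableSet_Icc, integral_Icc_eq_integral_Ioc,
          ← intervalIntegral.integral_of_le zero_le_one, outer_int A B C hA hB hC]
  · rw [← Measure.volume_eq_prod]
    exact (integrable_indicator_iff stdTri_closed.measurableSet).2 hitg

lemma Phi_tri {a b c : Pl} (h : dt a b c ≠ 0) (l : ℝ × ℝ × ℝ) (ha : 0 < ev l a)
    (hb : 0 < ev l b) (hc : 0 < ev l c) :
    Phi (convexHull ℝ {a, b, c}) l = |dt a b c| / 2 / (ev l a * ev l b * ev l c) := by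
  have hd : (b-a).1 * (c-a).2 - (c-a).1 * (b-a).2 = dt a b c := by
    simp only [dt, Prod.fst_sub, Prod.snd_sub]; ring
  rw [Phi, tri_image, integral_affine _ _ _ (by rw [hd]; exact h) _ stdTri_closed.measurableSet, hd]
  have : ∀ x : Pl, ev l (a + (x.1 • (b - a) + x.2 • (c - a))) =
      ev l a + x.1 * (ev l b - ev l a) + x.2 * (ev l c - ev l a) := by
    intro x; simp only [ev, Prod.fst_add, Prod.snd_add, Prod.smul_fst, Prod.smul_snd,
      Prod.fst_sub, Prod.snd_sub, smul_eq_mul]; ring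
  simp_rw [this]
  rw [stdTri_int _ _ _ ha hb hc]
  field_simp

end CC

end

section

open MeasureTheory Pointwise

namespace CC

lemma line_null (l : ℝ × ℝ × ℝ) (h : l.1 ≠ 0 ∨ l.2.1 ≠ 0) (c : ℝ) :
    volume {p : Pl | ev l p = c} = 0 := by
  have h1 := (convex_eq l c).addHaar_frontier volume
  have h2 : interior {p : Pl | ev l p = c} = ∅ := by
    by_contra hne
    have hh := ev_zero_of_interior (Set.nonempty_iff_ne_empty.2 hne) (l := l - (0,0,c)) (by
      intro p hp
      rw [ev_sub, show ev l p = c from hp]; simp [ev])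
    have e1 : l.1 = 0 := by simpa using congrArg Prod.fst hh
    have e2 : l.2.1 = 0 := by simpa using congrArg (fun x => x.2.1) hh
    rcases h with h | h
    · exact h e1
    · exact h e2
  rwa [frontier, (closed_eq l c).closure_eq, h2, Set.sdiff_empty] at h1

lemma dl_ne {a b : Pl} (h : a ≠ b) : (dl a b).1 ≠ 0 ∨ (dl a b).2.1 ≠ 0 := by
  by_contra hcon
  push Not at hcon
  simp only [dl] at hcon
  exact h (by ext <;> linarith [hcon.1, hcon.2])

lemma dt_null {a b : Pl} (h : a ≠ b) : volume {p : Pl | dt a b p = 0} = 0 := by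
  have := line_null (dl a b) (dl_ne h) 0
  simpa [ev_dl] using this

lemma dt_combo (u v p q : Pl) {a b : ℝ} (h : a + b = 1) :
    dt u v (a • p + b • q) = a * dt u v p + b * dt u v q := by
  rw [← ev_dl, ev_combo _ _ _ h, ev_dl, ev_dl]

lemma dt_cont (a b : Pl) : Continuous (dt a b) := by
  have : dt a b = ev (dl a b) := by ext c; rw [ev_dl]
  rw [this]; exact ev_cont _

/-- membership in a triangle by oriented areas -/
lemma mem_tri {f a b p : Pl} (h : 0 < dt f a b) (h1 : 0 ≤ dt f a p) (h2 : 0 ≤ dt b f p)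
    (h3 : 0 ≤ dt a b p) : p ∈ convexHull ℝ {f, a, b} := by
  rw [tri_image]
  have e : dt f a p + dt b f p + dt a b p = dt f a b := by simp only [dt]; ring
  refine ⟨(dt b f p / dt f a b, dt f a p / dt f a b), ⟨by simp only; positivity,
    by simp only; positivity, ?_⟩, ?_⟩
  · simp only; rw [← add_div, div_le_one h]; linarith
  · have hne := h.ne'
    ext
    · simp only [Prod.fst_add, Prod.smul_fst, Prod.fst_sub, smul_eq_mul]
      field_simp
      simp only [dt]; ring
    · simp only [Prod.snd_add, Prod.smul_snd, Prod.snd_sub, smul_eq_mul]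
      field_simp
      simp only [dt]; ring

/-- convex position -/
def CP (V : Finset Pl) : Prop := ∀ v ∈ V, v ∉ convexHull ℝ ((V.erase v : Finset Pl) : Set Pl)

lemma CP.mono {V W : Finset Pl} (h : CP V) (hW : W ⊆ V) : CP W := by
  intro v hv hh
  exact h v (hW hv) (convexHull_mono (by
    intro x hx; simp only [Finset.coe_erase, Set.mem_sdiff, Finset.mem_coe] at hx ⊢
    exact ⟨hW hx.1, hx.2⟩) hh)

/-- extreme directions seen from a point strictly outside -/
lemma dir_order {f : Pl} {l : ℝ × ℝ × ℝ} {W : Finset Pl} (hW : W.Nonempty)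
    (h : ∀ w ∈ W, ev l f < ev l w) :
    ∃ fm ∈ W, ∀ w ∈ W, 0 ≤ dt f fm w := by
  set s : Pl → ℝ := fun w => (-l.2.1 * (w.1 - f.1) + l.1 * (w.2 - f.2)) / (ev l w - ev l f) with hs
  obtain ⟨fm, h1, h2⟩ := W.exists_min_image s hW
  refine ⟨fm, h1, fun w hw => ?_⟩
  have a1 : 0 < ev l fm - ev l f := by linarith [h fm h1]
  have a2 : 0 < ev l w - ev l f := by linarith [h w hw]
  have h3 := h2 w hw
  simp only [hs] at h3
  rw [div_le_div_iff₀ a1 a2] at h3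
  have h4 : 0 ≤ (l.1^2 + l.2.1^2) * dt f fm w := by
    have : (l.1^2 + l.2.1^2) * dt f fm w =
      (-l.2.1 * (w.1 - f.1) + l.1 * (w.2 - f.2)) * (ev l fm - ev l f) -
      (-l.2.1 * (fm.1 - f.1) + l.1 * (fm.2 - f.2)) * (ev l w - ev l f) := by
      simp only [ev, dt]; ring
    rw [this]; linarith
  have h5 : 0 < l.1^2 + l.2.1^2 := by
    rcases eq_or_ne (l.1^2+l.2.1^2) 0 with h0 | h0
    · exfalso
      have b1 : l.1 = 0 := by nlinarith [sq_nonneg l.1, sq_nonneg l.2.1]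
      have b2 : l.2.1 = 0 := by nlinarith [sq_nonneg l.1, sq_nonneg l.2.1]
      simp [ev, b1, b2] at a1
    · positivity
  exact nonneg_of_mul_nonneg_right h4 h5

lemma dir_order' {f : Pl} {l : ℝ × ℝ × ℝ} {W : Finset Pl} (hW : W.Nonempty)
    (h : ∀ w ∈ W, ev l f < ev l w) :
    ∃ fp ∈ W, ∀ w ∈ W, dt f fp w ≤ 0 := by
  -- reflect the second coordinate
  obtain ⟨g, hg, hh⟩ := dir_order (f := (f.1, -f.2)) (l := (l.1, -l.2.1, l.2.2))
    (W := W.image (fun w : Pl => ((w.1, -w.2) : Pl))) (hW.image _) (by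
      intro w hw
      obtain ⟨u, hu, rfl⟩ := Finset.mem_image.1 hw
      have := h u hu
      simp only [ev] at this ⊢
      linarith)
  obtain ⟨u, hu, rfl⟩ := Finset.mem_image.1 hg
  refine ⟨u, hu, fun w hw => ?_⟩
  have := hh _ (Finset.mem_image_of_mem _ hw)
  simp only [dt] at this ⊢
  linarith

lemma collinear_same_side {f a b : Pl} {l : ℝ × ℝ × ℝ} (ha : ev l f < ev l a)
    (hb : ev l f < ev l b) (h : dt f a b = 0) (hab : ev l a ≤ ev l b) :
    a ∈ segment ℝ f b := by
  have hpos : 0 < ev l b - ev l f := by linarith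
  refine ⟨1 - (ev l a - ev l f)/(ev l b - ev l f), (ev l a - ev l f)/(ev l b - ev l f), ?_, ?_,
    by ring, ?_⟩
  · rw [sub_nonneg, div_le_one hpos]; linarith
  · apply div_nonneg <;> linarith
  · simp only [dt, ev] at *
    ext
    · simp only [Prod.fst_add, Prod.smul_fst, smul_eq_mul]
      rw [← sub_eq_zero]
      field_simp
      linear_combination -l.2.1 * h
    · simp only [Prod.snd_add, Prod.smul_snd, smul_eq_mul]
      rw [← sub_eq_zero]
      field_simp
      linear_combination l.1 * h

/-- ear decomposition -/
lemma ear {V : Finset Pl} (hV : CP V) (h3 : 3 ≤ V.card) {f : Pl} (hf : f ∈ V) :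
    ∃ a ∈ V.erase f, ∃ b ∈ V.erase f, 0 < dt f a b ∧
      convexHull ℝ (V : Set Pl) = convexHull ℝ ((V.erase f : Finset Pl) : Set Pl) ∪
        convexHull ℝ {f, a, b} ∧
      (convexHull ℝ ((V.erase f : Finset Pl) : Set Pl) ⊆ {p | dt a b p ≤ 0}) ∧
      convexHull ℝ {f, a, b} ⊆ {p | 0 ≤ dt a b p} := by
  set W := V.erase f with hW
  have hfW := hV f hf
  have hWc : 2 ≤ W.card := by rw [hW, Finset.card_erase_of_mem hf]; omega
  have hWne : W.Nonempty := Finset.card_pos.1 (by omega)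
  obtain ⟨l, hl1, hl2⟩ := sep (W.finite_toSet.isCompact_convexHull ℝ) (convex_convexHull ℝ _) hfW
  have hlW : ∀ w ∈ W, ev l f < ev l w := fun w hw =>
    hl1.trans (hl2 w (subset_convexHull ℝ _ hw))
  obtain ⟨a, ha, hamin⟩ := dir_order hWne hlW
  obtain ⟨b, hb, hbmax⟩ := dir_order' hWne hlW
  have hstrict : ∀ u ∈ W, ∀ w ∈ W, u ≠ w → dt f u w ≠ 0 := by
    intro u hu w hw huw h0
    have key : ∀ u ∈ W, ∀ w ∈ W, u ≠ w → dt f u w = 0 → ev l u ≤ ev l w → False := by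
      intro u hu w hw huw h0 hle
      have hseg := collinear_same_side (hlW u hu) (hlW w hw) h0 hle
      apply hV u (Finset.mem_of_mem_erase hu)
      apply segment_subset_convexHull _ _ hseg
      · simp only [Finset.coe_erase, Set.mem_sdiff, Finset.mem_coe, Set.mem_singleton_iff]
        exact ⟨hf, (Finset.ne_of_mem_erase hu).symm⟩
      · simp only [Finset.coe_erase, Set.mem_sdiff, Finset.mem_coe, Set.mem_singleton_iff]
        exact ⟨Finset.mem_of_mem_erase hw, huw.symm⟩
    rcases le_total (ev l u) (ev l w) with h | h
    · exact key u hu w hw huw h0 h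
    · exact key w hw u hu huw.symm (by rw [dt_swap', h0, neg_zero]) h
  have hab : a ≠ b := by
    rintro rfl
    obtain ⟨u, hu, hua⟩ := Finset.exists_mem_ne (by omega : 1 < W.card) a
    exact hstrict a ha u hu hua.symm (le_antisymm (hbmax u hu) (hamin u hu))
  have hpos : 0 < dt f a b := lt_of_le_of_ne (hamin b hb) (hstrict a ha b hb hab).symm
  have hWneg : ∀ w ∈ W, dt a b w ≤ 0 := by
    intro w hw
    by_contra hcon
    push Not at hcon
    have hwa : w ≠ a := by rintro rfl; rw [dt_self_left] at hcon; exact lt_irrefl _ hcon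
    have hwb : w ≠ b := by rintro rfl; rw [dt_self_right] at hcon; exact lt_irrefl _ hcon
    have hm : w ∈ convexHull ℝ {f, a, b} := mem_tri hpos (hamin w hw)
      (by rw [dt_swap]; linarith [hbmax w hw]) hcon.le
    apply hV w (Finset.mem_of_mem_erase hw)
    refine convexHull_mono ?_ hm
    intro x hx
    simp only [Finset.coe_erase, Set.mem_sdiff, Finset.mem_coe, Set.mem_singleton_iff]
    rcases hx with rfl | rfl | rfl
    · exact ⟨hf, (Finset.ne_of_mem_erase hw).symm⟩
    · exact ⟨Finset.mem_of_mem_erase ha, hwa.symm⟩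
    · exact ⟨Finset.mem_of_mem_erase hb, hwb.symm⟩
  have hside : convexHull ℝ (W : Set Pl) ⊆ {p | dt a b p ≤ 0} := by
    apply convexHull_min
    · intro w hw; exact hWneg w hw
    · have := convex_le (dl a b) 0; simpa [ev_dl] using this
  have hf' : dt a b f = dt f a b := dt_rot _ _ _
  have hside2 : convexHull ℝ {f, a, b} ⊆ {p | 0 ≤ dt a b p} := by
    apply convexHull_min
    · rintro w (rfl | rfl | rfl)
      · simp only [Set.mem_ofPred_eq]; rw [hf']; exact hpos.le
      · simp [dt_self_left]
      · simp [dt_self_right]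
    · have := convex_ge (dl a b) 0; simpa [ev_dl] using this
  refine ⟨a, ha, b, hb, hpos, ?_, hside, hside2⟩
  apply Set.Subset.antisymm
  · intro p hp
    have hVW : (V : Set Pl) = insert f (W : Set Pl) := by
      rw [hW, ← Finset.coe_insert, Finset.insert_erase hf]
    rw [hVW, convexHull_insert (by simpa using hWne), mem_convexJoin] at hp
    obtain ⟨f0, hf0, q, hq, hpq⟩ := hp
    rw [Set.mem_singleton_iff] at hf0; subst hf0
    have c1 : ∀ q ∈ convexHull ℝ (W : Set Pl), 0 ≤ dt f0 a q := by
      have : convexHull ℝ (W : Set Pl) ⊆ {p | 0 ≤ dt f0 a p} := by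
        apply convexHull_min
        · intro w hw; exact hamin w hw
        · have := convex_ge (dl f0 a) 0; simpa [ev_dl] using this
      exact this
    have c2 : ∀ q ∈ convexHull ℝ (W : Set Pl), 0 ≤ dt b f0 q := by
      have : convexHull ℝ (W : Set Pl) ⊆ {p | 0 ≤ dt b f0 p} := by
        apply convexHull_min
        · intro w hw; show 0 ≤ dt b f0 w; rw [dt_swap]; linarith [hbmax w hw]
        · have := convex_ge (dl b f0) 0; simpa [ev_dl] using this
      exact this
    obtain ⟨s, t, hs, ht, hst, rfl⟩ := hpq
    have d1 : ∀ s t : ℝ, 0 ≤ t → s + t = 1 → 0 ≤ dt f0 a (s • f0 + t • q) := by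
      intro s t ht hst
      rw [dt_combo _ _ _ _ hst, dt_self_left]; have := mul_nonneg ht (c1 q hq); linarith
    have d2 : ∀ s t : ℝ, 0 ≤ t → s + t = 1 → 0 ≤ dt b f0 (s • f0 + t • q) := by
      intro s t ht hst
      rw [dt_combo _ _ _ _ hst, dt_self_right]; have := mul_nonneg ht (c2 q hq); linarith
    rcases le_or_gt 0 (dt a b (s • f0 + t • q)) with h | h
    · right; exact mem_tri hpos (d1 s t ht hst) (d2 s t ht hst) h
    · left
      rw [dt_combo _ _ _ _ hst, hf'] at h
      have hq0 : dt a b q ≤ 0 := hside hq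
      set P := dt f0 a b
      set Q := dt a b q
      -- crossing parameter
      have hPQ : 0 < P - Q := by linarith
      set t0 := P / (P - Q) with ht0
      have ht0' : t0 * (P - Q) = P := by rw [ht0]; field_simp
      have hs' : s = 1 - t := by linarith
      have hlt : t0 < t := by
        rw [ht0, div_lt_iff₀ hPQ]; rw [hs'] at h; linarith
      have ht0n : 0 ≤ t0 := by rw [ht0]; positivity
      have hr0 : dt a b ((1 - t0) • f0 + t0 • q) = 0 := by
        rw [dt_combo _ _ _ _ (by ring), hf']; linarith
      have hr : (1 - t0) • f0 + t0 • q ∈ convexHull ℝ (W : Set Pl) := by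
        set r := (1 - t0) • f0 + t0 • q with hrdef
        have e1 := d1 (1 - t0) t0 ht0n (by ring)
        have e2 := d2 (1 - t0) t0 ht0n (by ring)
        rw [← hrdef] at e1 e2
        have e : dt f0 a r + dt b f0 r + dt a b r = P := by simp only [P, dt]; ring
        have hseg : r ∈ segment ℝ a b := by
          refine ⟨dt b f0 r / P, dt f0 a r / P, by positivity, by positivity, ?_, ?_⟩
          · rw [← add_div, div_eq_one_iff_eq hpos.ne']; linarith
          · have hP : P = dt f0 a b := rfl
            have hP0 : P ≠ 0 := hpos.ne'
            have hd : dt f0 a r = P - dt b f0 r := by linarith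
            ext
            · simp only [Prod.fst_add, Prod.smul_fst, smul_eq_mul]
              rw [← sub_eq_zero]
              field_simp
              have : dt b f0 r * a.1 + dt f0 a r * b.1 - P * r.1 = - dt a b r * f0.1 := by
                simp only [hP, dt]; ring
              rw [this, hr0]; simp
            · simp only [Prod.snd_add, Prod.smul_snd, smul_eq_mul]
              rw [← sub_eq_zero]
              field_simp
              have : dt b f0 r * a.2 + dt f0 a r * b.2 - P * r.2 = - dt a b r * f0.2 := by
                simp only [hP, dt]; ring
              rw [this, hr0]; simp
        exact segment_subset_convexHull (by simpa using ha) (by simpa using hb) hseg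
      have ht1 : t ≤ 1 := by linarith
      have h10 : 0 < 1 - t0 := by linarith
      have := (convex_convexHull ℝ (W : Set Pl)) hr hq
        (a := (1-t)/(1-t0)) (b := (t-t0)/(1-t0)) (by apply div_nonneg <;> linarith)
        (by apply div_nonneg <;> linarith) (by field_simp; ring)
      convert this using 1
      rw [hs']
      ext <;> simp <;> field_simp <;> ring
  · apply Set.union_subset
    · exact convexHull_mono (by rw [hW]; exact_mod_cast Finset.erase_subset _ _)
    · apply convexHull_mono
      rintro x (rfl | rfl | rfl)
      · exact hf
      · exact Finset.mem_of_mem_erase ha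
      · exact Finset.mem_of_mem_erase hb

end CC

end

section

open MeasureTheory Pointwise Topology

namespace CC

lemma pos_hull {V : Finset Pl} {l : ℝ × ℝ × ℝ} (h : ∀ v ∈ V, 0 < ev l v) :
    ∀ p ∈ convexHull ℝ (V : Set Pl), 0 < ev l p := by
  have : convexHull ℝ (V : Set Pl) ⊆ {p | 0 < ev l p} :=
    convexHull_min (fun w hw => h w hw) (convex_gt l 0)
  exact this

lemma integrable_inv {K : Set Pl} (hK : IsCompact K) {l : ℝ × ℝ × ℝ} (h : ∀ p ∈ K, 0 < ev l p) :
    IntegrableOn (fun p => ((ev l p)⁻¹)^3) K := by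
  apply ContinuousOn.integrableOn_compact hK
  apply ContinuousOn.pow
  exact ContinuousOn.inv₀ (ev_cont l).continuousOn (fun p hp => (h p hp).ne')

lemma Phi_ear {V : Finset Pl} (hV : CP V) (h3 : 3 ≤ V.card) {f : Pl} (hf : f ∈ V) :
    ∃ a ∈ V.erase f, ∃ b ∈ V.erase f, a ≠ b ∧ ∃ c : ℝ, 0 < c ∧ ∀ l, (∀ v ∈ V, 0 < ev l v) →
      Phi (convexHull ℝ (V : Set Pl)) l = Phi (convexHull ℝ ((V.erase f : Finset Pl) : Set Pl)) l +
        c / (ev l f * ev l a * ev l b) := by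
  obtain ⟨a, ha, b, hb, hpos, hun, hs1, hs2⟩ := ear hV h3 hf
  have hab : a ≠ b := by
    rintro rfl; rw [dt_self_right] at hpos; exact lt_irrefl _ hpos
  refine ⟨a, ha, b, hb, hab, |dt f a b| / 2, by positivity, ?_⟩
  intro l hl
  have ha' := hl a (Finset.mem_of_mem_erase ha)
  have hb' := hl b (Finset.mem_of_mem_erase hb)
  rw [← Phi_tri hpos.ne' l (hl f hf) ha' hb', hun]
  have hposV := pos_hull hl
  rw [hun] at hposV
  have k2 : IsCompact (convexHull ℝ ({f, a, b} : Set Pl)) :=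
    (Set.toFinite _).isCompact_convexHull ℝ
  unfold Phi
  apply setIntegral_union₀
  · apply measure_mono_null _ (dt_null hab)
    rintro p ⟨h1, h2⟩
    exact le_antisymm (hs1 h1) (hs2 h2)
  · exact k2.isClosed.measurableSet.nullMeasurableSet
  · exact integrable_inv ((Finset.finite_toSet _).isCompact_convexHull ℝ)
      (fun p hp => hposV p (Or.inl hp))
  · exact integrable_inv k2 (fun p hp => hposV p (Or.inr hp))

lemma ev_analytic (p : Pl) : AnalyticOnNhd ℝ (fun l => ev l p) Set.univ := by
  intro l _
  unfold ev
  have h1 : AnalyticAt ℝ (fun l : ℝ × ℝ × ℝ => l.1) l := analyticAt_fst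
  have h2 : AnalyticAt ℝ (fun l : ℝ × ℝ × ℝ => l.2.1) l :=
    analyticAt_fst.comp (f := fun l : ℝ × ℝ × ℝ => l.2) analyticAt_snd
  have h3 : AnalyticAt ℝ (fun l : ℝ × ℝ × ℝ => l.2.2) l :=
    analyticAt_snd.comp (f := fun l : ℝ × ℝ × ℝ => l.2) analyticAt_snd
  exact ((h1.mul analyticAt_const).add (h2.mul analyticAt_const)).add h3

/-- product of evaluations -/
noncomputable def PV (V : Finset Pl) (l : ℝ × ℝ × ℝ) : ℝ := ∏ u ∈ V, ev l u

lemma PV_analytic (V : Finset Pl) : AnalyticOnNhd ℝ (PV V) Set.univ := by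
  have : PV V = fun l => ∏ u ∈ V, ev l u := rfl
  rw [this]
  exact Finset.analyticOnNhd_fun_prod V (fun u _ => ev_analytic u)

/-- numerator property -/
def IsNum (V : Finset Pl) (N : ℝ × ℝ × ℝ → ℝ) : Prop :=
  AnalyticOnNhd ℝ N Set.univ ∧ ∀ l, (∀ v ∈ V, 0 < ev l v) →
    Phi (convexHull ℝ (V : Set Pl)) l * PV V l = N l

lemma num_step {V : Finset Pl} {f a b : Pl} (hf : f ∈ V) (ha : a ∈ V.erase f)
    (hb : b ∈ V.erase f) (hab : a ≠ b) {c : ℝ} {l : ℝ × ℝ × ℝ} (hl : ∀ v ∈ V, 0 < ev l v)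
    (x : ℝ) :
    (x + c / (ev l f * ev l a * ev l b)) * PV V l =
      ev l f * (x * PV (V.erase f) l) + c * PV (((V.erase f).erase a).erase b) l := by
  have e1 : PV V l = ev l f * PV (V.erase f) l := (Finset.mul_prod_erase V _ hf).symm
  have e2 : PV (V.erase f) l = ev l a * PV ((V.erase f).erase a) l :=
    (Finset.mul_prod_erase _ _ ha).symm
  have hb' : b ∈ (V.erase f).erase a := Finset.mem_erase.2 ⟨hab.symm, hb⟩
  have e3 : PV ((V.erase f).erase a) l = ev l b * PV (((V.erase f).erase a).erase b) l :=
    (Finset.mul_prod_erase _ _ hb').symm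
  have p1 := (hl f hf).ne'
  have p2 := (hl a (Finset.mem_of_mem_erase ha)).ne'
  have p3 := (hl b (Finset.mem_of_mem_erase hb)).ne'
  rw [e1, add_mul]
  congr 1
  · ring
  · rw [e2, e3]; field_simp

lemma hull_null {V : Finset Pl} (h : V.card < 3) : volume (convexHull ℝ (V : Set Pl)) = 0 := by
  have : V.card = 0 ∨ V.card = 1 ∨ V.card = 2 := by omega
  rcases this with h | h | h
  · rw [Finset.card_eq_zero] at h; subst h; simp
  · obtain ⟨a, rfl⟩ := Finset.card_eq_one.1 h; simp
  · obtain ⟨a, b, hab, rfl⟩ := Finset.card_eq_two.1 h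
    apply measure_mono_null _ (dt_null hab)
    apply convexHull_min
    · intro x hx
      simp only [Finset.coe_insert, Finset.coe_singleton, Set.mem_insert_iff,
        Set.mem_singleton_iff] at hx
      rcases hx with rfl | rfl
      · exact dt_self_left _ _
      · exact dt_self_right _ _
    · have := convex_eq (dl a b) 0; simpa [ev_dl] using this

lemma exists_num : ∀ (n : ℕ) (V : Finset Pl), V.card = n → CP V → ∃ N, IsNum V N := by
  intro n
  induction n with
  | zero =>
    intro V hn _
    refine ⟨fun _ => 0, analyticOnNhd_const, fun l _ => ?_⟩
    have := hull_null (V := V) (by omega)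
    rw [Phi, Measure.restrict_eq_zero.2 this]; simp
  | succ n ih =>
    intro V hn hV
    rcases lt_or_ge V.card 3 with h3 | h3
    · refine ⟨fun _ => 0, analyticOnNhd_const, fun l _ => ?_⟩
      have := hull_null h3
      rw [Phi, Measure.restrict_eq_zero.2 this]; simp
    obtain ⟨f, hf⟩ : V.Nonempty := Finset.card_pos.1 (by omega)
    obtain ⟨a, ha, b, hb, hab, c, hc, hPhi⟩ := Phi_ear hV h3 hf
    obtain ⟨N, hN1, hN2⟩ := ih (V.erase f) (by rw [Finset.card_erase_of_mem hf]; omega)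
      (hV.mono (Finset.erase_subset _ _))
    refine ⟨fun l => ev l f * N l + c * PV (((V.erase f).erase a).erase b) l, ?_, ?_⟩
    · exact ((ev_analytic f).mul hN1).add (analyticOnNhd_const.mul (PV_analytic _))
    · intro l hl
      rw [hPhi l hl, num_step hf ha hb hab hl,
        hN2 l (fun v hv => hl v (Finset.mem_of_mem_erase hv))]

lemma pos_nhds {K : Set Pl} (hK : IsCompact K) :
    ∀ᶠ l in 𝓝 ((0, 0, 1) : ℝ × ℝ × ℝ), ∀ p ∈ K, 0 < ev l p := by
  apply hK.eventually_forall_of_forall_eventually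
  intro p _
  have hc : Continuous (fun x : (ℝ × ℝ × ℝ) × Pl => ev x.1 x.2) := by unfold ev; fun_prop
  have : (0:ℝ) < (fun x : (ℝ × ℝ × ℝ) × Pl => ev x.1 x.2) ((0,0,1), p) := by simp [ev]
  exact hc.continuousAt.eventually (lt_mem_nhds this)

lemma analytic_eq {f g : ℝ × ℝ × ℝ → ℝ} (hf : AnalyticOnNhd ℝ f Set.univ)
    (hg : AnalyticOnNhd ℝ g Set.univ) (h : ∀ᶠ l in 𝓝 ((0, 0, 1) : ℝ × ℝ × ℝ), f l = g l) :
    f = g := hf.eq_of_eventuallyEq hg h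

/-- nonvanishing of numerators (R2) -/
lemma num_ne {V : Finset Pl} (hV : CP V) (h3 : 3 ≤ V.card) {N : ℝ × ℝ × ℝ → ℝ} (hN : IsNum V N)
    {f : Pl} (hf : f ∈ V) {l : ℝ × ℝ × ℝ} (h0 : ev l f = 0)
    (hne : ∀ u ∈ V, u ≠ f → ev l u ≠ 0) : N l ≠ 0 := by
  obtain ⟨a, ha, b, hb, hab, c, hc, hPhi⟩ := Phi_ear hV h3 hf
  obtain ⟨N', hN1, hN2⟩ := exists_num _ (V.erase f) rfl (hV.mono (Finset.erase_subset _ _))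
  have : N = fun l => ev l f * N' l + c * PV (((V.erase f).erase a).erase b) l := by
    apply analytic_eq hN.1
      (((ev_analytic f).mul hN1).add (analyticOnNhd_const.mul (PV_analytic _)))
    filter_upwards [pos_nhds V.finite_toSet.isCompact] with l hl
    rw [← hN.2 l hl, hPhi l hl, num_step hf ha hb hab hl,
        hN2 l (fun v hv => hl v (Finset.mem_of_mem_erase hv))]
    rfl
  rw [this]
  simp only [h0, zero_mul, zero_add]
  apply mul_ne_zero hc.ne'
  apply Finset.prod_ne_zero_iff.2
  intro u hu
  have hu' := Finset.mem_of_mem_erase (Finset.mem_of_mem_erase hu)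
  exact hne u (Finset.mem_of_mem_erase hu') (Finset.ne_of_mem_erase hu')

noncomputable def IsPoly.vts {K : Set Pl} (h : IsPoly K) : Finset Pl := h.ext_finite.toFinset

lemma IsPoly.mem_vts {K : Set Pl} (h : IsPoly K) {p : Pl} :
    p ∈ h.vts ↔ p ∈ Set.extremePoints ℝ K := by simp [IsPoly.vts]

lemma IsPoly.coe_vts {K : Set Pl} (h : IsPoly K) : (h.vts : Set Pl) = Set.extremePoints ℝ K := by
  simp [IsPoly.vts]

lemma IsPoly.hull_vts {K : Set Pl} (h : IsPoly K) : convexHull ℝ (h.vts : Set Pl) = K := by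
  rw [h.coe_vts, h.hull_ext]

lemma IsPoly.cp {K : Set Pl} (h : IsPoly K) : CP h.vts := by
  intro v hv
  apply ext_not_mem_hull h.convex (h.mem_vts.1 hv)
  · intro x hx
    simp only [Finset.coe_erase, Set.mem_sdiff, h.coe_vts] at hx
    exact hx.1.1
  · simp

lemma IsPoly.card {K : Set Pl} (h : IsPoly K) : 3 ≤ h.vts.card := by
  by_contra hcon
  have h0 := hull_null (V := h.vts) (by omega)
  rw [h.hull_vts] at h0
  have := (isOpen_interior.measure_pos volume h.2)
  exact absurd (measure_mono_null interior_subset h0) this.ne'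

lemma exists_generic {v : Pl} (S : Finset Pl) (hS : v ∉ S) :
    ∃ m, ev m v = 0 ∧ ∀ u ∈ S, ev m u ≠ 0 := by
  set bad : Finset ℝ := S.image (fun u => -(u.1 - v.1)/(u.2 - v.2)) with hb
  obtain ⟨c, hc⟩ := Infinite.exists_notMem_finset (insert 0 bad)
  rw [Finset.mem_insert, not_or] at hc
  refine ⟨(1, c, -v.1 - c * v.2), by simp only [ev]; ring, ?_⟩
  intro u hu h0
  simp only [ev] at h0
  rcases eq_or_ne (u.2 - v.2) 0 with h | h
  · have h2 : u.2 = v.2 := by linarith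
    have h1 : u.1 = v.1 := by rw [h2] at h0; linarith
    exact hS (by have : u = v := Prod.ext h1 h2
                 exact this ▸ hu)
  · apply hc.2
    rw [hb, Finset.mem_image]
    refine ⟨u, hu, ?_⟩
    field_simp; linarith

/-- product identity -/
def ID (K1 K2 K1' K2' : Set Pl) : Prop :=
  ∀ l, (∀ p ∈ K1, 0 < ev l p) → (∀ p ∈ K2, 0 < ev l p) → (∀ p ∈ K1', 0 < ev l p) →
    (∀ p ∈ K2', 0 < ev l p) → Phi K1 l * Phi K2 l = Phi K1' l * Phi K2' l

def Center (K : Set Pl) (v : Pl) : Prop :=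
  ∀ f ∈ Set.extremePoints ℝ K, ∃ f' ∈ Set.extremePoints ℝ K, f' ≠ f ∧ dt v f f' = 0

lemma pole {K1 K2 K1' K2' : Set Pl} (h1 : IsPoly K1) (h2 : IsPoly K2) (h1' : IsPoly K1')
    (h2' : IsPoly K2') (hid : ID K1 K2 K1' K2') {v : Pl} (hv2 : v ∈ Set.extremePoints ℝ K2)
    (hv1 : v ∉ Set.extremePoints ℝ K1) (hv1' : v ∉ Set.extremePoints ℝ K1')
    (hv2' : v ∉ Set.extremePoints ℝ K2') : Center K1 v := by
  obtain ⟨N1, hN1⟩ := exists_num _ h1.vts rfl h1.cp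
  obtain ⟨N2, hN2⟩ := exists_num _ h2.vts rfl h2.cp
  obtain ⟨N1', hN1'⟩ := exists_num _ h1'.vts rfl h1'.cp
  obtain ⟨N2', hN2'⟩ := exists_num _ h2'.vts rfl h2'.cp
  have key : (fun l => N1 l * N2 l * (PV h1'.vts l * PV h2'.vts l)) =
      fun l => N1' l * N2' l * (PV h1.vts l * PV h2.vts l) := by
    apply analytic_eq
    · exact (hN1.1.mul hN2.1).mul ((PV_analytic _).mul (PV_analytic _))
    · exact (hN1'.1.mul hN2'.1).mul ((PV_analytic _).mul (PV_analytic _))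
    filter_upwards [pos_nhds h1.compact, pos_nhds h2.compact, pos_nhds h1'.compact,
      pos_nhds h2'.compact] with l a1 a2 a1' a2'
    have b := hid l a1 a2 a1' a2'
    have c1 := hN1.2 l (fun v hv => a1 v (h1.mem_vts.1 hv).1)
    have c2 := hN2.2 l (fun v hv => a2 v (h2.mem_vts.1 hv).1)
    have c1' := hN1'.2 l (fun v hv => a1' v (h1'.mem_vts.1 hv).1)
    have c2' := hN2'.2 l (fun v hv => a2' v (h2'.mem_vts.1 hv).1)
    rw [h1.hull_vts] at c1
    rw [h2.hull_vts] at c2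
    rw [h1'.hull_vts] at c1'
    rw [h2'.hull_vts] at c2'
    rw [← c1, ← c2, ← c1', ← c2']
    linear_combination PV h1.vts l * PV h2.vts l * PV h1'.vts l * PV h2'.vts l * b
  classical
  set S : Finset Pl := (h1.vts ∪ h2.vts ∪ h1'.vts ∪ h2'.vts).erase v with hS
  have hgen : ∀ l, ev l v = 0 → (∀ u ∈ S, ev l u ≠ 0) → N1 l = 0 := by
    intro l hl hu
    have k := congrFun key l
    have p2 : PV h2.vts l = 0 := Finset.prod_eq_zero (h2.mem_vts.2 hv2) hl
    have n2 : N2 l ≠ 0 := num_ne h2.cp h2.card hN2 (h2.mem_vts.2 hv2) hl (by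
      intro u hu2 huv
      exact hu u (by simp [hS, huv, hu2]))
    have p1' : PV h1'.vts l ≠ 0 := by
      apply Finset.prod_ne_zero_iff.2
      intro u hu2
      have huv : u ≠ v := by rintro rfl; exact hv1' (h1'.mem_vts.1 hu2)
      exact hu u (by simp [hS, huv, hu2])
    have p2' : PV h2'.vts l ≠ 0 := by
      apply Finset.prod_ne_zero_iff.2
      intro u hu2
      have huv : u ≠ v := by rintro rfl; exact hv2' (h2'.mem_vts.1 hu2)
      exact hu u (by simp [hS, huv, hu2])
    rw [p2, mul_zero, mul_zero] at k
    simpa [n2, p1', p2'] using k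
  intro f hf
  have hfv : f ≠ v := by rintro rfl; exact hv1 hf
  by_contra hcon
  push Not at hcon
  obtain ⟨m, hm1, hm2⟩ := exists_generic S (v := v) (by simp [hS])
  set l := dl v f with hl
  have hlv : ev l v = 0 := by rw [hl, ev_dl, dt_self_left]
  have hlf : ev l f = 0 := by rw [hl, ev_dl, dt_self_right]
  have hN0 : N1 l = 0 := by
    have hc : Continuous N1 := by
      rw [continuous_iff_continuousAt]; intro x; exact (hN1.1 x trivial).continuousAt
    have ht : Filter.Tendsto (fun e : ℝ => N1 (l + e • m)) (𝓝[≠] 0) (𝓝 (N1 l)) := by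
      have : Continuous (fun e : ℝ => N1 (l + e • m)) := by fun_prop
      have h := (this.tendsto 0).mono_left (nhdsWithin_le_nhds (s := {0}ᶜ))
      simpa using h
    refine tendsto_nhds_unique_of_eventuallyEq ht tendsto_const_nhds ?_
    have hev : ∀ᶠ e in 𝓝[≠] (0:ℝ), ∀ u ∈ S, ev (l + e • m) u ≠ 0 := by
      rw [Filter.eventually_all_finset]
      intro u hu
      rcases eq_or_ne (ev l u) 0 with h0 | h0
      · filter_upwards [self_mem_nhdsWithin] with e he
        rw [ev_add, ev_smul, h0, zero_add]
        exact mul_ne_zero he (hm2 u hu)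
      · have hc : Continuous (fun e : ℝ => ev (l + e • m) u) := (ev_cont2 u).comp (by fun_prop)
        apply Filter.Eventually.filter_mono nhdsWithin_le_nhds
        exact hc.continuousAt.eventually_ne (by simpa using h0)
    filter_upwards [hev] with e he
    exact hgen _ (by rw [ev_add, ev_smul, hlv, hm1]; simp) he
  refine num_ne h1.cp h1.card hN1 (h1.mem_vts.2 hf) hlf ?_ hN0
  intro u hu huf
  rw [hl, ev_dl]
  exact hcon u (h1.mem_vts.1 hu) huf

lemma ext_subset_of_Phi {K K' : Set Pl} (h : IsPoly K) (h' : IsPoly K')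
    (he : ∀ᶠ l in 𝓝 ((0, 0, 1) : ℝ × ℝ × ℝ), Phi K l = Phi K' l) :
    Set.extremePoints ℝ K ⊆ Set.extremePoints ℝ K' := by
  intro f hf
  by_contra hf'
  obtain ⟨N, hN⟩ := exists_num _ h.vts rfl h.cp
  obtain ⟨N', hN'⟩ := exists_num _ h'.vts rfl h'.cp
  have key : (fun l => N l * PV h'.vts l) = fun l => N' l * PV h.vts l := by
    apply analytic_eq
    · exact hN.1.mul (PV_analytic _)
    · exact hN'.1.mul (PV_analytic _)
    filter_upwards [pos_nhds h.compact, pos_nhds h'.compact, he] with l a1 a2 b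
    have c1 := hN.2 l (fun v hv => a1 v (h.mem_vts.1 hv).1)
    have c2 := hN'.2 l (fun v hv => a2 v (h'.mem_vts.1 hv).1)
    rw [h.hull_vts] at c1
    rw [h'.hull_vts] at c2
    rw [← c1, ← c2]
    linear_combination PV h.vts l * PV h'.vts l * b
  classical
  obtain ⟨m, hm1, hm2⟩ := exists_generic ((h.vts ∪ h'.vts).erase f) (v := f) (by simp)
  have k := congrFun key m
  have p2 : PV h.vts m = 0 := Finset.prod_eq_zero (h.mem_vts.2 hf) hm1
  have n2 : N m ≠ 0 := num_ne h.cp h.card hN (h.mem_vts.2 hf) hm1 (by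
      intro u hu2 huv
      exact hm2 u (by simp [huv, hu2]))
  have p1' : PV h'.vts m ≠ 0 := by
      apply Finset.prod_ne_zero_iff.2
      intro u hu2
      have huv : u ≠ f := by rintro rfl; exact hf' (h'.mem_vts.1 hu2)
      exact hm2 u (by simp [huv, hu2])
  simp [p2, n2, p1'] at k

lemma Phi_pos {K : Set Pl} (h : IsPoly K) {l : ℝ × ℝ × ℝ} (hl : ∀ p ∈ K, 0 < ev l p) :
    0 < Phi K l := by
  unfold Phi
  rw [setIntegral_pos_iff_support_of_nonneg_ae]
  · have hsub : interior K ⊆ Function.support (fun p => ((ev l p)⁻¹)^3) ∩ K := by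
      intro p hp
      have := hl p (interior_subset hp)
      exact ⟨by simp only [Function.mem_support]; positivity, interior_subset hp⟩
    exact (isOpen_interior.measure_pos volume h.2).trans_le (measure_mono hsub)
  · filter_upwards [ae_restrict_mem h.closed.measurableSet] with p hp
    have := hl p hp
    simp only [Pi.zero_apply]; positivity
  · exact integrable_inv h.compact hl

/-- cancellation -/
lemma fin_cancel {F G F' : Set Pl} (h1 : IsPoly F) (h2 : IsPoly G) (h1' : IsPoly F')
    (hid : ID F G F' G) : F = F' := by
  have he : ∀ᶠ l in 𝓝 ((0, 0, 1) : ℝ × ℝ × ℝ), Phi F l = Phi F' l := by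
    filter_upwards [pos_nhds h1.compact, pos_nhds h2.compact, pos_nhds h1'.compact] with l a b c
    exact mul_right_cancel₀ (Phi_pos h2 b).ne' (hid l a b c b)
  have := (ext_subset_of_Phi h1 h1' he).antisymm (ext_subset_of_Phi h1' h1 (he.mono fun _ h => h.symm))
  rw [← h1.hull_ext, ← h1'.hull_ext, this]

lemma ID.comm {K1 K2 K1' K2' : Set Pl} (h : ID K1 K2 K1' K2') : ID K2 K1 K2' K1' := by
  intro l a b c d; rw [mul_comm, h l b a d c, mul_comm]
lemma ID.comm' {K1 K2 K1' K2' : Set Pl} (h : ID K1 K2 K1' K2') : ID K1 K2 K2' K1' := by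
  intro l a b c d; rw [h l a b d c, mul_comm]
lemma ID.symm {K1 K2 K1' K2' : Set Pl} (h : ID K1 K2 K1' K2') : ID K1' K2' K1 K2 := by
  intro l a b c d; rw [h l c d a b]

end CC

end

section

open MeasureTheory Pointwise Topology

namespace CC

/-- points on a line -/
lemma on_line {f g v : Pl} (hfg : f ≠ g) (h : dt f g v = 0) :
    ∃ t : ℝ, v = (1 - t) • f + t • g := by
  set d := (g.1 - f.1)^2 + (g.2 - f.2)^2 with hd
  have hd0 : d ≠ 0 := by
    intro h0
    apply hfg
    have a1 : g.1 - f.1 = 0 := by nlinarith [sq_nonneg (g.1-f.1), sq_nonneg (g.2-f.2)]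
    have a2 : g.2 - f.2 = 0 := by nlinarith [sq_nonneg (g.1-f.1), sq_nonneg (g.2-f.2)]
    ext <;> linarith
  refine ⟨((v.1-f.1)*(g.1-f.1) + (v.2-f.2)*(g.2-f.2))/d, ?_⟩
  simp only [dt] at h
  ext
  · simp only [Prod.fst_add, Prod.smul_fst, smul_eq_mul]
    rw [← sub_eq_zero]; field_simp; simp only [hd]
    linear_combination -(g.2-f.2)*h
  · simp only [Prod.snd_add, Prod.smul_snd, smul_eq_mul]
    rw [← sub_eq_zero]; field_simp; simp only [hd]
    linear_combination (g.1-f.1)*h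

lemma antipode {K : Set Pl} {v : Pl} (hv : v ∈ K) (hve : v ∉ Set.extremePoints ℝ K)
    {f f' : Pl} (hf : f ∈ Set.extremePoints ℝ K) (hf' : f' ∈ Set.extremePoints ℝ K)
    (hne : f' ≠ f) (h : dt v f f' = 0) :
    ∃ t : ℝ, 0 < t ∧ t < 1 ∧ v = (1 - t) • f + t • f' := by
  obtain ⟨t, ht⟩ := on_line (v := v) hne.symm (by rw [dt_rot]; exact h)
  have hvf : v ≠ f := by rintro rfl; exact hve hf
  have hvf' : v ≠ f' := by rintro rfl; exact hve hf'
  refine ⟨t, ?_, ?_, ht⟩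
  · by_contra hcon
    push Not at hcon
    rcases hcon.eq_or_lt with h0 | h0
    · subst h0; apply hvf; rw [ht]; simp
    · have hm : f ∈ openSegment ℝ v f' := by
        refine ⟨1/(1-t), -t/(1-t), by apply div_pos <;> linarith,
          by apply div_pos <;> linarith, ?_, ?_⟩
        · have : 1 - t ≠ 0 := by linarith
          field_simp; ring
        · have : 1 - t ≠ 0 := by linarith
          rw [ht]; ext <;> simp <;> field_simp <;> ring
      exact hvf (hf.2 hv hf'.1 hm)
  · by_contra hcon
    push Not at hcon
    rcases hcon.eq_or_lt with h0 | h0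
    · subst h0; apply hvf'; rw [ht]; simp
    · have hm : f' ∈ openSegment ℝ v f := by
        refine ⟨1/t, (t-1)/t, by apply div_pos <;> linarith,
          by apply div_pos <;> linarith, ?_, ?_⟩
        · have : t ≠ 0 := by linarith
          field_simp; ring
        · have : t ≠ 0 := by linarith
          rw [ht]; ext <;> simp <;> field_simp <;> ring
      exact hvf' (hf'.2 hv hf.1 hm)

/-- Lemma U -/
lemma two_centers {K : Set Pl} (hK : IsPoly K) {v1 v2 : Pl} (h12 : v1 ≠ v2)
    (hv1 : v1 ∈ K) (hv2 : v2 ∈ K) (hv1e : v1 ∉ Set.extremePoints ℝ K)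
    (hv2e : v2 ∉ Set.extremePoints ℝ K) (c1 : Center K v1) (c2 : Center K v2) : False := by
  set h := dt v1 v2 with hh
  set x : Pl → ℝ := ev (v2.1 - v1.1, v2.2 - v1.2, -((v2.1-v1.1)*v1.1 + (v2.2-v1.2)*v1.2)) with hx
  have hx1 : x v1 = 0 := by simp only [hx, ev]; ring
  have hx2 : 0 < x v2 := by
    have e : x v2 = (v2.1-v1.1)^2 + (v2.2-v1.2)^2 := by simp only [hx, ev]; ring
    rw [e]
    rcases eq_or_ne ((v2.1-v1.1)^2 + (v2.2-v1.2)^2) 0 with h0 | h0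
    · exfalso; apply h12
      have a1 : v2.1 - v1.1 = 0 := by nlinarith [sq_nonneg (v2.1-v1.1), sq_nonneg (v2.2-v1.2)]
      have a2 : v2.2 - v1.2 = 0 := by nlinarith [sq_nonneg (v2.1-v1.1), sq_nonneg (v2.2-v1.2)]
      ext <;> linarith
    · positivity
  have hh1 : h v1 = 0 := dt_self_left _ _
  have hh2 : h v2 = 0 := dt_self_right _ _
  -- antipodes
  have A : ∀ v ∈ K, v ∉ Set.extremePoints ℝ K → Center K v → ∀ f ∈ Set.extremePoints ℝ K,
      ∃ f' ∈ Set.extremePoints ℝ K, ∃ t : ℝ, 0 < t ∧ t < 1 ∧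
        h v = (1-t) * h f + t * h f' ∧ x v = (1-t) * x f + t * x f' := by
    intro v hv hve hc f hf
    obtain ⟨f', hf', hne, h0⟩ := hc f hf
    obtain ⟨t, t0, t1, e⟩ := antipode hv hve hf hf' hne h0
    refine ⟨f', hf', t, t0, t1, ?_, ?_⟩
    · rw [hh]; conv_lhs => rw [e]
      rw [dt_combo _ _ _ _ (by ring)]
    · rw [hx]; conv_lhs => rw [e]
      rw [ev_combo _ _ _ (by ring)]
  have hex : ∃ f ∈ Set.extremePoints ℝ K, 0 < h f := by
    by_contra hcon
    push Not at hcon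
    have hall : ∀ f ∈ Set.extremePoints ℝ K, h f = 0 := by
      intro f hf
      by_contra hne
      have hlt := lt_of_le_of_ne (hcon f hf) hne
      obtain ⟨f', hf', t, t0, t1, e, _⟩ := A v1 hv1 hv1e c1 f hf
      have := hcon f' hf'
      rw [hh1] at e
      nlinarith
    have hz : ∀ p ∈ K, ev (dl v1 v2) p = 0 := by
      have : K ⊆ {p | ev (dl v1 v2) p = 0} := hK.subset_of_ext (convex_eq _ _)
        (fun f hf => by simp only [Set.mem_ofPred_eq, ev_dl]; exact hall f hf)
      exact this
    have h0 := ev_zero_of_interior hK.2 hz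
    rcases dl_ne h12 with h' | h' <;> simp [h0] at h'
  classical
  set S := hK.vts.filter (fun f => 0 < h f) with hS
  obtain ⟨f, hfS, hmax⟩ := S.exists_max_image (fun f => x f / h f) (by
    obtain ⟨f, hf, h0⟩ := hex
    exact ⟨f, by rw [hS, Finset.mem_filter]; exact ⟨hK.mem_vts.2 hf, h0⟩⟩)
  rw [hS, Finset.mem_filter] at hfS
  obtain ⟨hf, hfpos⟩ := hfS
  obtain ⟨g, hg, t, t0, t1, e1, e2⟩ := A v1 hv1 hv1e c1 f (hK.mem_vts.1 hf)
  obtain ⟨f', hf', s, s0, s1, e3, e4⟩ := A v2 hv2 hv2e c2 g hg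
  rw [hh1] at e1; rw [hx1] at e2; rw [hh2] at e3
  have hgneg : h g < 0 := by nlinarith
  have hf'pos : 0 < h f' := by nlinarith
  have hm := hmax f' (by rw [hS, Finset.mem_filter]; exact ⟨hK.mem_vts.2 hf', hf'pos⟩)
  rw [div_le_div_iff₀ hf'pos hfpos] at hm
  have : t * s * (x f' * h f - x f * h f') = t * x v2 * h f := by
    linear_combination (- t * h f) * e4 + (1-s) * h f * e2 - (1-s) * x f * e1 + t * x f * e3
  have p1 : 0 < t * x v2 * h f := by positivity
  have p2 : 0 < t * s := by positivity
  nlinarith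

end CC

end

section

open MeasureTheory Pointwise Topology

namespace CC

/-- derivative step for the transform -/
lemma transform_deriv (μ : Measure ℝ) [IsFiniteMeasure μ] {R : ℝ} (hR : 0 < R)
    (hμ : ∀ᵐ x ∂μ, |x| ≤ R) (k : ℕ) {s : ℝ} (hs : s ∈ Set.Ioo (-(1/(2*R))) (1/(2*R))) :
    HasDerivAt (fun s => ∫ x, x^k * ((1 + s*x)⁻¹)^(k+3) ∂μ)
      (∫ x, -((k:ℝ)+3) * (x^(k+1) * ((1+s*x)⁻¹)^(k+4)) ∂μ) s := by
  have hb : ∀ t ∈ Set.Ioo (-(1/(2*R))) (1/(2*R)), ∀ x : ℝ, |x| ≤ R → 1/2 ≤ 1 + t*x := by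
    intro t ht x hx
    have h1 : |t| ≤ 1/(2*R) := abs_le.2 ⟨ht.1.le, ht.2.le⟩
    have h2 : |t*x| ≤ 1/(2*R) * R := by
      rw [abs_mul]; exact mul_le_mul h1 hx (abs_nonneg _) (by positivity)
    have h3 : 1/(2*R)*R = 1/2 := by field_simp
    rw [h3] at h2
    linarith [(abs_le.1 h2).1]
  have hinv : ∀ t ∈ Set.Ioo (-(1/(2*R))) (1/(2*R)), ∀ x : ℝ, |x| ≤ R → |(1 + t*x)⁻¹| ≤ 2 := by
    intro t ht x hx
    have := hb t ht x hx
    rw [abs_of_pos (by positivity)]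
    rw [inv_le_comm₀ (by linarith) (by norm_num)]; linarith
  have hmeas : ∀ (j n : ℕ) (t : ℝ), AEStronglyMeasurable (fun x : ℝ => x^j * ((1+t*x)⁻¹)^n) μ := by
    intro j n t
    apply Measurable.aestronglyMeasurable
    fun_prop
  have hbd : ∀ (j n : ℕ), ∀ t ∈ Set.Ioo (-(1/(2*R))) (1/(2*R)), ∀ x : ℝ, |x| ≤ R →
      ‖x^j * ((1 + t*x)⁻¹)^n‖ ≤ R^j * 2^n := by
    intro j n t ht x hx
    rw [norm_mul, norm_pow, norm_pow, Real.norm_eq_abs, Real.norm_eq_abs]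
    have := hinv t ht x hx
    gcongr
  refine (hasDerivAt_integral_of_dominated_loc_of_deriv_le (𝕜 := ℝ) (μ := μ)
    (F := fun s x => x^k * ((1 + s*x)⁻¹)^(k+3))
    (F' := fun s x => -((k:ℝ)+3) * (x^(k+1) * ((1+s*x)⁻¹)^(k+4)))
    (bound := fun _ => ((k:ℝ)+3) * (R^(k+1) * 2^(k+4)))
    (s := Set.Ioo (-(1/(2*R))) (1/(2*R)))
    (isOpen_Ioo.mem_nhds hs) ?_ ?_ ?_ ?_ ?_ ?_).2
  · filter_upwards with t using hmeas k (k+3) t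
  · exact Integrable.of_bound (hmeas k (k+3) s) (R^k * 2^(k+3))
      (hμ.mono fun x hx => hbd k (k+3) s hs x hx)
  · exact (hmeas (k+1) (k+4) s).const_mul _
  · filter_upwards [hμ] with x hx t ht
    rw [norm_mul]
    have e : ‖-((k:ℝ)+3)‖ = (k:ℝ)+3 := by rw [norm_neg, Real.norm_of_nonneg (by positivity)]
    rw [e]
    exact mul_le_mul_of_nonneg_left (hbd (k+1) (k+4) t ht x hx) (by positivity)
  · exact integrable_const _
  · filter_upwards [hμ] with x hx t ht
    have hp := hb t ht x hx
    have hne : 1 + t*x ≠ 0 := by linarith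
    have d1 : HasDerivAt (fun t : ℝ => 1 + t*x) (1*x) t :=
      ((hasDerivAt_id t).mul_const x).const_add 1
    have d2 := ((d1.inv hne).pow (k+3)).const_mul (x^k)
    refine d2.congr_deriv ?_
    simp only [Pi.inv_apply, show k + 3 - 1 = k + 2 from rfl]
    push_cast
    rw [div_eq_mul_inv, ← inv_pow]
    ring

lemma moments_eq (μ ν : Measure ℝ) [IsFiniteMeasure μ] [IsFiniteMeasure ν] {R r : ℝ} (hR : 0 < R)
    (hr : 0 < r) (hμ : ∀ᵐ x ∂μ, |x| ≤ R) (hν : ∀ᵐ x ∂ν, |x| ≤ R)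
    (h : ∀ s ∈ Set.Ioo (-r) r, ∫ x, ((1 + s*x)⁻¹)^3 ∂μ = ∫ x, ((1 + s*x)⁻¹)^3 ∂ν) (k : ℕ) :
    ∫ x, x^k ∂μ = ∫ x, x^k ∂ν := by
  set q := min r (1/(2*R)) with hq
  have hq0 : 0 < q := lt_min hr (by positivity)
  have key : ∀ k : ℕ, ∀ s ∈ Set.Ioo (-q) q,
      ∫ x, x^k * ((1 + s*x)⁻¹)^(k+3) ∂μ = ∫ x, x^k * ((1 + s*x)⁻¹)^(k+3) ∂ν := by
    intro k
    induction k with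
    | zero =>
      intro s hs
      have := h s ⟨by linarith [hs.1, min_le_left r (1/(2*R))],
        by linarith [hs.2, min_le_left r (1/(2*R))]⟩
      simpa using this
    | succ k ih =>
      intro s hs
      have hs' : s ∈ Set.Ioo (-(1/(2*R))) (1/(2*R)) :=
        ⟨by linarith [hs.1, min_le_right r (1/(2*R))], by linarith [hs.2, min_le_right r (1/(2*R))]⟩
      have d1 := transform_deriv μ hR hμ k hs'
      have d2 := transform_deriv ν hR hν k hs'
      have hev : (fun s => ∫ x, x^k * ((1 + s*x)⁻¹)^(k+3) ∂μ) =ᶠ[𝓝 s]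
          (fun s => ∫ x, x^k * ((1 + s*x)⁻¹)^(k+3) ∂ν) := by
        filter_upwards [isOpen_Ioo.mem_nhds hs] with t ht using ih t ht
      have e := (d2.congr_of_eventuallyEq hev).unique d1
      rw [integral_const_mul, integral_const_mul] at e
      have hk : -((k:ℝ)+3) ≠ 0 := by
        have : (0:ℝ) < (k:ℝ)+3 := by positivity
        linarith
      exact (mul_left_cancel₀ hk e).symm
  have := key k 0 ⟨by linarith, hq0⟩
  simpa using this

lemma measure_eq_of_moments (μ ν : Measure ℝ) [IsFiniteMeasure μ] [IsFiniteMeasure ν] {R : ℝ}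
    (hμ : ∀ᵐ x ∂μ, |x| ≤ R) (hν : ∀ᵐ x ∂ν, |x| ≤ R)
    (h : ∀ k : ℕ, ∫ x, x^k ∂μ = ∫ x, x^k ∂ν) : μ = ν := by
  have hpint : ∀ (μ : Measure ℝ) [IsFiniteMeasure μ], (∀ᵐ x ∂μ, |x| ≤ R) →
      ∀ k : ℕ, Integrable (fun x : ℝ => x^k) μ := by
    intro μ _ hμ k
    apply Integrable.of_bound (by fun_prop) (R^k)
    filter_upwards [hμ] with x hx
    rw [norm_pow, Real.norm_eq_abs]; gcongr
  have hpol : ∀ p : Polynomial ℝ, ∫ x, p.eval x ∂μ = ∫ x, p.eval x ∂ν := by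
    intro p
    simp_rw [Polynomial.eval_eq_sum_range]
    rw [integral_finsetSum _ (fun i _ => (hpint μ hμ i).const_mul _),
      integral_finsetSum _ (fun i _ => (hpint ν hν i).const_mul _)]
    apply Finset.sum_congr rfl
    intro i _
    rw [integral_const_mul, integral_const_mul, h]
  have hpolint : ∀ (μ : Measure ℝ) [IsFiniteMeasure μ], (∀ᵐ x ∂μ, |x| ≤ R) →
      ∀ p : Polynomial ℝ, Integrable (fun x : ℝ => p.eval x) μ := by
    intro μ _ hμ p
    simp_rw [Polynomial.eval_eq_sum_range]
    exact integrable_finsetSum _ (fun i _ => (hpint μ hμ i).const_mul _)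
  apply ext_of_forall_integral_eq_of_IsFiniteMeasure
  intro f
  have hfint : ∀ (μ : Measure ℝ) [IsFiniteMeasure μ], Integrable (fun x => f x) μ :=
    fun μ _ => f.integrable μ
  have est : ∀ (μ : Measure ℝ) [IsFiniteMeasure μ], (∀ᵐ x ∂μ, |x| ≤ R) → ∀ ε : ℝ,
      ∀ p : Polynomial ℝ, (∀ x ∈ Set.Icc (-R) R, |p.eval x - f x| < ε) →
      |∫ x, f x ∂μ - ∫ x, p.eval x ∂μ| ≤ ε * μ.real Set.univ := by
    intro μ _ hμ ε p hp
    rw [← integral_sub (hfint μ) (hpolint μ hμ p), ← Real.norm_eq_abs]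
    apply norm_integral_le_of_norm_le_const
    filter_upwards [hμ] with x hx
    rw [Real.norm_eq_abs, abs_sub_comm]
    exact (hp x (abs_le.1 hx)).le
  by_contra hne
  set D := |∫ x, f x ∂μ - ∫ x, f x ∂ν| with hD
  have hDpos : 0 < D := abs_pos.2 (sub_ne_zero.2 hne)
  set M := μ.real Set.univ + ν.real Set.univ + 1 with hM
  have hMpos : 0 < M := by positivity
  obtain ⟨p, hp⟩ := exists_polynomial_near_of_continuousOn (-R) R (fun x => f x)
    f.continuous.continuousOn (D/(2*M)) (by positivity)
  have e1 := est μ hμ _ p hp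
  have e2 := est ν hν _ p hp
  rw [hpol p] at e1
  have : D ≤ D/(2*M) * μ.real Set.univ + D/(2*M) * ν.real Set.univ := by
    calc D ≤ |∫ x, f x ∂μ - ∫ x, p.eval x ∂ν| + |∫ x, p.eval x ∂ν - ∫ x, f x ∂ν| :=
          abs_sub_le _ _ _
      _ ≤ _ := by rw [abs_sub_comm (∫ x, p.eval x ∂ν)]; exact add_le_add e1 e2
  have h2 : D/(2*M) * μ.real Set.univ + D/(2*M) * ν.real Set.univ ≤ D/(2*M) * M := by
    rw [← mul_add]; apply mul_le_mul_of_nonneg_left _ (by positivity); linarith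
  have h3 : D/(2*M)*M = D/2 := by field_simp
  linarith

/-- vertical sections -/
lemma sec_usc {S : Set Pl} (hS : IsCompact S) (x0 : ℝ) {c : ENNReal}
    (hc : volume (Prod.mk x0 ⁻¹' S) < c) : ∀ᶠ x in 𝓝 x0, volume (Prod.mk x ⁻¹' S) < c := by
  obtain ⟨V, hV1, hV2, hV3⟩ := Set.exists_isOpen_lt_of_lt _ c hc
  have hcomp : IsCompact (S \ (Prod.snd ⁻¹' V)) := hS.diff (hV2.preimage continuous_snd)
  have hcl := (hcomp.image continuous_fst).isClosed
  have hx : x0 ∉ Prod.fst '' (S \ (Prod.snd ⁻¹' V)) := by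
    rintro ⟨⟨a, b⟩, ⟨h1, h2⟩, rfl⟩
    exact h2 (hV1 h1)
  filter_upwards [hcl.isOpen_compl.mem_nhds hx] with x hx
  refine lt_of_le_of_lt (measure_mono ?_) hV3
  intro t ht
  by_contra htV
  exact hx ⟨(x, t), ⟨ht, htV⟩, rfl⟩

lemma sec_le {S S' : Set Pl} (hSc : Convex ℝ S) (hSi : (interior S).Nonempty)
    (hS' : IsCompact S')
    (hae : ∀ᵐ x : ℝ, volume (Prod.mk x ⁻¹' S) = volume (Prod.mk x ⁻¹' S')) (x0 : ℝ) :
    volume (Prod.mk x0 ⁻¹' S) ≤ volume (Prod.mk x0 ⁻¹' S') := by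
  by_contra hlt
  push Not at hlt
  -- a point of `S` with different first coordinate
  obtain ⟨q, hq, hqx⟩ : ∃ q ∈ S, q.1 ≠ x0 := by
    by_contra hcon
    push Not at hcon
    have := ev_zero_of_interior hSi (l := (1, 0, -x0)) (by
      intro p hp; simp only [ev]; rw [hcon p hp]; ring)
    simp at this
  obtain ⟨c, hc1, hc2⟩ := exists_between hlt
  have hev := sec_usc hS' x0 hc1
  -- pull back to theta
  have hpath : Filter.Tendsto (fun θ : ℝ => (1-θ) * x0 + θ * q.1) (𝓝[>] 0) (𝓝 x0) := by
    have : Continuous (fun θ : ℝ => (1-θ) * x0 + θ * q.1) := by fun_prop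
    have h := (this.tendsto 0).mono_left (nhdsWithin_le_nhds (s := Set.Ioi 0))
    simpa using h
  have h1 : ∀ᶠ θ in 𝓝[>] (0:ℝ), volume (Prod.mk ((1-θ) * x0 + θ * q.1) ⁻¹' S') < c :=
    hpath.eventually hev
  have h2 : ∀ᶠ θ in 𝓝[>] (0:ℝ), c < ENNReal.ofReal (1-θ) * volume (Prod.mk x0 ⁻¹' S) := by
    have ht : Filter.Tendsto (fun θ : ℝ => ENNReal.ofReal (1-θ) * volume (Prod.mk x0 ⁻¹' S))
        (𝓝[>] 0) (𝓝 (ENNReal.ofReal (1-0) * volume (Prod.mk x0 ⁻¹' S))) := by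
      apply ENNReal.Tendsto.mul_const
      · have : Continuous (fun θ : ℝ => ENNReal.ofReal (1-θ)) :=
          ENNReal.continuous_ofReal.comp (by fun_prop)
        exact (this.tendsto 0).mono_left nhdsWithin_le_nhds
      · left; simp
    refine ht.eventually (lt_mem_nhds ?_)
    simpa using hc2
  have h3 : ∀ᶠ θ in 𝓝[>] (0:ℝ), θ < 1 := by
    apply Filter.Eventually.filter_mono nhdsWithin_le_nhds
    exact gt_mem_nhds zero_lt_one
  have hall := (h1.and (h2.and h3))
  rw [eventually_nhdsWithin_iff, Metric.eventually_nhds_iff] at hall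
  obtain ⟨ε, he, hall⟩ := hall
  -- the open interval of x
  have hbad : ∀ θ ∈ Set.Ioo 0 ε, volume (Prod.mk ((1-θ) * x0 + θ * q.1) ⁻¹' S) ≠
      volume (Prod.mk ((1-θ) * x0 + θ * q.1) ⁻¹' S') := by
    intro θ hθ heq
    obtain ⟨a1, a2, a3⟩ := hall (by rw [Real.dist_eq, sub_zero, abs_of_pos hθ.1]; exact hθ.2) hθ.1
    rw [← heq] at a1
    have hsub : (fun t => θ * q.2 + t) '' ((1-θ) • (Prod.mk x0 ⁻¹' S)) ⊆
        Prod.mk ((1-θ) * x0 + θ * q.1) ⁻¹' S := by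
      rintro _ ⟨_, ⟨t, ht, rfl⟩, rfl⟩
      have := hSc ht hq (a := 1-θ) (b := θ) (by linarith) hθ.1.le (by ring)
      simp only [Set.mem_preimage]
      convert this using 1
      ext <;> simp; ring
    have hm := measure_mono (μ := volume) hsub
    rw [Set.image_add_left, measure_preimage_add, Measure.addHaar_smul] at hm
    simp only [Module.finrank_self, pow_one, abs_of_pos (show 0 < 1-θ by linarith)] at hm
    exact absurd (a2.trans_le hm) (not_lt.2 a1.le)
  have hnull : volume {x : ℝ | ¬ volume (Prod.mk x ⁻¹' S) = volume (Prod.mk x ⁻¹' S')} = 0 := hae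
  have himg : (fun θ : ℝ => (1-θ) * x0 + θ * q.1) '' Set.Ioo 0 ε ⊆
      {x : ℝ | ¬ volume (Prod.mk x ⁻¹' S) = volume (Prod.mk x ⁻¹' S')} := by
    rintro _ ⟨θ, hθ, rfl⟩; exact hbad θ hθ
  have e1 : (fun θ : ℝ => (1-θ) * x0 + θ * q.1) '' Set.Ioo 0 ε =
      (fun t => x0 + t) '' ((q.1 - x0) • Set.Ioo 0 ε) := by
    rw [← Set.image_smul, Set.image_image]
    apply Set.image_congr
    intro θ _
    simp only [smul_eq_mul]; ring
  have h0 := measure_mono_null himg hnull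
  rw [e1, Set.image_add_left, measure_preimage_add, Measure.addHaar_smul] at h0
  simp only [Module.finrank_self, pow_one, Real.volume_Ioo, sub_zero, mul_eq_zero,
    ENNReal.ofReal_eq_zero] at h0
  rcases h0 with h0 | h0
  · have := abs_pos.2 (sub_ne_zero.2 hqx); linarith
  · linarith

lemma sec_ae {S S' : Set Pl} (hS : IsCompact S) (hS' : IsCompact S') {r : ℝ} (hr : 0 < r)
    (h : ∀ s ∈ Set.Ioo (-r) r,
      ∫ q in S, ((1 + s * q.1)⁻¹)^3 = ∫ q in S', ((1 + s * q.1)⁻¹)^3) :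
    ∀ᵐ x : ℝ, volume (Prod.mk x ⁻¹' S) = volume (Prod.mk x ⁻¹' S') := by
  have hden : ∀ S : Set Pl, IsCompact S → (volume.restrict S).map Prod.fst =
      volume.withDensity (fun x : ℝ => volume (Prod.mk x ⁻¹' S)) := by
    intro S hS
    ext A hA
    rw [Measure.map_apply measurable_fst hA, Measure.restrict_apply (measurable_fst hA),
      withDensity_apply _ hA, Measure.volume_eq_prod, Measure.prod_apply
        ((measurable_fst hA).inter hS.measurableSet), ← lintegral_indicator hA]
    congr 1
    ext x
    by_cases hx : x ∈ A
    · rw [Set.indicator_of_mem hx]; congr 1; ext t; simp [hx]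
    · rw [Set.indicator_of_notMem hx]
      have : Prod.mk x ⁻¹' (Prod.fst ⁻¹' A ∩ S) = ∅ := by ext t; simp [hx]
      rw [this]; simp
  have hfin : ∀ S : Set Pl, IsCompact S → IsFiniteMeasure ((volume.restrict S).map Prod.fst) := by
    intro S hS
    have : IsFiniteMeasure (volume.restrict S) :=
      ⟨by rw [Measure.restrict_apply_univ]; exact hS.measure_lt_top⟩
    exact Measure.isFiniteMeasure_map _ _
  have := hfin S hS
  have := hfin S' hS'
  obtain ⟨R, hR0, hR⟩ : ∃ R : ℝ, 0 < R ∧ ∀ q ∈ S ∪ S', |q.1| ≤ R := by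
    obtain ⟨R, hR⟩ := ((hS.union hS').image continuous_fst).isBounded.exists_norm_le
    refine ⟨max R 1, by positivity, fun q hq => ?_⟩
    exact (hR _ ⟨q, hq, rfl⟩).trans (le_max_left _ _)
  have hsupp : ∀ S0 : Set Pl, IsCompact S0 → S0 ⊆ S ∪ S' →
      ∀ᵐ x ∂((volume.restrict S0).map Prod.fst), |x| ≤ R := by
    intro S0 hS0 hsub
    rw [ae_map_iff measurable_fst.aemeasurable (measurableSet_le (by fun_prop) (by fun_prop))]
    filter_upwards [ae_restrict_mem hS0.measurableSet] with q hq
    exact hR q (hsub hq)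
  have a1 := hsupp S hS Set.subset_union_left
  have a2 := hsupp S' hS' Set.subset_union_right
  have heq : (volume.restrict S).map Prod.fst = (volume.restrict S').map Prod.fst := by
    apply measure_eq_of_moments _ _ a1 a2
    intro k
    apply moments_eq _ _ hR0 hr a1 a2
    intro s hs
    have hm : Measurable (fun x : ℝ => ((1 + s*x)⁻¹)^3) := by fun_prop
    rw [integral_map measurable_fst.aemeasurable hm.aestronglyMeasurable,
      integral_map measurable_fst.aemeasurable hm.aestronglyMeasurable]
    exact h s hs
  rw [hden S hS, hden S' hS'] at heq
  have hms : ∀ S : Set Pl, IsCompact S → Measurable (fun x : ℝ => volume (Prod.mk x ⁻¹' S)) :=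
    fun S hS => measurable_measure_prodMk_left hS.measurableSet
  refine (withDensity_eq_iff (hms S hS).aemeasurable (hms S' hS').aemeasurable ?_).1 heq
  have hp := Measure.prod_apply (μ := (volume : Measure ℝ)) (ν := (volume : Measure ℝ)) hS.measurableSet
  rw [← Measure.volume_eq_prod] at hp
  rw [← hp]
  exact hS.measure_lt_top.ne

lemma sec_eq {S S' : Set Pl} (hS : IsCompact S) (hS' : IsCompact S') (hc : Convex ℝ S)
    (hc' : Convex ℝ S') (hi : (interior S).Nonempty) (hi' : (interior S').Nonempty)
    {r : ℝ} (hr : 0 < r)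
    (h : ∀ s ∈ Set.Ioo (-r) r,
      ∫ q in S, ((1 + s * q.1)⁻¹)^3 = ∫ q in S', ((1 + s * q.1)⁻¹)^3) (x : ℝ) :
    volume (Prod.mk x ⁻¹' S) = volume (Prod.mk x ⁻¹' S') := by
  have := sec_ae hS hS' hr h
  exact le_antisymm (sec_le hc hi hS' this x)
    (sec_le hc' hi' hS (this.mono fun _ h => h.symm) x)

end CC

end

section

open MeasureTheory Pointwise Topology

namespace CC

lemma IsPoly.expose_of_ext {K : Set Pl} (h : IsPoly K) {z : Pl}
    (hz : z ∈ Set.extremePoints ℝ K) {l : ℝ × ℝ × ℝ} (hlz : ev l z = 0)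
    (hl : ∀ u ∈ Set.extremePoints ℝ K, u ≠ z → 0 < ev l u) : ∀ p ∈ K, p ≠ z → 0 < ev l p := by
  set S := Set.extremePoints ℝ K \ {z} with hS
  intro p hp hpz
  have hK : K = convexHull ℝ (insert z S) := by
    rw [hS, Set.insert_sdiff_singleton, Set.insert_eq_of_mem hz, h.hull_ext]
  rw [hK] at hp
  rcases S.eq_empty_or_nonempty with h0 | h0
  · rw [h0] at hp; simp at hp; exact absurd hp hpz
  have hSpos : convexHull ℝ S ⊆ {p | 0 < ev l p} := convexHull_min
    (fun u hu => hl u hu.1 hu.2) (convex_gt l 0)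
  rw [convexHull_insert h0, mem_convexJoin] at hp
  obtain ⟨a, ha, b, hb, hpab⟩ := hp
  rw [Set.mem_singleton_iff] at ha; subst ha
  obtain ⟨s, t, hs, ht, hst, rfl⟩ := hpab
  rw [ev_combo l _ _ hst, hlz, mul_zero, zero_add]
  have hb : 0 < ev l b := hSpos hb
  have ht0 : t ≠ 0 := by
    rintro rfl
    apply hpz
    have : s = 1 := by linarith
    subst this; simp
  have : 0 < t := lt_of_le_of_ne ht (Ne.symm ht0)
  positivity

lemma Phi_cont {K : Set Pl} (h : IsPoly K) {l : ℝ × ℝ × ℝ} (hl : ∀ p ∈ K, 0 < ev l p)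
    {ι : Type*} {f : Filter ι} {L : ι → ℝ × ℝ × ℝ} (hL : Filter.Tendsto L f (𝓝 l))
    (hp : ∀ᶠ i in f, ∀ p ∈ K, 0 < ev (L i) p) :
    Filter.Tendsto (fun i => Phi K (L i)) f (𝓝 (Phi K l)) := by
  obtain ⟨N, hN⟩ := exists_num _ h.vts rfl h.cp
  have hPne : ∀ l, (∀ p ∈ K, 0 < ev l p) → PV h.vts l ≠ 0 := by
    intro l hl
    apply Finset.prod_ne_zero_iff.2
    intro u hu; exact (hl u (h.mem_vts.1 hu).1).ne'
  have e : ∀ l, (∀ p ∈ K, 0 < ev l p) → Phi K l = N l / PV h.vts l := by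
    intro l hl
    have c1 := hN.2 l (fun v hv => hl v (h.mem_vts.1 hv).1)
    rw [h.hull_vts] at c1
    rw [← c1, mul_div_cancel_right₀ _ (hPne l hl)]
  rw [e l hl]
  have hc : ContinuousAt (fun l => N l / PV h.vts l) l :=
    (hN.1 l trivial).continuousAt.div (PV_analytic _ l trivial).continuousAt (hPne l hl)
  refine (hc.tendsto.comp hL).congr' ?_
  filter_upwards [hp] with i hi
  exact (e _ hi).symm

lemma Phi_out_bound {K V : Set Pl} (hK : IsCompact K) (hV : IsOpen V) {z : Pl} (hz : z ∈ V)
    {l : ℝ × ℝ × ℝ} (hl : ∀ p ∈ K, p ≠ z → 0 < ev l p) :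
    ∃ M : ℝ, 0 ≤ M ∧ ∀ ε : ℝ, 0 < ε → |∫ p in K \ V, ((ev (l + (0,0,ε)) p)⁻¹)^3| ≤ M := by
  have hc : IsCompact (K \ V) := hK.diff hV
  rcases (K \ V).eq_empty_or_nonempty with h0 | h0
  · exact ⟨0, le_rfl, fun ε _ => by rw [h0]; simp⟩
  obtain ⟨p0, hp0, hmin⟩ := hc.exists_isMinOn h0 (ev_cont l).continuousOn
  have hpz : p0 ≠ z := by rintro rfl; exact hp0.2 hz
  have hd := hl p0 hp0.1 hpz
  refine ⟨((ev l p0)⁻¹)^3 * volume.real (K \ V), by positivity, fun ε he => ?_⟩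
  rw [← Real.norm_eq_abs]
  apply norm_setIntegral_le_of_norm_le_const hc.measure_lt_top
  intro p hp
  have h1 : ev l p0 ≤ ev l p := hmin hp
  have e : ev (l + (0,0,ε)) p = ev l p + ε := by rw [ev_add]; simp [ev]
  rw [e, Real.norm_of_nonneg (by have : 0 < ev l p + ε := by linarith
                                 positivity)]
  have : ev l p0 ≤ ev l p + ε := by linarith
  have hpp : 0 < ev l p + ε := by linarith
  have hpi : 0 ≤ (ev l p + ε)⁻¹ := by positivity
  gcongr

/-- step x2 -/
lemma Phi_eq_of_expose {F G F' G' : Set Pl} (hF : IsPoly F) (hG : IsPoly G) (hF' : IsPoly F')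
    (hG' : IsPoly G') (hid : ID F G F' G') {z : Pl} (hz : z ∈ Set.extremePoints ℝ F)
    {U : Set Pl} (hU : U ∈ 𝓝 z) (hloc : F ∩ U = F' ∩ U) {l : ℝ × ℝ × ℝ}
    (hlz : ev l z = 0) (h1 : ∀ p ∈ F, p ≠ z → 0 < ev l p) (h1' : ∀ p ∈ F', p ≠ z → 0 < ev l p)
    (h2 : ∀ p ∈ G, 0 < ev l p) (h2' : ∀ p ∈ G', 0 < ev l p) : Phi G l = Phi G' l := by
  obtain ⟨V, hVU, hVo, hzV⟩ := mem_nhds_iff.1 hU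
  have hlocV : F ∩ V = F' ∩ V := by
    ext p; constructor
    · rintro ⟨a, b⟩; exact ⟨(hloc ▸ (⟨a, hVU b⟩ : p ∈ F ∩ U) : p ∈ F' ∩ U).1, b⟩
    · rintro ⟨a, b⟩; exact ⟨(hloc.symm ▸ (⟨a, hVU b⟩ : p ∈ F' ∩ U) : p ∈ F ∩ U).1, b⟩
  have e : ∀ (ε : ℝ) (p : Pl), ev (l + (0,0,ε)) p = ev l p + ε := by
    intro ε p; rw [ev_add]; simp [ev]
  have pos : ∀ K : Set Pl, (∀ p ∈ K, p ≠ z → 0 < ev l p) → ∀ ε : ℝ, 0 < ε →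
      ∀ p ∈ K, 0 < ev (l + (0,0,ε)) p := by
    intro K hK ε he p hp
    rw [e]
    by_cases hpz : p = z
    · rw [hpz, hlz]; linarith
    · linarith [hK p hp hpz]
  obtain ⟨M, hM0, hM⟩ := Phi_out_bound hF.compact hVo hzV h1
  obtain ⟨M', hM0', hM'⟩ := Phi_out_bound hF'.compact hVo hzV h1'
  have hdiff : ∀ ε : ℝ, 0 < ε → |Phi F' (l + (0,0,ε)) - Phi F (l + (0,0,ε))| ≤ M' + M := by
    intro ε he
    have s1 := integral_inter_add_sdiff (μ := volume) (s := F) hVo.measurableSet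
      (integrable_inv hF.compact (pos F h1 ε he))
    have s2 := integral_inter_add_sdiff (μ := volume) (s := F') hVo.measurableSet
      (integrable_inv hF'.compact (pos F' h1' ε he))
    unfold Phi
    rw [← s1, ← s2, hlocV, add_sub_add_left_eq_sub]
    exact (abs_sub _ _).trans (add_le_add (hM' ε he) (hM ε he))
  obtain ⟨a, ha, b, hb, hab, c, hc, hear⟩ := Phi_ear hF.cp hF.card (hF.mem_vts.2 hz)
  have ha0 := h1 a (hF.mem_vts.1 (Finset.mem_of_mem_erase ha)).1 (Finset.ne_of_mem_erase ha)
  have hb0 := h1 b (hF.mem_vts.1 (Finset.mem_of_mem_erase hb)).1 (Finset.ne_of_mem_erase hb)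
  have hlow : ∀ ε : ℝ, 0 < ε → c / (ε * (ev l a + ε) * (ev l b + ε)) ≤ Phi F (l + (0,0,ε)) := by
    intro ε he
    have hh := hear (l + (0,0,ε)) (fun v hv => pos F h1 ε he v (hF.mem_vts.1 hv).1)
    rw [hF.hull_vts, e, e, e, hlz, zero_add] at hh
    rw [hh]
    have hnn : 0 ≤ Phi (convexHull ℝ ((hF.vts.erase z : Finset Pl) : Set Pl)) (l + (0,0,ε)) := by
      unfold Phi
      apply setIntegral_nonneg (Set.Finite.isClosed_convexHull ℝ (Finset.finite_toSet _)).measurableSet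
      intro p hp
      have hpF : p ∈ F := by
        rw [← hF.hull_vts]
        exact convexHull_mono (by exact_mod_cast Finset.erase_subset _ _) hp
      have := pos F h1 ε he p hpF
      positivity
    linarith
  set g := fun ε : ℝ => Phi G (l + (0,0,ε))
  set g' := fun ε : ℝ => Phi G' (l + (0,0,ε))
  have hL : Filter.Tendsto (fun ε : ℝ => l + (0,0,ε)) (𝓝[>] 0) (𝓝 l) := by
    have hcc : Continuous (fun ε : ℝ => l + (0,0,ε)) := by fun_prop
    have := (hcc.tendsto 0).mono_left (nhdsWithin_le_nhds (s := Set.Ioi 0))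
    have h00 : l + ((0:ℝ),(0:ℝ),(0:ℝ)) = l := by ext <;> simp
    rw [h00] at this
    exact this
  have hg : Filter.Tendsto g (𝓝[>] 0) (𝓝 (Phi G l)) := Phi_cont hG h2 hL (by
    filter_upwards [self_mem_nhdsWithin] with ε he
    exact pos G (fun p hp _ => h2 p hp) ε he)
  have hg' : Filter.Tendsto g' (𝓝[>] 0) (𝓝 (Phi G' l)) := Phi_cont hG' h2' hL (by
    filter_upwards [self_mem_nhdsWithin] with ε he
    exact pos G' (fun p hp _ => h2' p hp) ε he)
  have hbound : ∀ᶠ ε in 𝓝[>] (0:ℝ), |g ε - g' ε| ≤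
      |g' ε| * (M' + M) * (ε * (ev l a + ε) * (ev l b + ε) / c) := by
    filter_upwards [self_mem_nhdsWithin] with ε he
    have he : 0 < ε := he
    have hi := hid _ (pos F h1 ε he) (pos G (fun p hp _ => h2 p hp) ε he) (pos F' h1' ε he)
      (pos G' (fun p hp _ => h2' p hp) ε he)
    have hlo := hlow ε he
    have hdi := hdiff ε he
    have hPF : 0 < Phi F (l + (0,0,ε)) := Phi_pos hF (pos F h1 ε he)
    have e1 : (g ε - g' ε) * Phi F (l + (0,0,ε)) =
        g' ε * (Phi F' (l + (0,0,ε)) - Phi F (l + (0,0,ε))) := by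
      simp only [g, g']; linear_combination hi
    have e2 : |g ε - g' ε| * Phi F (l + (0,0,ε)) ≤ |g' ε| * (M' + M) := by
      have := congrArg abs e1
      rw [abs_mul, abs_mul, abs_of_pos hPF] at this
      rw [this]; gcongr
    have hX : 0 < ε * (ev l a + ε) * (ev l b + ε) := by positivity
    have e3 : |g ε - g' ε| * (c / (ε * (ev l a + ε) * (ev l b + ε))) ≤ |g' ε| * (M' + M) :=
      (mul_le_mul_of_nonneg_left hlo (abs_nonneg _)).trans e2
    calc |g ε - g' ε| = |g ε - g' ε| * (c / (ε * (ev l a + ε) * (ev l b + ε))) *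
          (ε * (ev l a + ε) * (ev l b + ε) / c) := by field_simp
      _ ≤ _ := mul_le_mul_of_nonneg_right e3 (by positivity)
  have hR : Filter.Tendsto (fun ε => |g' ε| * (M' + M) * (ε * (ev l a + ε) * (ev l b + ε) / c))
      (𝓝[>] 0) (𝓝 (|Phi G' l| * (M' + M) * 0)) := by
    apply (hg'.abs.mul_const _).mul
    have hcc : Continuous (fun ε : ℝ => ε * (ev l a + ε) * (ev l b + ε) / c) := by fun_prop
    have := (hcc.tendsto 0).mono_left (nhdsWithin_le_nhds (s := Set.Ioi 0))
    simpa using this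
  have := le_of_tendsto_of_tendsto (hg.sub hg').abs hR hbound
  rw [mul_zero] at this
  have := abs_nonpos_iff.1 this
  linarith

/-- projective coordinates -/
noncomputable def ph (l : ℝ × ℝ × ℝ) (z : Pl) (q : Pl) : Pl :=
  z + q.2⁻¹ • (q.1 • ((l.2.1/(l.1^2+l.2.1^2), -l.1/(l.1^2+l.2.1^2)) : Pl) +
    ((l.1/(l.1^2+l.2.1^2), l.2.1/(l.1^2+l.2.1^2)) : Pl))

/-- transversal functional -/
def tm (l : ℝ × ℝ × ℝ) (z : Pl) : ℝ × ℝ × ℝ := (l.2.1, -l.1, -(l.2.1 * z.1 - l.1 * z.2))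

/-- inverse projective coordinates -/
noncomputable def ps (l : ℝ × ℝ × ℝ) (z : Pl) (p : Pl) : Pl :=
  (ev (tm l z) p / ev l p, (ev l p)⁻¹)

/-- transformed set -/
def trS (l : ℝ × ℝ × ℝ) (z : Pl) (K : Set Pl) : Set Pl := {q | 0 < q.2 ∧ ph l z q ∈ K}

section coords
variable {l : ℝ × ℝ × ℝ} {z : Pl}

lemma ev_ph (hn : l.1^2+l.2.1^2 ≠ 0) (hz : ev l z = 0) (q : Pl) : ev l (ph l z q) = q.2⁻¹ := by
  have : ev l (ph l z q) = ev l z + q.2⁻¹ := by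
    simp only [ev, ph, Prod.fst_add, Prod.snd_add, Prod.smul_fst, Prod.smul_snd, smul_eq_mul]
    generalize q.2⁻¹ = t
    field_simp
    ring
  rw [this, hz, zero_add]

lemma tm_ph (hn : l.1^2+l.2.1^2 ≠ 0) (q : Pl) : ev (tm l z) (ph l z q) = q.2⁻¹ * q.1 := by
  simp only [ev, tm, ph, Prod.fst_add, Prod.snd_add, Prod.smul_fst, Prod.smul_snd, smul_eq_mul]
  generalize q.2⁻¹ = t
  field_simp
  ring

lemma ps_ph (hn : l.1^2+l.2.1^2 ≠ 0) (hz : ev l z = 0) {q : Pl} (hq : 0 < q.2) :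
    ps l z (ph l z q) = q := by
  have : q.2 ≠ 0 := hq.ne'
  simp only [ps, ev_ph hn hz, tm_ph hn]
  ext
  · simp only; field_simp
  · simp

lemma ph_ps (hn : l.1^2+l.2.1^2 ≠ 0) (hz : ev l z = 0) {p : Pl} (hp : 0 < ev l p) :
    ph l z (ps l z p) = p := by
  have h1 : ev l p = l.1 * (p.1 - z.1) + l.2.1 * (p.2 - z.2) := by
    rw [← sub_zero (ev l p), ← hz]; simp only [ev]; ring
  have h2 : ev (tm l z) p = l.2.1 * (p.1 - z.1) - l.1 * (p.2 - z.2) := by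
    simp only [ev, tm]; ring
  simp only [ph, ps, inv_inv, smul_add, smul_smul]
  rw [mul_div_cancel₀ _ hp.ne', h1, h2]
  ext
  · simp only [Prod.fst_add, Prod.smul_fst, smul_eq_mul]; field_simp; ring
  · simp only [Prod.snd_add, Prod.smul_snd, smul_eq_mul]; field_simp; ring

lemma ph_image (hn : l.1^2+l.2.1^2 ≠ 0) (hz : ev l z = 0) {K : Set Pl}
    (hK : ∀ p ∈ K, 0 < ev l p) : ph l z '' trS l z K = K := by
  ext p; constructor
  · rintro ⟨q, hq, rfl⟩; exact hq.2
  · intro hp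
    exact ⟨ps l z p, ⟨inv_pos.2 (hK p hp), by rw [ph_ps hn hz (hK p hp)]; exact hp⟩,
      ph_ps hn hz (hK p hp)⟩

lemma ps_image (hn : l.1^2+l.2.1^2 ≠ 0) (hz : ev l z = 0) {K : Set Pl}
    (hK : ∀ p ∈ K, 0 < ev l p) : ps l z '' K = trS l z K := by
  ext q; constructor
  · rintro ⟨p, hp, rfl⟩
    exact ⟨inv_pos.2 (hK p hp), by rw [ph_ps hn hz (hK p hp)]; exact hp⟩
  · rintro ⟨h1, h2⟩; exact ⟨_, h2, ps_ph hn hz h1⟩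

lemma trS_compact (hn : l.1^2+l.2.1^2 ≠ 0) (hz : ev l z = 0) {K : Set Pl}
    (hK : ∀ p ∈ K, 0 < ev l p) (hc : IsCompact K) : IsCompact (trS l z K) := by
  rw [← ps_image hn hz hK]
  apply hc.image_of_continuousOn
  unfold ps
  apply ContinuousOn.prodMk
  · exact (ev_cont _).continuousOn.div (ev_cont _).continuousOn (fun p hp => (hK p hp).ne')
  · exact (ev_cont _).continuousOn.inv₀ (fun p hp => (hK p hp).ne')

lemma trS_convex {K : Set Pl} (hc : Convex ℝ K) : Convex ℝ (trS l z K) := by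
  rintro q ⟨hq1, hq2⟩ q' ⟨hq1', hq2'⟩ a b ha hb hab
  have hpos : 0 < a * q.2 + b * q'.2 := by
    rcases ha.eq_or_lt with h | h
    · have : b = 1 := by linarith
      rw [← h, this]; linarith
    · have := mul_pos h hq1
      have := mul_nonneg hb hq1'.le
      linarith
  refine ⟨by simpa using hpos, ?_⟩
  have := hc hq2 hq2' (a := a * q.2 / (a * q.2 + b * q'.2)) (b := b * q'.2 / (a * q.2 + b * q'.2))
    (by positivity) (by positivity) (by field_simp)
  convert this using 1
  have hb' : b = 1 - a := by linarith
  subst hb'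
  have e1 := hq1.ne'
  have e2 := hq1'.ne'
  have e3 := hpos.ne'
  simp only [ph]
  generalize (l.1^2+l.2.1^2) = n
  ext
  · simp only [Prod.fst_add, Prod.snd_add, Prod.smul_fst, Prod.smul_snd, smul_eq_mul]
    generalize l.2.1/n = c1
    generalize l.1/n = c2
    field_simp
    ring
  · simp only [Prod.fst_add, Prod.snd_add, Prod.smul_fst, Prod.smul_snd, smul_eq_mul]
    generalize l.2.1/n = c1
    generalize -l.1/n = c2
    field_simp
    ring

lemma trS_interior (hn : l.1^2+l.2.1^2 ≠ 0) (hz : ev l z = 0) {K : Set Pl}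
    (hK : ∀ p ∈ K, 0 < ev l p) (hi : (interior K).Nonempty) : (interior (trS l z K)).Nonempty := by
  obtain ⟨p, hp⟩ := hi
  have hpos := hK p (interior_subset hp)
  have ho : IsOpen {q : Pl | 0 < q.2} := isOpen_lt continuous_const continuous_snd
  have hc : ContinuousOn (ph l z) {q : Pl | 0 < q.2} := by
    unfold ph
    apply ContinuousOn.add continuousOn_const
    apply ContinuousOn.fun_smul
    · exact continuous_snd.continuousOn.inv₀ (fun q hq => ne_of_gt hq)
    · fun_prop
  have := hc.isOpen_inter_preimage ho (isOpen_interior (s := K))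
  refine ⟨ps l z p, mem_interior.2 ⟨_, ?_, this, ?_⟩⟩
  · rintro q ⟨h1, h2⟩; exact ⟨h1, interior_subset h2⟩
  · exact ⟨inv_pos.2 hpos, by simp only [Set.mem_preimage]; rw [ph_ps hn hz hpos]; exact hp⟩

lemma ph_deriv {q : Pl} (hq : 0 < q.2) : HasFDerivAt (ph l z)
    (lmap (q.2⁻¹ • ((l.2.1/(l.1^2+l.2.1^2), -l.1/(l.1^2+l.2.1^2)) : Pl))
      (-(q.2^2)⁻¹ • (q.1 • ((l.2.1/(l.1^2+l.2.1^2), -l.1/(l.1^2+l.2.1^2)) : Pl) +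
    ((l.1/(l.1^2+l.2.1^2), l.2.1/(l.1^2+l.2.1^2)) : Pl)))) q := by
  unfold ph
  generalize ((l.2.1/(l.1^2+l.2.1^2), -l.1/(l.1^2+l.2.1^2)) : Pl) = e1
  generalize ((l.1/(l.1^2+l.2.1^2), l.2.1/(l.1^2+l.2.1^2)) : Pl) = e2
  have d1 : HasFDerivAt (fun q : Pl => q.1) (ContinuousLinearMap.fst ℝ ℝ ℝ) q := hasFDerivAt_fst
  have d2 : HasFDerivAt (fun q : Pl => q.2) (ContinuousLinearMap.snd ℝ ℝ ℝ) q := hasFDerivAt_snd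
  have d3 := (hasDerivAt_inv hq.ne').comp_hasFDerivAt q d2
  have d4 := (d3.smul ((d1.smul_const e1).add_const e2)).const_add z
  refine d4.congr_fderiv ?_
  ext <;> simp [lmap]

lemma Phi_coords (hn : l.1^2+l.2.1^2 ≠ 0) (hz : ev l z = 0) {K : Set Pl}
    (hK : ∀ p ∈ K, 0 < ev l p) (hc : IsCompact K) (s : ℝ) :
    Phi K (l + s • tm l z) =
      (l.1^2+l.2.1^2)⁻¹ * ∫ q in trS l z K, ((1 + s * q.1)⁻¹)^3 := by
  unfold Phi
  conv_lhs => rw [← ph_image hn hz hK]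
  have hm := (trS_compact hn hz hK hc).measurableSet
  rw [integral_image_eq_integral_abs_det_fderiv_smul volume hm
    (fun q hq => (ph_deriv hq.1).hasFDerivWithinAt)
    (by intro q hq q' hq' h; rw [← ps_ph hn hz hq.1, ← ps_ph hn hz hq'.1, h])]
  rw [← integral_const_mul]
  apply setIntegral_congr_fun hm
  intro q hq
  have hq2 : 0 < q.2 := hq.1
  have hq0 := hq2.ne'
  have hnpos : 0 < l.1^2+l.2.1^2 := by positivity
  have e1 : ev (l + s • tm l z) (ph l z q) = q.2⁻¹ * (1 + s * q.1) := by
    rw [ev_add, ev_smul, ev_ph hn hz, tm_ph hn]; ring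
  simp only [smul_eq_mul]
  rw [e1, lmap_det]
  have e2 : (q.2⁻¹ • ((l.2.1/(l.1^2+l.2.1^2), -l.1/(l.1^2+l.2.1^2)) : Pl)).1 *
      (-(q.2^2)⁻¹ • (q.1 • ((l.2.1/(l.1^2+l.2.1^2), -l.1/(l.1^2+l.2.1^2)) : Pl) +
        ((l.1/(l.1^2+l.2.1^2), l.2.1/(l.1^2+l.2.1^2)) : Pl))).2 -
      (-(q.2^2)⁻¹ • (q.1 • ((l.2.1/(l.1^2+l.2.1^2), -l.1/(l.1^2+l.2.1^2)) : Pl) +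
        ((l.1/(l.1^2+l.2.1^2), l.2.1/(l.1^2+l.2.1^2)) : Pl))).1 *
      (q.2⁻¹ • ((l.2.1/(l.1^2+l.2.1^2), -l.1/(l.1^2+l.2.1^2)) : Pl)).2 =
      -((l.1^2+l.2.1^2)⁻¹ * (q.2^3)⁻¹) := by
    simp only [Prod.fst_add, Prod.snd_add, Prod.smul_fst, Prod.smul_snd, smul_eq_mul]
    field_simp
    ring
  rw [e2, abs_neg, abs_of_pos (by positivity), mul_inv, mul_pow, inv_inv]
  field_simp

end coords

/-- equality of projective chord lengths -/
def EqLen (z : Pl) (K K' : Set Pl) : Prop :=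
  ∀ d : Pl, volume {τ : ℝ | 0 < τ ∧ z + τ⁻¹ • d ∈ K} = volume {τ : ℝ | 0 < τ ∧ z + τ⁻¹ • d ∈ K'}

lemma eqLen_of_local {F G F' G' H : Set Pl} (hF : IsPoly F) (hG : IsPoly G) (hF' : IsPoly F')
    (hG' : IsPoly G') (hH : IsPoly H) (sF : F ⊆ H) (sG : G ⊆ H) (sF' : F' ⊆ H) (sG' : G' ⊆ H)
    (hid : ID F G F' G') {z : Pl} (hz : z ∈ Set.extremePoints ℝ H) (hzF : z ∈ F)
    (hzG : z ∉ G) (hzG' : z ∉ G') {U : Set Pl} (hU : U ∈ 𝓝 z) (hloc : F ∩ U = F' ∩ U) :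
    EqLen z G G' := by
  obtain ⟨l, hlz, hl⟩ := hH.expose hz
  have hzFe : z ∈ Set.extremePoints ℝ F :=
    inter_extremePoints_subset_extremePoints_of_subset sF ⟨hzF, hz⟩
  have ne : ∀ K : Set Pl, z ∉ K → ∀ p ∈ K, p ≠ z := by rintro K hK p hp rfl; exact hK hp
  have hGp : ∀ p ∈ G, 0 < ev l p := fun p hp => hl p (sG hp) (ne G hzG p hp)
  have hGp' : ∀ p ∈ G', 0 < ev l p := fun p hp => hl p (sG' hp) (ne G' hzG' p hp)
  have hn : l.1^2+l.2.1^2 ≠ 0 := by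
    intro h0
    have b1 : l.1 = 0 := by nlinarith [sq_nonneg l.1, sq_nonneg l.2.1]
    have b2 : l.2.1 = 0 := by nlinarith [sq_nonneg l.1, sq_nonneg l.2.1]
    obtain ⟨p, hp⟩ := hG.nonempty
    have := hGp p hp
    simp only [ev, b1, b2] at this hlz
    linarith
  have htz : ev (tm l z) z = 0 := by simp only [tm, ev]; ring
  have hev : ∀ᶠ s in 𝓝 (0:ℝ), ∀ u ∈ hH.vts, u ≠ z → 0 < ev (l + s • tm l z) u := by
    rw [Filter.eventually_all_finset]
    intro u hu
    by_cases huz : u = z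
    · exact Filter.Eventually.of_forall (fun s h => absurd huz h)
    have hc : Continuous (fun s : ℝ => ev (l + s • tm l z) u) := (ev_cont2 u).comp (by fun_prop)
    have : (0:ℝ) < (fun s : ℝ => ev (l + s • tm l z) u) 0 := by
      simpa using hl u (hH.mem_vts.1 hu).1 huz
    exact (hc.continuousAt.eventually (lt_mem_nhds this)).mono fun s hs _ => hs
  obtain ⟨r, hr, hball⟩ := Metric.eventually_nhds_iff.1 hev
  have key : ∀ s ∈ Set.Ioo (-r) r,
      ∫ q in trS l z G, ((1 + s * q.1)⁻¹)^3 = ∫ q in trS l z G', ((1 + s * q.1)⁻¹)^3 := by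
    intro s hs
    have hu := hball (y := s) (by rw [Real.dist_eq, sub_zero]; exact abs_lt.2 hs)
    have hlz' : ev (l + s • tm l z) z = 0 := by rw [ev_add, ev_smul, hlz, htz]; simp
    have hl' := hH.expose_of_ext hz hlz' (fun u h => hu u (hH.mem_vts.2 h))
    have := Phi_eq_of_expose hF hG hF' hG' hid hzFe hU hloc hlz'
      (fun p hp => hl' p (sF hp)) (fun p hp => hl' p (sF' hp))
      (fun p hp => hl' p (sG hp) (ne G hzG p hp)) (fun p hp => hl' p (sG' hp) (ne G' hzG' p hp))
    rw [Phi_coords hn hlz hGp hG.compact, Phi_coords hn hlz hGp' hG'.compact] at this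
    exact mul_left_cancel₀ (inv_ne_zero hn) this
  have hsec := sec_eq (trS_compact hn hlz hGp hG.compact) (trS_compact hn hlz hGp' hG'.compact)
    (trS_convex hG.convex) (trS_convex hG'.convex) (trS_interior hn hlz hGp hG.2)
    (trS_interior hn hlz hGp' hG'.2) hr key
  intro d
  set y := l.1 * d.1 + l.2.1 * d.2 with hy
  have hevd : ∀ τ : ℝ, ev l (z + τ⁻¹ • d) = τ⁻¹ * y := by
    intro τ
    have : ev l (z + τ⁻¹ • d) = ev l z + τ⁻¹ * y := by
      simp only [ev, hy, Prod.fst_add, Prod.snd_add, Prod.smul_fst, Prod.smul_snd, smul_eq_mul]; ring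
    rw [this, hlz, zero_add]
  rcases le_or_gt y 0 with h0 | h0
  · have : ∀ K : Set Pl, (∀ p ∈ K, 0 < ev l p) → {τ : ℝ | 0 < τ ∧ z + τ⁻¹ • d ∈ K} = ∅ := by
      intro K hK
      ext τ
      simp only [Set.mem_ofPred_eq, Set.mem_empty_iff_false, iff_false, not_and]
      intro ht hm
      have := hK _ hm
      rw [hevd] at this
      have := inv_pos.2 ht
      nlinarith
    rw [this G hGp, this G' hGp']
  · set x := (l.2.1 * d.1 - l.1 * d.2) / y with hx
    have : ∀ K : Set Pl, {τ : ℝ | 0 < τ ∧ z + τ⁻¹ • d ∈ K} = y • (Prod.mk x ⁻¹' trS l z K) := by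
      intro K
      ext τ
      have hph : ph l z (x, y⁻¹ * τ) = z + τ⁻¹ • d := by
        simp only [ph, hx, mul_inv, inv_inv]
        have hy0 := h0.ne'
        rw [← smul_smul, smul_comm]
        congr 1
        congr 1
        ext
        · simp only [Prod.fst_add, Prod.smul_fst, smul_eq_mul]; field_simp; rw [hy]; ring
        · simp only [Prod.snd_add, Prod.smul_snd, smul_eq_mul]; field_simp; rw [hy]; ring
      rw [Set.mem_smul_set_iff_inv_smul_mem₀ h0.ne']
      simp only [Set.mem_preimage, trS, Set.mem_ofPred_eq, smul_eq_mul, hph]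
      have : 0 < y⁻¹ * τ ↔ 0 < τ := by
        constructor
        · intro h; exact pos_of_mul_pos_right h (inv_pos.2 h0).le
        · intro h; positivity
      rw [this]
    rw [this, this, Measure.addHaar_smul, Measure.addHaar_smul, hsec x]

end CC

end

section

open MeasureTheory Pointwise Topology

namespace CC

lemma chord1 {K : Set Pl} (hK : IsCompact K) (hc : Convex ℝ K) {z d : Pl} (hz : z ∉ K)
    {r0 : ℝ} (hr0 : 0 < r0) (hm : z + r0 • d ∈ K) :
    ∃ r1 r2 : ℝ, 0 < r1 ∧ r1 ≤ r2 ∧ ∀ r : ℝ, 0 < r → (z + r • d ∈ K ↔ r1 ≤ r ∧ r ≤ r2) := by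
  have hd : d ≠ 0 := by
    rintro rfl; simp at hm; exact hz hm
  set S : Set ℝ := {r | 0 ≤ r ∧ z + r • d ∈ K} with hS
  have hcont : Continuous (fun r : ℝ => z + r • d) := by fun_prop
  have hcl : IsClosed S := isClosed_Ici.inter (hK.isClosed.preimage hcont)
  have hbd : Bornology.IsBounded S := by
    obtain ⟨C, hC⟩ := hK.isBounded.subset_closedBall z
    refine (Metric.isBounded_Icc (0:ℝ) (C/‖d‖)).subset ?_
    rintro r ⟨h0, h1⟩
    refine ⟨h0, ?_⟩
    have := hC h1
    rw [Metric.mem_closedBall, dist_eq_norm, add_sub_cancel_left, norm_smul, Real.norm_of_nonneg h0] at this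
    rwa [le_div_iff₀ (norm_pos_iff.2 hd)]
  have hcomp : IsCompact S := Metric.isCompact_of_isClosed_isBounded hcl hbd
  have hne : S.Nonempty := ⟨r0, hr0.le, hm⟩
  obtain ⟨r1, h1, h1m⟩ := hcomp.exists_isLeast hne
  obtain ⟨r2, h2, h2m⟩ := hcomp.exists_isGreatest hne
  have h1pos : 0 < r1 := by
    rcases h1.1.lt_or_eq with h | h
    · exact h
    · exfalso; have := h1.2; rw [← h] at this; simp at this; exact hz this
  refine ⟨r1, r2, h1pos, h1m h2, fun r hr => ⟨fun h => ⟨h1m ⟨hr.le, h⟩, h2m ⟨hr.le, h⟩⟩, ?_⟩⟩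
  rintro ⟨a, b⟩
  have hSc : Convex ℝ S := by
    intro p hp q hq s t hs ht hst
    refine ⟨add_nonneg (mul_nonneg hs hp.1) (mul_nonneg ht hq.1), ?_⟩
    have := hc hp.2 hq.2 hs ht hst
    convert this using 1
    have : z = s • z + t • z := by rw [← add_smul, hst, one_smul]
    simp only [smul_eq_mul, smul_add, smul_smul, add_smul]
    nth_rewrite 1 [this]; abel
  exact (hSc.ordConnected.out h1 h2 ⟨a, b⟩).2

lemma chord_vol {K : Set Pl} {z d : Pl} {r1 r2 : ℝ} (h1 : 0 < r1) (h12 : r1 ≤ r2)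
    (h : ∀ r : ℝ, 0 < r → (z + r • d ∈ K ↔ r1 ≤ r ∧ r ≤ r2)) :
    volume {τ : ℝ | 0 < τ ∧ z + τ⁻¹ • d ∈ K} = ENNReal.ofReal (r1⁻¹ - r2⁻¹) := by
  have : {τ : ℝ | 0 < τ ∧ z + τ⁻¹ • d ∈ K} = Set.Icc r2⁻¹ r1⁻¹ := by
    have h2 : 0 < r2 := by linarith
    ext τ; constructor
    · rintro ⟨a, b⟩
      rw [h _ (inv_pos.2 a)] at b
      exact ⟨inv_le_of_inv_le₀ a b.2, (le_inv_comm₀ h1 a).1 b.1⟩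
    · rintro ⟨a, b⟩
      have ht : 0 < τ := lt_of_lt_of_le (inv_pos.2 h2) a
      refine ⟨ht, (h _ (inv_pos.2 ht)).2 ⟨(le_inv_comm₀ h1 ht).2 b, inv_le_of_inv_le₀ h2 a⟩⟩
  rw [this, Real.volume_Icc]

lemma chord_eq {K K' : Set Pl} {z d : Pl} (he : EqLen z K K') {r1 r2 r1' r2' : ℝ}
    (h1 : 0 < r1) (h12 : r1 ≤ r2)
    (h : ∀ r : ℝ, 0 < r → (z + r • d ∈ K ↔ r1 ≤ r ∧ r ≤ r2))
    (h1' : 0 < r1') (h12' : r1' ≤ r2')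
    (h' : ∀ r : ℝ, 0 < r → (z + r • d ∈ K' ↔ r1' ≤ r ∧ r ≤ r2')) :
    r1⁻¹ - r2⁻¹ = r1'⁻¹ - r2'⁻¹ := by
  have := he d
  rw [chord_vol h1 h12 h, chord_vol h1' h12' h'] at this
  have p1 : r2⁻¹ ≤ r1⁻¹ := inv_anti₀ h1 h12
  have p2 : r2'⁻¹ ≤ r1'⁻¹ := inv_anti₀ h1' h12'
  exact (ENNReal.ofReal_eq_ofReal_iff (by linarith) (by linarith)).1 this

lemma EqLen.symm {K K' : Set Pl} {z : Pl} (he : EqLen z K K') : EqLen z K' K := fun d => (he d).symm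

/-- common exit point -/
lemma chord2 {K K' : Set Pl} (hK : IsCompact K) (hc : Convex ℝ K) (hK' : IsCompact K')
    (hc' : Convex ℝ K') {z d : Pl} (hz : z ∉ K) (hz' : z ∉ K') (he : EqLen z K K')
    {r0 : ℝ} (hr0 : 0 < r0) (hm : z + r0 • d ∈ K) (hm' : z + r0 • d ∈ K')
    (hx : ∀ r, z + r • d ∈ K → r ≤ r0) (hx' : ∀ r, z + r • d ∈ K' → r ≤ r0) {r : ℝ} (hr : 0 < r) :
    z + r • d ∈ K ↔ z + r • d ∈ K' := by
  obtain ⟨r1, r2, h1, h12, h⟩ := chord1 hK hc hz hr0 hm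
  obtain ⟨r1', r2', h1', h12', h'⟩ := chord1 hK' hc' hz' hr0 hm'
  have e := chord_eq he h1 h12 h h1' h12' h'
  have e2 : r2 = r0 := le_antisymm (hx _ ((h r2 (by linarith)).2 ⟨h12, le_rfl⟩)) ((h r0 hr0).1 hm).2
  have e2' : r2' = r0 :=
    le_antisymm (hx' _ ((h' r2' (by linarith)).2 ⟨h12', le_rfl⟩)) ((h' r0 hr0).1 hm').2
  have e1 : r1 = r1' := by
    rw [e2, e2'] at e
    exact inv_injective (by linarith)
  rw [h r hr, h' r hr, e1, e2, e2']

lemma ext_ray {H : Set Pl} {z u : Pl} (hu : u ∈ Set.extremePoints ℝ H) (hz : z ∈ H) (hzu : z ≠ u)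
    {r : ℝ} (hr : z + r • (u - z) ∈ H) : r ≤ 1 := by
  by_contra hcon
  push Not at hcon
  have hr0 : 0 < r := by linarith
  have := hu.2 hz hr ⟨1 - r⁻¹, r⁻¹, by rw [sub_pos]; exact inv_lt_one_of_one_lt₀ hcon, inv_pos.2 hr0, by ring, by
    rw [smul_add, smul_smul, inv_mul_cancel₀ hr0.ne']; module⟩
  exact hzu this

lemma interior_ext {K T : Set Pl} (hK : Convex ℝ K) {x : Pl} (hx : x ∈ interior T)
    (he : x ∈ Set.extremePoints ℝ (K ∩ T)) : x ∈ Set.extremePoints ℝ K := by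
  refine ⟨he.1.1, ?_⟩
  rintro p hp q hq ⟨a, b, ha, hb, hab, hx2⟩
  have key : ∀ w : Pl, ∀ᶠ s : ℝ in 𝓝[>] 0, x + s • (w - x) ∈ T := by
    intro w
    have hc : Continuous (fun s : ℝ => x + s • (w - x)) := by fun_prop
    have := hc.tendsto 0
    simp only [zero_smul, add_zero] at this
    exact (this.mono_left nhdsWithin_le_nhds).eventually (mem_interior_iff_mem_nhds.1 hx)
  have hlt : ∀ᶠ s : ℝ in 𝓝[>] 0, s < 1 := nhdsWithin_le_nhds (Iio_mem_nhds one_pos)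
  obtain ⟨s, ⟨⟨h1, h2⟩, h3⟩, h4⟩ := (((key p).and (key q)).and hlt |>.and self_mem_nhdsWithin).exists
  have h4' : 0 < s := h4
  have hk : ∀ w ∈ K, x + s • (w - x) ∈ K := by
    intro w hw
    have := hK he.1.1 hw (by linarith : 0 ≤ 1 - s) h4'.le (by ring)
    convert this using 1; module
  have := he.2 ⟨hk p hp, h1⟩ ⟨hk q hq, h2⟩ ⟨a, b, ha, hb, hab, by
    have : a • (x + s • (p - x)) + b • (x + s • (q - x)) = (a+b) • x + s • ((a • p + b • q) - (a+b) • x) := by module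
    rw [this, hab, hx2]; module⟩
  have h5 : s • (p - x) = 0 := by simpa using this
  rcases smul_eq_zero.1 h5 with h | h
  · linarith
  · exact sub_eq_zero.1 h

lemma T_lemma {K K' H : Set Pl} (hK : IsCompact K) (hc : Convex ℝ K) (hK' : IsCompact K')
    (hc' : Convex ℝ K') (sK : K ⊆ H) (sK' : K' ⊆ H) {z y u b : Pl}
    (hzH : z ∈ H) (hz : z ∉ K) (hz' : z ∉ K') (he : EqLen z K K')
    (hyH : y ∈ Set.extremePoints ℝ H) (huH : u ∈ Set.extremePoints ℝ H)
    (hbH : b ∈ Set.extremePoints ℝ H) (hzext : z ∈ Set.extremePoints ℝ H)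
    (hu : u ∈ K) (hu' : u ∈ K') (hb : b ∈ K) (hb' : b ∈ K') (hy : y ∉ K) (hy' : y ∈ K')
    (hsu : dt z y u < 0) (hsb : 0 < dt z y b) :
    ∃ v ∈ Set.extremePoints ℝ K, v ∉ K' ∧ 0 < dt z u b ∧ 0 < dt z u v ∧ 0 < dt b z v ∧
      0 < dt u b v := by
  have hzy : z ≠ y := by rintro rfl; exact hz' hy'
  have hzu : z ≠ u := by rintro rfl; exact hz hu
  have hzb : z ≠ b := by rintro rfl; exact hz hb
  -- crossing point
  set c := (-dt z y u) / (dt z y b - dt z y u) with hcdef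
  have hpos : 0 < dt z y b - dt z y u := by linarith
  have hc0 : 0 < c := div_pos (by linarith) hpos
  have hc1 : c < 1 := by rw [hcdef, div_lt_one hpos]; linarith
  set m := (1 - c) • u + c • b with hm
  have hmK : m ∈ K := hc hu hb (by linarith) hc0.le (by ring)
  have hmK' : m ∈ K' := hc' hu' hb' (by linarith) hc0.le (by ring)
  have hmline : dt z y m = 0 := by
    rw [hm, dt_combo _ _ _ _ (by ring : 1 - c + c = 1), hcdef]; field_simp; ring
  obtain ⟨s, hs⟩ := on_line hzy hmline
  have hs' : m = z + s • (y - z) := by rw [hs]; module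
  have hs1 : s ≤ 1 := ext_ray hyH hzH hzy (hs' ▸ sK hmK)
  have hs0 : 0 < s := by
    have : 1 - s ≤ 1 := ext_ray hzext hyH.1 hzy.symm (by
      have : y + (1 - s) • (z - y) = m := by rw [hs]; module
      rw [this]; exact sK hmK)
    rcases (by linarith : 0 ≤ s).lt_or_eq with h | h
    · exact h
    · exfalso; rw [← h] at hs'; simp at hs'; exact hz (hs' ▸ hmK)
  have hzub : 0 < dt z u b := by
    have h1 : dt z u m = c * dt z u b := by
      rw [hm, dt_combo _ _ _ _ (by ring : 1 - c + c = 1), dt_self_right]; ring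
    have h2 : dt z u m = s * - dt z y u := by
      rw [hs, dt_combo _ _ _ _ (by ring : 1 - s + s = 1), dt_self_left, dt_swap' z y u]; ring
    have h3 : 0 < c * dt z u b := by rw [← h1, h2]; apply mul_pos hs0; linarith
    exact (pos_iff_pos_of_mul_pos h3).1 hc0
  -- entry points
  obtain ⟨r1, r2, h1, h12, h⟩ := chord1 hK hc hz hs0 (hs' ▸ hmK)
  obtain ⟨r1', r2', h1', h12', h'⟩ := chord1 hK' hc' hz' hs0 (hs' ▸ hmK')
  have ee := chord_eq he h1 h12 h h1' h12' h'
  have hz1 : z + (1:ℝ) • (y - z) = y := by module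
  have e2' : 1 ≤ r2' := ((h' 1 one_pos).1 (by rw [hz1]; exact hy')).2
  have e2'' : r2' ≤ 1 := ext_ray hyH hzH hzy (sK' ((h' r2' (by linarith)).2 ⟨h12', le_rfl⟩))
  have e2 : r2 ≤ 1 := ext_ray hyH hzH hzy (sK ((h r2 (by linarith)).2 ⟨h12, le_rfl⟩))
  have e2n : r2 < 1 := by
    rcases e2.lt_or_eq with h0 | h0
    · exact h0
    · exfalso; apply hy; rw [← hz1, ← h0]; exact (h r2 (by linarith)).2 ⟨h12, le_rfl⟩
  have hr : r1 < r1' := by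
    have e3 : r2' = 1 := by linarith
    rw [e3] at ee
    have : 1 < r2⁻¹ := (one_lt_inv₀ (by linarith)).2 e2n
    have h4 : r1'⁻¹ < r1⁻¹ := by simp at ee; linarith
    exact (inv_lt_inv₀ h1' h1).1 h4
  have hr1s : r1' ≤ s := ((h' s hs0).1 (hs' ▸ hmK')).1
  set e := z + r1 • (y - z) with hedef
  have heK : e ∈ K := (h r1 h1).2 ⟨le_rfl, h12⟩
  have heK' : e ∉ K' := fun hh => by have := ((h' r1 h1).1 hh).1; linarith
  -- coordinates of e
  set q := r1 / s with hq
  have hq0 : 0 < q := div_pos h1 hs0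
  have hq1 : q < 1 := by rw [hq, div_lt_one hs0]; linarith
  have heq : e = (1 - q) • z + q • m := by
    have : q * s = r1 := by rw [hq]; field_simp
    rw [hs', hedef, ← this]; module
  have hbz : dt b z u = dt z u b := by rw [← dt_rot]
  have hub : dt u b z = dt z u b := dt_rot _ _ _
  set T : Set Pl := {p | 0 ≤ dt z u p} ∩ ({p | 0 ≤ dt b z p} ∩ {p | 0 ≤ dt u b p}) with hT
  have hTc : Convex ℝ T := by
    have := fun (a b : Pl) => convex_ge (dl a b) 0
    simp only [ev_dl] at this
    exact (this _ _).inter ((this _ _).inter (this _ _))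
  have hTcl : IsClosed T := by
    have := fun (a b : Pl) => closed_ge (dl a b) 0
    simp only [ev_dl] at this
    exact (this _ _).inter ((this _ _).inter (this _ _))
  have hzT : z ∈ T := by
    refine ⟨?_, ?_, ?_⟩ <;> simp only [Set.mem_ofPred_eq, dt_self_left, dt_self_right, hub, le_refl]
    exact hzub.le
  have huT : u ∈ T := by
    refine ⟨?_, ?_, ?_⟩ <;> simp only [Set.mem_ofPred_eq, dt_self_left, dt_self_right, hbz, le_refl]
    exact hzub.le
  have hbT : b ∈ T := by
    refine ⟨?_, ?_, ?_⟩ <;> simp only [Set.mem_ofPred_eq, dt_self_left, dt_self_right, le_refl]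
    exact hzub.le
  have heT : e ∈ T := by
    rw [heq]
    exact hTc hzT (hTc huT hbT (by linarith) hc0.le (by ring)) (by linarith) hq0.le (by ring)
  by_contra hcon
  push Not at hcon
  have hall : ∀ v ∈ Set.extremePoints ℝ K, 0 < dt z u v → 0 < dt b z v → 0 < dt u b v → v ∈ K' := by
    intro v hv a1 a2 a3
    by_contra hv'
    exact absurd (hcon v hv hv' hzub a1 a2) (not_le.2 a3)
  apply heK'
  have hcompT : IsCompact (K ∩ T) := hK.inter_right hTcl
  have hconvT : Convex ℝ (K ∩ T) := hc.inter hTc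
  have hKM := closure_convexHull_extremePoints hcompT hconvT
  have hsub : Set.extremePoints ℝ (K ∩ T) ⊆ K' := by
    intro x hx
    obtain ⟨hxK, t1, t2, t3⟩ := hx.1
    simp only [Set.mem_ofPred_eq] at t1 t2 t3
    have hxz : x ≠ z := by rintro rfl; exact hz hxK
    rcases t1.lt_or_eq with p1 | p1
    · rcases t2.lt_or_eq with p2 | p2
      · rcases t3.lt_or_eq with p3 | p3
        · refine hall x (interior_ext hc ?_ hx) p1 p2 p3
          refine mem_interior.2 ⟨{p | 0 < dt z u p} ∩ ({p | 0 < dt b z p} ∩ {p | 0 < dt u b p}), ?_, ?_, p1, p2, p3⟩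
          · rintro p ⟨a1, a2, a3⟩
            simp only [Set.mem_ofPred_eq] at a1 a2 a3
            exact ⟨a1.le, a2.le, a3.le⟩
          · exact (isOpen_lt continuous_const (dt_cont _ _)).inter
              ((isOpen_lt continuous_const (dt_cont _ _)).inter (isOpen_lt continuous_const (dt_cont _ _)))
        · have hub' : u ≠ b := by
            rintro rfl; rw [dt_self_right] at hzub; exact lt_irrefl _ hzub
          obtain ⟨t, ht⟩ := on_line hub' p3.symm
          have a1 : dt z u x = t * dt z u b := by
            rw [ht, dt_combo _ _ _ _ (by ring : 1 - t + t = 1), dt_self_right]; ring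
          have a2 : dt b z x = (1 - t) * dt z u b := by
            rw [ht, dt_combo _ _ _ _ (by ring : 1 - t + t = 1), dt_self_left, hbz]; ring
          have b1 : 0 < t := (pos_iff_pos_of_mul_pos (a1 ▸ p1)).2 hzub
          have b2 : 0 < 1 - t := (pos_iff_pos_of_mul_pos (a2 ▸ p2)).2 hzub
          rw [ht]
          exact hc' hu' hb' b2.le b1.le (by ring)
      · obtain ⟨t, ht⟩ := on_line hzb (by rw [dt_swap, ← p2, neg_zero] : dt z b x = 0)
        have a1 : dt z u x = t * dt z u b := by
          rw [ht, dt_combo _ _ _ _ (by ring : 1 - t + t = 1), dt_self_left]; ring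
        have b1 : 0 < t := (pos_iff_pos_of_mul_pos (a1 ▸ p1)).2 hzub
        have ht' : x = z + t • (b - z) := by rw [ht]; module
        have hb1 : z + (1:ℝ) • (b - z) = b := by module
        rw [ht'] at hxK ⊢
        exact (chord2 hK hc hK' hc' hz hz' he one_pos (hb1.symm ▸ hb) (hb1.symm ▸ hb')
          (fun r hr => ext_ray hbH hzH hzb (sK hr)) (fun r hr => ext_ray hbH hzH hzb (sK' hr)) b1).1 hxK
    · obtain ⟨t, ht⟩ := on_line hzu p1.symm
      have a1 : dt b z x = t * dt z u b := by
        rw [ht, dt_combo _ _ _ _ (by ring : 1 - t + t = 1), dt_self_right, hbz]; ring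
      have ht' : x = z + t • (u - z) := by rw [ht]; module
      have b0 : 0 ≤ t := nonneg_of_mul_nonneg_left (a1 ▸ t2) hzub
      have b1 : 0 < t := by
        rcases b0.lt_or_eq with h0 | h0
        · exact h0
        · exfalso; apply hxz; rw [ht', ← h0]; simp
      have hb1 : z + (1:ℝ) • (u - z) = u := by module
      rw [ht'] at hxK ⊢
      exact (chord2 hK hc hK' hc' hz hz' he one_pos (hb1.symm ▸ hu) (hb1.symm ▸ hu')
          (fun r hr => ext_ray huH hzH hzu (sK hr)) (fun r hr => ext_ray huH hzH hzu (sK' hr)) b1).1 hxK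
  have : closure (convexHull ℝ (Set.extremePoints ℝ (K ∩ T))) ⊆ K' :=
    closure_minimal (convexHull_min hsub hc') hK'.isClosed
  exact this (hKM.symm ▸ ⟨heK, heT⟩)

lemma open_tri_not_ext {K : Set Pl} (hK : Convex ℝ K) {z u b v : Pl} (h : 0 < dt z u b)
    (h1 : 0 < dt z u v) (h2 : 0 < dt b z v) (h3 : 0 < dt u b v) (hz : z ∈ K) (hu : u ∈ K)
    (hb : b ∈ K) : v ∈ K ∧ v ∉ Set.extremePoints ℝ K := by
  have hm := mem_tri h h1.le h2.le h3.le
  have hs : ({z, u, b} : Set Pl) ⊆ K := by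
    rintro x (rfl | rfl | rfl) <;> assumption
  refine ⟨convexHull_min hs hK hm, fun he => ext_not_mem_hull hK he hs ?_ hm⟩
  rintro (rfl | rfl | rfl)
  · rw [dt_self_left] at h1; exact lt_irrefl _ h1
  · rw [dt_self_right] at h1; exact lt_irrefl _ h1
  · rw [dt_self_left] at h2; exact lt_irrefl _ h2

/-- Step 4 core -/
lemma step4 {F G F' G' H : Set Pl} (hF : IsPoly F) (hG : IsPoly G) (hF' : IsPoly F')
    (hG' : IsPoly G') (sF : F ⊆ H) (sG : G ⊆ H) (sF' : F' ⊆ H) (sG' : G' ⊆ H)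
    (hid : ID F G F' G') {z y u b : Pl} (hzH : z ∈ Set.extremePoints ℝ H)
    (hyH : y ∈ Set.extremePoints ℝ H) (huH : u ∈ Set.extremePoints ℝ H)
    (hbH : b ∈ Set.extremePoints ℝ H)
    (z1 : z ∈ F) (z2 : z ∈ F') (z3 : z ∉ G) (z4 : z ∉ G') (zE : EqLen z G G')
    (y1 : y ∈ F) (y2 : y ∈ G') (y3 : y ∉ G) (y4 : y ∉ F') (yE : EqLen y G F')
    (u1 : u ∈ F) (u2 : u ∈ G) (u3 : u ∈ F') (u4 : u ∈ G')
    (b1 : b ∈ F) (b2 : b ∈ G) (b3 : b ∈ F') (b4 : b ∈ G')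
    (hsu : dt z y u < 0) (hsb : 0 < dt z y b) : False := by
  obtain ⟨v, hv, hv', p0, p1, p2, p3⟩ := T_lemma hG.compact hG.convex hG'.compact hG'.convex sG sG'
    hzH.1 z3 z4 zE hyH huH hbH hzH u2 u4 b2 b4 y3 y2 hsu hsb
  obtain ⟨w, hw, hw', q0, q1, q2, q3⟩ := T_lemma hG.compact hG.convex hF'.compact hF'.convex sG sF'
    hyH.1 y3 y4 yE hzH hbH huH hyH b2 b3 u2 u3 z3 z2 (by rw [dt_swap]; linarith)
    (by rw [dt_swap]; linarith)
  have A1 := open_tri_not_ext hF.convex p0 p1 p2 p3 z1 u1 b1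
  have A2 := open_tri_not_ext hF'.convex p0 p1 p2 p3 z2 u3 b3
  have B1 := open_tri_not_ext hF.convex q0 q1 q2 q3 y1 b1 u1
  have B2 := open_tri_not_ext hG'.convex q0 q1 q2 q3 y2 b4 u4
  have c1 := pole hF hG hF' hG' hid hv A1.2 A2.2 (fun h => hv' h.1)
  have c2 := pole hF hG hF' hG' hid hw B1.2 (fun h => hw' h.1) B2.2
  have hne : v ≠ w := by rintro rfl; exact hw' A2.1
  exact two_centers hF hne A1.1 B1.1 A1.2 B1.2 c1 c2

end CC

end

section

open MeasureTheory Pointwise Topology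

namespace CC

/-- determinant of the linear parts -/
def ldet (f g : ℝ × ℝ × ℝ) : ℝ := f.1 * g.2.1 - f.2.1 * g.1

lemma ldet_id {f g : ℝ × ℝ × ℝ} {z : Pl} (fz : ev f z = 0) (gz : ev g z = 0) (a x : Pl) :
    ev f a * ev g x - ev g a * ev f x = ldet f g * dt z a x := by
  have hf : f.2.2 = - (f.1 * z.1 + f.2.1 * z.2) := by unfold ev at fz; linarith
  have hg : g.2.2 = - (g.1 * z.1 + g.2.1 * z.2) := by unfold ev at gz; linarith
  simp only [ev, ldet, dt, hf, hg]; ring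

lemma coord_inj {t h : ℝ × ℝ × ℝ} (hd : ldet t h ≠ 0) {x y : Pl} (h1 : ev t x = ev t y)
    (h2 : ev h x = ev h y) : x = y := by
  unfold ev at h1 h2
  unfold ldet at hd
  ext
  · apply mul_left_cancel₀ hd
    linear_combination h.2.1 * h1 - t.2.1 * h2
  · apply mul_left_cancel₀ hd
    linear_combination - h.1 * h1 + t.1 * h2

lemma coord_surj {t h : ℝ × ℝ × ℝ} (hd : ldet t h ≠ 0) (τ η : ℝ) :
    ∃ x : Pl, ev t x = τ ∧ ev h x = η := by
  refine ⟨((h.2.1 * (τ - t.2.2) - t.2.1 * (η - h.2.2)) / ldet t h,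
    (- h.1 * (τ - t.2.2) + t.1 * (η - h.2.2)) / ldet t h), ?_, ?_⟩
  · unfold ev; simp only; field_simp; simp only [ldet]; ring
  · unfold ev; simp only; field_simp; simp only [ldet]; ring

lemma seg_of_coord {t h : ℝ × ℝ × ℝ} (hd : ldet t h ≠ 0) {p q x : Pl} (hp : ev h x = ev h p)
    (hq : ev h x = ev h q) (h1 : ev t p ≤ ev t x) (h2 : ev t x ≤ ev t q) : x ∈ segment ℝ p q := by
  rcases (h1.trans h2).lt_or_eq with hlt | heq
  · have hpos : 0 < ev t q - ev t p := by linarith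
    set μ := (ev t x - ev t p) / (ev t q - ev t p) with hμ
    have hμ0 : 0 ≤ μ := div_nonneg (by linarith) hpos.le
    have hμ1 : μ ≤ 1 := by rw [hμ, div_le_one hpos]; linarith
    refine ⟨1 - μ, μ, by linarith, hμ0, by ring, ?_⟩
    apply coord_inj hd
    · rw [ev_combo _ _ _ (by ring)]
      have : μ * (ev t q - ev t p) = ev t x - ev t p := by rw [hμ]; field_simp
      linarith
    · rw [ev_combo _ _ _ (by ring), ← hp, ← hq]; ring
  · have : x = p := coord_inj hd (by linarith) hp
    rw [this]; exact left_mem_segment _ _ _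

/-- trapezoid description above the line `h = 0` -/
def Slab (t h : ℝ × ℝ × ℝ) (K : Set Pl) (η c d α β : ℝ) : Prop :=
  ∀ x, 0 ≤ ev h x → ev h x ≤ η →
    (x ∈ K ↔ c + α * ev h x ≤ ev t x ∧ ev t x ≤ d + β * ev h x)

lemma Slab.mono {t h : ℝ × ℝ × ℝ} {K : Set Pl} {η η' c d α β : ℝ} (hs : Slab t h K η c d α β)
    (hle : η' ≤ η) : Slab t h K η' c d α β := fun x h1 h2 => hs x h1 (h2.trans hle)

lemma Slab.flip {t h : ℝ × ℝ × ℝ} {K : Set Pl} {η c d α β : ℝ} (hs : Slab t h K η c d α β)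
    (k : ℝ) : Slab ((0,0,k) - t) h K η (k-d) (k-c) (-β) (-α) := by
  intro x h1 h2
  have : ev ((0,0,k) - t) x = k - ev t x := by rw [ev_sub]; simp [ev]
  rw [hs x h1 h2, this]
  constructor
  · rintro ⟨a, b⟩; constructor <;> linarith
  · rintro ⟨a, b⟩; constructor <;> linarith

lemma exists_slab {K : Set Pl} (hK : IsPoly K) {t h : ℝ × ℝ × ℝ} (hd : ldet t h ≠ 0) {p q : Pl}
    (hp : p ∈ K) (hq : q ∈ K) (hp0 : ev h p = 0) (hq0 : ev h q = 0)
    (hmin : ∀ x ∈ K, ev h x = 0 → ev t p ≤ ev t x) (hmax : ∀ x ∈ K, ev h x = 0 → ev t x ≤ ev t q)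
    (hab : ∃ x ∈ K, 0 < ev h x) :
    ∃ η α β : ℝ, 0 < η ∧ Slab t h K η (ev t p) (ev t q) α β := by
  set W := {v | v ∈ Set.extremePoints ℝ K ∧ 0 < ev h v} with hW
  have hWf : W.Finite := hK.ext_finite.subset (fun v hv => hv.1)
  have hWn : W.Nonempty := by
    by_contra hcon
    rw [Set.not_nonempty_iff_eq_empty] at hcon
    obtain ⟨x, hx, hx0⟩ := hab
    have := hK.subset_of_ext (convex_le h 0) (fun v hv => by
      by_contra h2
      simp only [Set.mem_ofPred_eq, not_le] at h2
      have : v ∈ W := ⟨hv, h2⟩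
      rw [hcon] at this; exact this) hx
    simp only [Set.mem_ofPred_eq] at this
    linarith
  obtain ⟨v, hv, hvm⟩ := hWf.exists_minimalFor (ev h) W hWn
  set η := ev h v with hη
  have hη0 : 0 < η := hv.2
  have hmin' : ∀ w ∈ Set.extremePoints ℝ K, 0 < ev h w → η ≤ ev h w := by
    intro w hw hw0
    rcases le_total (ev h w) η with h1 | h1
    · exact hvm ⟨hw, hw0⟩ h1
    · exact h1
  have hc1 : IsCompact (K ∩ {x | ev h x = η}) := hK.compact.inter_right (closed_eq h η)
  have hn1 : (K ∩ {x | ev h x = η}).Nonempty := ⟨v, hv.1.1, rfl⟩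
  obtain ⟨p1, ⟨hp1, hp1h⟩, hp1m⟩ := hc1.exists_isMinOn hn1 (ev_cont t).continuousOn
  obtain ⟨q1, ⟨hq1, hq1h⟩, hq1m⟩ := hc1.exists_isMaxOn hn1 (ev_cont t).continuousOn
  simp only [Set.mem_ofPred_eq] at hp1h hq1h
  set α := (ev t p1 - ev t p) / η with hα
  set β := (ev t q1 - ev t q) / η with hβ
  have eα : α * η = ev t p1 - ev t p := by rw [hα]; field_simp
  have eβ : β * η = ev t q1 - ev t q := by rw [hβ]; field_simp
  refine ⟨η, α, β, hη0, fun x h1 h2 => ⟨fun hx => ?_, ?_⟩⟩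
  · -- Krein-Milman on the slab
    set T : Set Pl := {x | 0 ≤ ev h x} ∩ {x | ev h x ≤ η} with hT
    have hTc : Convex ℝ T := (convex_ge h 0).inter (convex_le h η)
    have hTcl : IsClosed T := (closed_ge h 0).inter (closed_le h η)
    set M : Set Pl := {x | ev t p ≤ ev (t - α • h) x} ∩ {x | ev (t - β • h) x ≤ ev t q} with hM
    have hMc : Convex ℝ M := (convex_ge _ _).inter (convex_le _ _)
    have hMcl : IsClosed M := (closed_ge _ _).inter (closed_le _ _)
    have hMm : ∀ x, x ∈ M ↔ ev t p + α * ev h x ≤ ev t x ∧ ev t x ≤ ev t q + β * ev h x := by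
      intro x
      simp only [hM, Set.mem_inter_iff, Set.mem_ofPred_eq, ev_sub, ev_smul]
      constructor
      · rintro ⟨a, b⟩; constructor <;> linarith
      · rintro ⟨a, b⟩; constructor <;> linarith
    rw [← hMm]
    have hsub : Set.extremePoints ℝ (K ∩ T) ⊆ M := by
      intro w hw
      obtain ⟨hwK, w1, w2⟩ := hw.1
      simp only [Set.mem_ofPred_eq] at w1 w2
      rw [hMm]
      rcases w1.lt_or_eq with w1' | w1'
      · rcases w2.lt_or_eq with w2' | w2'
        · exfalso
          have : w ∈ Set.extremePoints ℝ K := by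
            refine interior_ext hK.convex ?_ hw
            refine mem_interior.2 ⟨{x | 0 < ev h x} ∩ {x | ev h x < η}, ?_, ?_, w1', w2'⟩
            · rintro x ⟨a, b⟩
              simp only [Set.mem_ofPred_eq] at a b
              exact ⟨a.le, b.le⟩
            · exact (isOpen_lt continuous_const (ev_cont h)).inter (isOpen_lt (ev_cont h) continuous_const)
          have := hmin' w this w1'
          linarith
        · have a1 : ev t p1 ≤ ev t w := hp1m ⟨hwK, w2'⟩
          have a2 : ev t w ≤ ev t q1 := hq1m ⟨hwK, w2'⟩
          rw [w2', eα, eβ]; constructor <;> linarith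
      · rw [← w1']
        simp only [mul_zero, add_zero]
        exact ⟨hmin w hwK w1'.symm, hmax w hwK w1'.symm⟩
    have hKM := closure_convexHull_extremePoints (hK.compact.inter_right hTcl) (hK.convex.inter hTc)
    have : closure (convexHull ℝ (Set.extremePoints ℝ (K ∩ T))) ⊆ M :=
      closure_minimal (convexHull_min hsub hMc) hMcl
    exact this (hKM.symm ▸ ⟨hx, h1, h2⟩)
  · rintro ⟨a, b⟩
    set θ := ev h x / η with hθ
    have hθ0 : 0 ≤ θ := div_nonneg h1 hη0.le
    have hθ1 : θ ≤ 1 := by rw [hθ, div_le_one hη0]; exact h2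
    have eθ : θ * η = ev h x := by rw [hθ]; field_simp
    have P : (1-θ) • p + θ • p1 ∈ K := hK.convex hp hp1 (by linarith) hθ0 (by ring)
    have Q : (1-θ) • q + θ • q1 ∈ K := hK.convex hq hq1 (by linarith) hθ0 (by ring)
    refine hK.convex.segment_subset P Q (seg_of_coord hd ?_ ?_ ?_ ?_)
    · rw [ev_combo _ _ _ (by ring), hp0, hp1h, ← eθ]; ring
    · rw [ev_combo _ _ _ (by ring), hq0, hq1h, ← eθ]; ring
    · rw [ev_combo _ _ _ (by ring)]
      rw [← eθ] at a
      have : α * (θ * η) = θ * (ev t p1 - ev t p) := by rw [← eα]; ring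
      linarith
    · rw [ev_combo _ _ _ (by ring)]
      rw [← eθ] at b
      have : β * (θ * η) = θ * (ev t q1 - ev t q) := by rw [← eβ]; ring
      linarith

lemma evlt {f g : ℝ → ℝ} (hf : Continuous f) (hg : Continuous g) (h : f 0 < g 0) :
    ∀ᶠ s in 𝓝[>] (0:ℝ), f s < g s :=
  nhdsWithin_le_nhds ((isOpen_lt hf hg).mem_nhds h)

lemma edge_cmp {t h : ℝ × ℝ × ℝ} (hd : ldet t h ≠ 0) {K K' D : Set Pl} {η c d α β α' β' : ℝ}
    (hη : 0 < η) (hs : Slab t h K η c d α β) (hs' : Slab t h K' η c d α' β') (hcd : c < d)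
    (hD : K \ K' ⊆ D) {p : Pl} (hpt : ev t p = c) (hph : ev h p = 0) (hpD : p ∉ closure D) :
    α' ≤ α := by
  obtain ⟨X, X1, X2⟩ := coord_surj hd (c + α * η) η
  have hcont : Continuous (fun θ : ℝ => (1-θ) • p + θ • X) := by fun_prop
  have e1 : ∀ᶠ θ : ℝ in 𝓝[>] 0, (1-θ) • p + θ • X ∈ (closure D)ᶜ := by
    have := hcont.tendsto 0
    simp only [sub_zero, one_smul, zero_smul, add_zero] at this
    exact (this.mono_left nhdsWithin_le_nhds).eventually (isClosed_closure.isOpen_compl.mem_nhds hpD)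
  have e2 : ∀ᶠ θ : ℝ in 𝓝[>] 0, c + α * (θ * η) < d + β * (θ * η) :=
    evlt (by fun_prop) (by fun_prop) (by simpa using hcd)
  have e3 : ∀ᶠ θ : ℝ in 𝓝[>] 0, θ < 1 := evlt continuous_id continuous_const one_pos
  obtain ⟨θ, ⟨⟨a1, a2⟩, a3⟩, a4⟩ := (((e1.and e2).and e3).and self_mem_nhdsWithin).exists
  have a4' : 0 < θ := a4
  set x := (1-θ) • p + θ • X with hx
  have xh : ev h x = θ * η := by rw [hx, ev_combo _ _ _ (by ring), hph, X2]; ring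
  have xt : ev t x = c + α * (θ * η) := by rw [hx, ev_combo _ _ _ (by ring), hpt, X1]; ring
  have h0 : 0 ≤ ev h x := by rw [xh]; positivity
  have h1 : ev h x ≤ η := by rw [xh]; nlinarith
  have xK : x ∈ K := by rw [hs x h0 h1, xh, xt]; exact ⟨le_rfl, a2.le⟩
  have xK' : x ∈ K' := by
    by_contra hc; exact a1 (subset_closure (hD ⟨xK, hc⟩))
  have := ((hs' x h0 h1).1 xK').1
  rw [xh, xt] at this
  have hpos : 0 < θ * η := mul_pos a4' hη
  nlinarith

lemma eqLen_slab {t h : ℝ × ℝ × ℝ} (hd : ldet t h ≠ 0) {K K' : Set Pl} (hK : IsCompact K)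
    (hK' : IsCompact K') {z : Pl} (hE : EqLen z K K') (tz : ev t z = 0) (hz : ev h z = 0)
    {η c d α β α' β' : ℝ} (hη : 0 < η)
    (hs : Slab t h K η c d α β) (hs' : Slab t h K' η c d α' β') (hc : 0 < c) (hcd : c < d) :
    α / c - β / d = α' / c - β' / d := by
  obtain ⟨R, hR⟩ := (hK.union hK').bddAbove_image (ev_cont t).continuousOn
  have hd0 : 0 < d := by linarith
  have ev1 : ∀ γ : ℝ, ∀ᶠ s : ℝ in 𝓝[>] 0, 1/2 < 1 - γ * s := fun γ =>
    evlt (by fun_prop) (by fun_prop) (by norm_num)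
  have ev2 : ∀ γ δ : ℝ, ∀ᶠ s : ℝ in 𝓝[>] 0, c * (1 - δ * s) < d * (1 - γ * s) := fun γ δ =>
    evlt (by fun_prop) (by fun_prop) (by simpa using hcd)
  have ev3 : ∀ᶠ s : ℝ in 𝓝[>] 0, s * R < η := evlt (by fun_prop) (by fun_prop) (by simpa using hη)
  have ev4 : ∀ᶠ s : ℝ in 𝓝[>] 0, s * (2 * d) < η :=
    evlt (by fun_prop) (by fun_prop) (by simpa using hη)
  obtain ⟨s, ⟨⟨⟨⟨⟨⟨⟨⟨a1, a2⟩, a3⟩, a4⟩, a5⟩, a6⟩, a7⟩, a8⟩, a9⟩⟩ :=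
    ((((((((ev1 α).and (ev1 β)).and (ev1 α')).and (ev1 β')).and (ev2 α β)).and (ev2 α' β')).and
      ev3).and ev4 |>.and self_mem_nhdsWithin).exists
  have s0 : 0 < s := a9
  obtain ⟨w, w1, w2⟩ := coord_surj hd 1 s
  set e := w - z with he
  have ray : ∀ r : ℝ, z + r • e = (1 - r) • z + r • w := by intro r; rw [he]; module
  have rt : ∀ r : ℝ, ev t (z + r • e) = r := by
    intro r; rw [ray, ev_combo _ _ _ (by ring), tz, w1]; ring
  have rh : ∀ r : ℝ, ev h (z + r • e) = s * r := by
    intro r; rw [ray, ev_combo _ _ _ (by ring), hz, w2]; ring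
  have main : ∀ (L : Set Pl) (γ δ : ℝ), (∀ x ∈ L, ev t x ≤ R) → Slab t h L η c d γ δ →
      1/2 < 1 - γ * s → 1/2 < 1 - δ * s →
      ∀ r : ℝ, 0 < r → (z + r • e ∈ L ↔ c / (1 - γ * s) ≤ r ∧ r ≤ d / (1 - δ * s)) := by
    intro L γ δ hL hsl g1 g2 r hr
    have p1 : 0 < 1 - γ * s := by linarith
    have p2 : 0 < 1 - δ * s := by linarith
    rw [div_le_iff₀ p1, le_div_iff₀ p2]
    have n0 : 0 ≤ ev h (z + r • e) := by rw [rh]; positivity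
    constructor
    · intro hm
      have hrR : r ≤ R := by have := hL _ hm; rwa [rt] at this
      have := (hsl _ n0 (by rw [rh]; nlinarith)).1 hm
      rw [rt, rh] at this
      constructor <;> nlinarith [this.1, this.2]
    · rintro ⟨b1, b2⟩
      have hr2 : r ≤ 2 * d := by nlinarith
      refine (hsl _ n0 (by rw [rh]; nlinarith)).2 ?_
      rw [rt, rh]
      constructor <;> nlinarith
  have m1 := main K α β (fun x hx => hR ⟨x, Or.inl hx, rfl⟩) hs a1 a2
  have m2 := main K' α' β' (fun x hx => hR ⟨x, Or.inr hx, rfl⟩) hs' a3 a4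
  have q1 : 0 < 1 - α * s := by linarith
  have q2 : 0 < 1 - β * s := by linarith
  have q3 : 0 < 1 - α' * s := by linarith
  have q4 : 0 < 1 - β' * s := by linarith
  have := chord_eq hE (div_pos hc q1) (by rw [div_le_div_iff₀ q1 q2]; exact a5.le) m1
    (div_pos hc q3) (by rw [div_le_div_iff₀ q3 q4]; exact a6.le) m2
  simp only [inv_div] at this
  have e2 : s * (α / c - β / d) = s * (α' / c - β' / d) := by
    simp only [sub_div] at this
    have f1 : ∀ γ k : ℝ, s * (γ / k) = γ * s / k := by intro γ k; ring
    rw [mul_sub, mul_sub, f1, f1, f1, f1]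
    linarith
  exact mul_left_cancel₀ s0.ne' e2

lemma interior_zero {K : Set Pl} (hc : Convex ℝ K) (hi : (interior K).Nonempty) {h : ℝ × ℝ × ℝ}
    {x1 x2 : Pl} (m1 : x1 ∈ K) (m2 : x2 ∈ K) (h1 : ev h x1 < 0) (h2 : 0 < ev h x2) :
    ∃ w ∈ interior K, ev h w = 0 := by
  have hcl := hc.closure_interior_eq_closure_of_nonempty_interior hi
  have e1 : x1 ∈ closure (interior K) := hcl ▸ subset_closure m1
  have e2 : x2 ∈ closure (interior K) := hcl ▸ subset_closure m2
  obtain ⟨y1, b1, c1⟩ := mem_closure_iff.1 e1 _ (isOpen_lt (ev_cont h) continuous_const) h1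
  obtain ⟨y2, b2, c2⟩ := mem_closure_iff.1 e2 _ (isOpen_lt continuous_const (ev_cont h)) h2
  have := hc.interior.isPreconnected.intermediate_value c1 c2 (ev_cont h).continuousOn
  exact this ⟨le_of_lt b1, le_of_lt b2⟩

lemma interior_transfer {K K' : Set Pl} {z w : Pl} (hE : EqLen z K K')
    (hw : w ∈ interior K) : ∃ r : ℝ, 0 < r ∧ z + r • (w - z) ∈ K' := by
  have h1 : 0 < volume {τ : ℝ | 0 < τ ∧ z + τ⁻¹ • (w - z) ∈ K} := by
    have hsub : {τ : ℝ | 0 < τ ∧ z + τ⁻¹ • (w - z) ∈ interior K} ⊆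
        {τ : ℝ | 0 < τ ∧ z + τ⁻¹ • (w - z) ∈ K} := fun τ hτ => ⟨hτ.1, interior_subset hτ.2⟩
    refine lt_of_lt_of_le ?_ (measure_mono hsub)
    have ho : IsOpen {τ : ℝ | 0 < τ ∧ z + τ⁻¹ • (w - z) ∈ interior K} := by
      have hc : ContinuousOn (fun τ : ℝ => z + τ⁻¹ • (w - z)) (Set.Ioi 0) := by
        apply ContinuousOn.add continuousOn_const
        apply ContinuousOn.fun_smul
        · exact continuousOn_id.inv₀ (fun q hq => ne_of_gt hq)
        · fun_prop
      exact hc.isOpen_inter_preimage isOpen_Ioi isOpen_interior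
    exact ho.measure_pos _ ⟨1, one_pos, by simpa using hw⟩
  rw [hE (w - z)] at h1
  obtain ⟨τ, hτ, hm⟩ := nonempty_of_measure_ne_zero h1.ne'
  exact ⟨τ⁻¹, inv_pos.2 hτ, hm⟩

end CC

end

section

open MeasureTheory Pointwise Topology

namespace CC

lemma above_transfer {K K' : Set Pl} (hc : Convex ℝ K) (hi : (interior K).Nonempty) {z x d : Pl}
    (hE : EqLen z K K') {f m : ℝ × ℝ × ℝ} (fz : ev f z = 0) (mz : ev m z = 0)
    (fpos : ∀ x ∈ K, 0 < ev f x) (fpos' : ∀ x ∈ K', 0 < ev f x) (hx : x ∈ K) (hd : d ∈ K)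
    (mx : 0 < ev m x) (md : ev m d = 0) : ∃ x' ∈ K', 0 < ev m x' := by
  have fx := fpos x hx
  have fd := fpos d hd
  set ε := ev m x / (2 * ev f x) with hε
  have hε0 : 0 < ε := by positivity
  have e1 : ev (m - ε • f) d < 0 := by
    rw [ev_sub, ev_smul, md]; have := mul_pos hε0 fd; linarith
  have e2 : 0 < ev (m - ε • f) x := by
    have : ε * ev f x = ev m x / 2 := by rw [hε]; field_simp
    rw [ev_sub, ev_smul, this]; linarith
  obtain ⟨w, hw, hw0⟩ := interior_zero hc hi hd hx e1 e2
  obtain ⟨r, hr, hm⟩ := interior_transfer hE hw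
  refine ⟨_, hm, ?_⟩
  have fp := fpos' _ hm
  have ray : z + r • (w - z) = (1 - r) • z + r • w := by module
  rw [ray, ev_combo _ _ _ (by ring), fz] at fp
  rw [ray, ev_combo _ _ _ (by ring), mz]
  rw [ev_sub, ev_smul] at hw0
  have : ev m w = ε * ev f w := by linarith
  rw [this]
  have := mul_pos hε0 (by linarith : 0 < r * ev f w)
  nlinarith

lemma push_in {K K' D : Set Pl} (hc : Convex ℝ K) (hcl : IsClosed K') {a x : Pl}
    (ha : a ∈ K) (hx : x ∈ K) (hD : K \ K' ⊆ D) {m : ℝ × ℝ × ℝ} (ma : ev m a < 0)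
    (mx : ev m x = 0) (mD : ∀ y ∈ D, 0 ≤ ev m y) : x ∈ K' := by
  by_contra hcon
  have hcont : Continuous (fun θ : ℝ => (1-θ) • x + θ • a) := by fun_prop
  have e1 : ∀ᶠ θ : ℝ in 𝓝[>] 0, (1-θ) • x + θ • a ∈ K'ᶜ := by
    have := hcont.tendsto 0
    simp only [sub_zero, one_smul, zero_smul, add_zero] at this
    exact (this.mono_left nhdsWithin_le_nhds).eventually (hcl.isOpen_compl.mem_nhds hcon)
  have e3 : ∀ᶠ θ : ℝ in 𝓝[>] 0, θ < 1 := evlt continuous_id continuous_const one_pos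
  obtain ⟨θ, ⟨a1, a3⟩, a4⟩ := ((e1.and e3).and self_mem_nhdsWithin).exists
  have a4' : 0 < θ := a4
  have hm : (1-θ) • x + θ • a ∈ K := hc hx ha (by linarith) a4'.le (by ring)
  have := mD _ (hD ⟨hm, a1⟩)
  rw [ev_combo _ _ _ (by ring), mx] at this
  nlinarith

lemma S3b {G G' : Set Pl} (hG : IsPoly G) (hG' : IsPoly G') {z a : Pl} (zE : EqLen z G G')
    (aG : a ∈ G) (aG' : a ∈ G') {D : Set Pl} (hD : D = (G \ G') ∪ (G' \ G)) (hne : D.Nonempty)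
    (haD : a ∉ closure D) {f l : ℝ × ℝ × ℝ} (fz : ev f z = 0) (fpos : ∀ x ∈ G, 0 < ev f x)
    (fpos' : ∀ x ∈ G', 0 < ev f x) (lz : ev l z = 0) (la : ev l a = 0)
    (lpos : ∀ x ∈ D, 0 < ev l x) (hfa : ∀ x ∈ G, ev l x = 0 → ev f x ≤ ev f a) :
    ∃ (m : ℝ × ℝ × ℝ) (p q : Pl), ev m z = 0 ∧ ev m a < 0 ∧ (∀ x ∈ closure D, 0 ≤ ev m x) ∧
      p ∈ closure D ∧ q ∈ closure D ∧ p ≠ q ∧ ev m p = 0 ∧ ev m q = 0 ∧ p ∈ G ∧ q ∈ G ∧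
      (∀ x ∈ G, ev m x = 0 → x ∈ segment ℝ p q) ∧ (∀ x, ev m x = 0 → (x ∈ G ↔ x ∈ G')) ∧
      (∃ x ∈ G, 0 < ev m x) ∧ (∃ x ∈ G', 0 < ev m x) := by
  have hD1 : G \ G' ⊆ D := hD ▸ Set.subset_union_left
  have hD2 : G' \ G ⊆ D := hD ▸ Set.subset_union_right
  have hDsub : closure D ⊆ G ∪ G' := by
    refine closure_minimal ?_ (hG.closed.union hG'.closed)
    rw [hD]; rintro x (h | h)
    · exact Or.inl h.1
    · exact Or.inr h.1
  have hDc : IsCompact (closure D) := (hG.compact.union hG'.compact).of_isClosed_subset isClosed_closure hDsub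
  have fposD : ∀ x ∈ closure D, 0 < ev f x := fun x hx => (hDsub hx).elim (fpos x) (fpos' x)
  have lD : ∀ x ∈ closure D, 0 ≤ ev l x := by
    intro x hx
    exact closure_minimal (fun y hy => (lpos y hy).le) (closed_ge l 0) hx
  obtain ⟨d0, hd0, hmin⟩ := hDc.exists_isMinOn hne.closure
    (f := fun x => ev l x / ev f x) ((ev_cont l).continuousOn.div (ev_cont f).continuousOn
      (fun x hx => (fposD x hx).ne'))
  set lam := ev l d0 / ev f d0 with hlam
  have lam0 : 0 ≤ lam := div_nonneg (lD d0 hd0) (fposD d0 hd0).le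
  set m := l - lam • f with hm
  have evm : ∀ x, ev m x = ev l x - lam * ev f x := by intro x; rw [hm, ev_sub, ev_smul]
  have mz : ev m z = 0 := by rw [evm, lz, fz]; ring
  have mD : ∀ x ∈ closure D, 0 ≤ ev m x := by
    intro x hx
    have h1 : lam ≤ ev l x / ev f x := hmin hx
    rw [le_div_iff₀ (fposD x hx)] at h1
    rw [evm]; linarith
  have md0 : ev m d0 = 0 := by
    have := (fposD d0 hd0).ne'
    rw [evm, hlam]; field_simp; ring
  have ma : ev m a = - lam * ev f a := by rw [evm, la]; ring
  have fa := fpos a aG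
  have hDm : ∀ x ∈ D, ev m x ≠ 0 := by
    intro x hx h0
    rcases lam0.lt_or_eq with hl | hl
    · have ma' : ev m a < 0 := by rw [ma]; nlinarith
      have mD' : ∀ y ∈ D, 0 ≤ ev m y := fun y hy => mD y (subset_closure hy)
      rw [hD] at hx
      rcases hx with hx | hx
      · exact hx.2 (push_in hG.convex hG'.closed aG hx.1 hD1 ma' h0 mD')
      · exact hx.2 (push_in hG'.convex hG.closed aG' hx.1 hD2 ma' h0 mD')
    · rw [evm, ← hl] at h0
      have := lpos x hx
      linarith
  have hline : ∀ x, ev m x = 0 → (x ∈ G ↔ x ∈ G') := by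
    intro x hx
    constructor
    · intro h; by_contra hc; exact hDm x (hD1 ⟨h, hc⟩) hx
    · intro h; by_contra hc; exact hDm x (hD2 ⟨h, hc⟩) hx
  have d0G : d0 ∈ G := by
    rcases hDsub hd0 with h | h
    · exact h
    · exact (hline d0 md0).2 h
  have d0G' : d0 ∈ G' := (hline d0 md0).1 d0G
  obtain ⟨x0, hx0⟩ := hne
  have mx0 : 0 < ev m x0 := lt_of_le_of_ne (mD x0 (subset_closure hx0)) (hDm x0 hx0).symm
  have hab : (∃ x ∈ G, 0 < ev m x) ∧ (∃ x ∈ G', 0 < ev m x) := by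
    rcases hDsub (subset_closure hx0) with h | h
    · exact ⟨⟨x0, h, mx0⟩, above_transfer hG.convex hG.2 zE fz mz fpos fpos' h d0G mx0 md0⟩
    · exact ⟨above_transfer hG'.convex hG'.2 zE.symm fz mz fpos' fpos h d0G' mx0 md0, ⟨x0, h, mx0⟩⟩
  have hdet : ldet f m ≠ 0 := by
    have h1 := ldet_id fz lz a x0
    rw [la, zero_mul, sub_zero] at h1
    have h2 : 0 < ev f a * ev l x0 := mul_pos fa (lpos x0 hx0)
    have h3 : ldet f m = ldet f l := by
      simp only [ldet, hm, Prod.fst_sub, Prod.snd_sub, Prod.smul_fst, Prod.smul_snd, smul_eq_mul]; ring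
    rw [h3]
    intro h0; rw [h0, zero_mul] at h1; linarith
  have hcL : IsCompact (G ∩ {x | ev m x = 0}) := hG.compact.inter_right (closed_eq m 0)
  have hnL : (G ∩ {x | ev m x = 0}).Nonempty := ⟨d0, d0G, md0⟩
  obtain ⟨p, ⟨hp, hp0⟩, hpm⟩ := hcL.exists_isMinOn hnL (ev_cont f).continuousOn
  obtain ⟨q, ⟨hq, hq0⟩, hqm⟩ := hcL.exists_isMaxOn hnL (ev_cont f).continuousOn
  simp only [Set.mem_ofPred_eq] at hp0 hq0
  have hpm' : ∀ x ∈ G, ev m x = 0 → ev f p ≤ ev f x := fun x hx h0 => hpm ⟨hx, h0⟩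
  have hqm' : ∀ x ∈ G, ev m x = 0 → ev f x ≤ ev f q := fun x hx h0 => hqm ⟨hx, h0⟩
  have hpq : p ∈ closure D ∧ q ∈ closure D := by
    rcases (hpm' q hq hq0).lt_or_eq with hlt | heq
    · obtain ⟨η1, α, β, hη1, hs1⟩ := exists_slab hG hdet hp hq hp0 hq0 hpm' hqm' hab.1
      obtain ⟨η2, α', β', hη2, hs2⟩ := exists_slab hG' hdet ((hline p hp0).1 hp)
        ((hline q hq0).1 hq) hp0 hq0 (fun x hx h0 => hpm' x ((hline x h0).2 hx) h0)
        (fun x hx h0 => hqm' x ((hline x h0).2 hx) h0) hab.2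
      set η := min η1 η2
      have hη : 0 < η := lt_min hη1 hη2
      have s1 := hs1.mono (min_le_left η1 η2)
      have s2 := hs2.mono (min_le_right η1 η2)
      have hrel := eqLen_slab hdet hG.compact hG'.compact zE fz mz hη s1 s2 (fpos p hp) hlt
      have fp0 := fpos p hp
      have fq0 := fpos q hq
      have hno : α = α' → β = β' → False := by
        intro h1 h2
        obtain ⟨y, hy1, hy2⟩ := mem_closure_iff.1 hd0 {x | ev m x < η}
          (isOpen_lt (ev_cont m) continuous_const) (by simp only [Set.mem_ofPred_eq]; rw [md0]; exact hη)
        have y0 := mD y (subset_closure hy2)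
        have e1 := s1 y y0 (le_of_lt hy1)
        have e2 := s2 y y0 (le_of_lt hy1)
        rw [← h1, ← h2, ← e1] at e2
        rw [hD] at hy2
        rcases hy2 with h | h
        · exact h.2 (e2.2 h.1)
        · exact h.2 (e2.1 h.1)
      constructor
      · by_contra hcon
        have c1 := edge_cmp hdet hη s1 s2 hlt hD1 rfl hp0 hcon
        have c2 := edge_cmp hdet hη s2 s1 hlt hD2 rfl hp0 hcon
        have c3 := le_antisymm c2 c1
        refine hno c3 ?_
        rw [c3] at hrel
        have : β / ev f q = β' / ev f q := by linarith
        field_simp at this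
        exact this
      · by_contra hcon
        have hdet' : ldet ((0,0,0) - f) m ≠ 0 := by
          have : ldet ((0,0,0) - f) m = - ldet f m := by
            simp only [ldet, Prod.fst_sub, Prod.snd_sub]; ring
          rw [this]; exact neg_ne_zero.2 hdet
        have hq' : ev ((0,0,0) - f) q = 0 - ev f q := by rw [ev_sub]; simp [ev]
        have c1 := edge_cmp hdet' hη (s1.flip 0) (s2.flip 0) (by linarith) hD1 hq' hq0 hcon
        have c2 := edge_cmp hdet' hη (s2.flip 0) (s1.flip 0) (by linarith) hD2 hq' hq0 hcon
        have c3 : β = β' := by linarith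
        refine hno ?_ c3
        rw [c3] at hrel
        have : α / ev f p = α' / ev f p := by linarith
        field_simp at this
        exact this
    · have a1 := hpm' d0 d0G md0
      have a2 := hqm' d0 d0G md0
      have b1 : p = d0 := coord_inj hdet (by linarith) (by rw [hp0, md0])
      have b2 : q = d0 := coord_inj hdet (by linarith) (by rw [hq0, md0])
      rw [b1, b2]; exact ⟨hd0, hd0⟩
  have hlampos : 0 < lam := by
    rcases lam0.lt_or_eq with h | h
    · exact h
    · exfalso
      have hml : ∀ x, ev m x = ev l x := by intro x; rw [evm, ← h]; ring
      have e1 : ev f q ≤ ev f a := hfa q hq (by rw [← hml, hq0])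
      have e2 : ev f a ≤ ev f q := hqm' a aG (by rw [hml, la])
      have : q = a := coord_inj hdet (by linarith) (by rw [hq0, hml, la])
      exact haD (this ▸ hpq.2)
  have ma' : ev m a < 0 := by rw [ma]; nlinarith
  refine ⟨m, p, q, mz, ma', mD, hpq.1, hpq.2, ?_, hp0, hq0, hp, hq, ?_, hline, hab.1, hab.2⟩
  · rintro rfl
    obtain ⟨x1, hx1, hx1m⟩ := hab.1
    obtain ⟨w, hw, hw0⟩ := interior_zero hG.convex hG.2 aG hx1 ma' hx1m
    obtain ⟨e, he1, he2⟩ := coord_surj hdet (ev f w + 1) 0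
    have hcont : Continuous (fun θ : ℝ => (1-θ) • w + θ • e) := by fun_prop
    have e1 : ∀ᶠ θ : ℝ in 𝓝[>] 0, (1-θ) • w + θ • e ∈ interior G := by
      have := hcont.tendsto 0
      simp only [sub_zero, one_smul, zero_smul, add_zero] at this
      exact (this.mono_left nhdsWithin_le_nhds).eventually (isOpen_interior.mem_nhds hw)
    obtain ⟨θ, hθ, hθ0⟩ := (e1.and self_mem_nhdsWithin).exists
    have hθ0' : 0 < θ := hθ0
    have m0 : ev m ((1-θ) • w + θ • e) = 0 := by rw [ev_combo _ _ _ (by ring), hw0, he2]; ring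
    have f0 : ev f ((1-θ) • w + θ • e) = ev f w + θ := by rw [ev_combo _ _ _ (by ring), he1]; ring
    have k1 := hpm' w (interior_subset hw) hw0
    have k2 := hqm' _ (interior_subset hθ) m0
    rw [f0] at k2
    linarith
  · intro x hx h0
    exact seg_of_coord hdet (by rw [h0, hp0]) (by rw [h0, hq0]) (hpm' x hx h0) (hqm' x hx h0)

lemma S3a {G G' H : Set Pl} (hH : IsPoly H) (hG : IsPoly G) (hG' : IsPoly G') (sG : G ⊆ H)
    (sG' : G' ⊆ H) {z a : Pl} (hz : z ∈ Set.extremePoints ℝ H) (ha : a ∈ Set.extremePoints ℝ H)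
    (zG : z ∉ G) (zG' : z ∉ G') (zE : EqLen z G G') (aG : a ∈ G) (aG' : a ∈ G')
    {l : ℝ × ℝ × ℝ} (lz : ev l z = 0) (la : ev l a = 0) (hl : ∀ p, ev l p = 0 → dt z a p = 0)
    (hneg : ∀ v ∈ Set.extremePoints ℝ H, ev l v < 0 → v ∈ G ∧ v ∈ G') :
    ∀ p ∈ H, ev l p ≤ 0 → (p ∈ G ↔ p ∈ G') := by
  intro p hp hpl
  have hza : z ≠ a := by rintro rfl; exact zG aG
  by_cases hpz : p = z
  · rw [hpz]; exact ⟨fun h => absurd h zG, fun h => absurd h zG'⟩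
  set T : Set Pl := {x | ev l x ≤ 0} with hT
  have hc1 : IsCompact (H ∩ T) := hH.compact.inter_right (closed_le l 0)
  have hv1 : Convex ℝ (H ∩ T) := hH.convex.inter (convex_le l 0)
  have zT : z ∈ H ∩ T := ⟨hz.1, by simp [hT, lz]⟩
  have aT : a ∈ H ∩ T := ⟨ha.1, by simp [hT, la]⟩
  set P := Set.extremePoints ℝ (H ∩ T) \ {z} with hP
  have key : ∀ x ∈ Set.extremePoints ℝ (H ∩ T), x ∈ Set.extremePoints ℝ H ∧ (x = z ∨ x ∈ G ∧ x ∈ G') := by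
    intro x hx
    have hxl : ev l x ≤ 0 := hx.1.2
    rcases hxl.lt_or_eq with h | h
    · have : x ∈ Set.extremePoints ℝ H := by
        refine interior_ext hH.convex ?_ hx
        refine mem_interior.2 ⟨{x | ev l x < 0}, ?_, isOpen_lt (ev_cont l) continuous_const, h⟩
        intro y hy
        simp only [hT, Set.mem_ofPred_eq] at hy ⊢
        exact hy.le
      exact ⟨this, Or.inr (hneg x this h)⟩
    · obtain ⟨t, ht⟩ := on_line hza (hl x h)
      have t1 : t ≤ 1 := ext_ray ha hz.1 hza (by
        have : z + t • (a - z) = x := by rw [ht]; module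
        rw [this]; exact hx.1.1)
      have t0 : 1 - t ≤ 1 := ext_ray hz ha.1 hza.symm (by
        have : a + (1 - t) • (z - a) = x := by rw [ht]; module
        rw [this]; exact hx.1.1)
      rcases t1.lt_or_eq with h1 | h1
      · rcases (by linarith : 0 ≤ t).lt_or_eq with h0 | h0
        · have e1 := hx.2 zT aT ⟨1 - t, t, by linarith, h0, by ring, ht.symm⟩
          exact ⟨e1 ▸ hz, Or.inl e1.symm⟩
        · have : x = z := by rw [ht, ← h0]; simp
          exact ⟨this ▸ hz, Or.inl this⟩
      · have : x = a := by rw [ht, h1]; simp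
        exact ⟨this ▸ ha, Or.inr (this ▸ ⟨aG, aG'⟩)⟩
  have hPG : P ⊆ G ∩ G' := by
    rintro x ⟨hx, hxz⟩
    rcases (key x hx).2 with h | h
    · exact absurd h hxz
    · exact h
  have hfin : (insert z P).Finite := by
    refine (hH.ext_finite.subset ?_).insert z
    rintro x ⟨hx, -⟩; exact (key x hx).1
  have haP : a ∈ P := ⟨inter_extremePoints_subset_extremePoints_of_subset Set.inter_subset_left ⟨aT, ha⟩, hza.symm⟩
  have hKM : H ∩ T ⊆ convexHull ℝ (insert z P) := by
    rw [← closure_convexHull_extremePoints hc1 hv1]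
    refine closure_minimal (convexHull_mono ?_) (hfin.isClosed_convexHull ℝ)
    intro x hx
    by_cases h : x = z
    · exact Or.inl h
    · exact Or.inr ⟨hx, h⟩
  -- exit point
  have hdne : p - z ≠ 0 := sub_ne_zero.2 hpz
  set S : Set ℝ := {r | 0 ≤ r ∧ z + r • (p - z) ∈ H} with hS
  have hcont : Continuous (fun r : ℝ => z + r • (p - z)) := by fun_prop
  have hcl : IsClosed S := isClosed_Ici.inter (hH.closed.preimage hcont)
  have hbd : Bornology.IsBounded S := by
    obtain ⟨C, hC⟩ := hH.compact.isBounded.subset_closedBall z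
    refine (Metric.isBounded_Icc (0:ℝ) (C/‖p - z‖)).subset ?_
    rintro r ⟨h0, h1⟩
    refine ⟨h0, ?_⟩
    have := hC h1
    rw [Metric.mem_closedBall, dist_eq_norm, add_sub_cancel_left, norm_smul, Real.norm_of_nonneg h0] at this
    rwa [le_div_iff₀ (norm_pos_iff.2 hdne)]
  have hcomp : IsCompact S := Metric.isCompact_of_isClosed_isBounded hcl hbd
  have h1S : (1:ℝ) ∈ S := ⟨zero_le_one, by simpa using hp⟩
  obtain ⟨r0, hr0, hr0m⟩ := hcomp.exists_isGreatest ⟨1, h1S⟩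
  have hr01 : 1 ≤ r0 := hr0m h1S
  have hexit : ∀ r, z + r • (p - z) ∈ H → r ≤ r0 := by
    intro r hr
    rcases le_total 0 r with h | h
    · exact hr0m ⟨h, hr⟩
    · linarith
  have heT : z + r0 • (p - z) ∈ H ∩ T := by
    refine ⟨hr0.2, ?_⟩
    have : z + r0 • (p - z) = (1 - r0) • z + r0 • p := by module
    simp only [hT, Set.mem_ofPred_eq]
    rw [this, ev_combo _ _ _ (by ring), lz]
    nlinarith
  have hm := hKM heT
  rw [convexHull_insert ⟨a, haP⟩, mem_convexJoin] at hm
  obtain ⟨z', hz', k, hk, hseg⟩ := hm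
  rw [Set.mem_singleton_iff] at hz'
  rw [hz'] at hseg
  have hkG : k ∈ G ∩ G' := convexHull_min hPG (hG.convex.inter hG'.convex) hk
  obtain ⟨s, t, hs, ht, hst, he⟩ := hseg
  have ht0 : 0 < t := by
    rcases ht.lt_or_eq with h | h
    · exact h
    · exfalso
      rw [← h] at hst he
      have : s = 1 := by linarith
      rw [this] at he
      simp only [one_smul, zero_smul, add_zero] at he
      have h2 : r0 • (p - z) = 0 := by
        have := he.symm; simpa using this
      rcases smul_eq_zero.1 h2 with h3 | h3
      · linarith
      · exact hdne h3
  have hk2 : k = z + (r0 / t) • (p - z) := by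
    have h1 : t • k = t • (z + (r0 / t) • (p - z)) := by
      have hss : s = 1 - t := by linarith
      rw [smul_add, smul_smul, mul_div_cancel₀ _ ht0.ne']
      rw [hss] at he
      have h2 : t • k = z + r0 • (p - z) - (1 - t) • z := by rw [← he]; abel
      rw [h2]; module
    exact smul_right_injective _ ht0.ne' h1
  have hle := hexit (r0 / t) (hk2 ▸ sG hkG.1)
  have ht1 : t = 1 := by
    rw [div_le_iff₀ ht0] at hle
    have : 1 ≤ t := by
      by_contra h; push Not at h; nlinarith
    linarith
  rw [ht1, div_one] at hk2
  have := chord2 hG.compact hG.convex hG'.compact hG'.convex zG zG' zE (d := p - z) (r0 := r0) (by linarith)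
    (hk2 ▸ hkG.1) (hk2 ▸ hkG.2) (fun r hr => hexit r (sG hr)) (fun r hr => hexit r (sG' hr)) (r := 1) one_pos
  simpa using this

end CC

end

section

open MeasureTheory Pointwise Topology

namespace CC

lemma line_dt {m : ℝ × ℝ × ℝ} {a : Pl} (ha : ev m a ≠ 0) {p q x : Pl} (hp : ev m p = 0)
    (hq : ev m q = 0) (hx : ev m x = 0) : dt p q x = 0 := by
  by_contra h
  have e : ev m a * dt p q x = ev m p * dt q x a + ev m q * dt x p a + ev m x * dt p q a := by
    simp only [ev, dt]; ring
  rw [hp, hq, hx] at e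
  simp only [zero_mul, add_zero] at e
  rcases mul_eq_zero.1 e with h1 | h1
  · exact ha h1
  · exact h h1

lemma S3 {G G' H : Set Pl} (hH : IsPoly H) (hG : IsPoly G) (hG' : IsPoly G') (sG : G ⊆ H)
    (sG' : G' ⊆ H) (hx : ∀ x ∈ Set.extremePoints ℝ H, (x ∈ G ∧ x ∈ G') ∨
      (x ∉ G ∧ x ∉ G' ∧ EqLen x G G')) {a : Pl} (ha : a ∈ Set.extremePoints ℝ H) (aG : a ∈ G)
    (aG' : a ∈ G') {U : Set Pl} (hU : U ∈ 𝓝 a) (hloc : G ∩ U = G' ∩ U) : G = G' := by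
  by_contra hne
  set D := (G \ G') ∪ (G' \ G) with hD
  have hDne : D.Nonempty := by
    by_contra h
    rw [Set.not_nonempty_iff_eq_empty, hD, Set.union_empty_iff, Set.sdiff_eq_empty, Set.sdiff_eq_empty] at h
    exact hne (h.1.antisymm h.2)
  have haD : a ∉ closure D := by
    intro h
    obtain ⟨V, hVU, hVo, haV⟩ := mem_nhds_iff.1 hU
    obtain ⟨y, hy1, hy2⟩ := mem_closure_iff.1 h V hVo haV
    rcases hy2 with hy2 | hy2
    · have : y ∈ G' ∩ U := hloc ▸ ⟨hy2.1, hVU hy1⟩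
      exact hy2.2 this.1
    · have : y ∈ G ∩ U := hloc.symm ▸ ⟨hy2.1, hVU hy1⟩
      exact hy2.2 this.1
  have hDH : D ⊆ H := by
    rintro x (h | h)
    · exact sG h.1
    · exact sG' h.1
  have hDno : ∀ x ∈ D, ¬ (x ∈ G ↔ x ∈ G') := by
    rintro x (h | h) h2
    · exact h.2 (h2.1 h.1)
    · exact h.2 (h2.2 h.1)
  -- the set of outside vertices
  have hfin : {x | x ∈ Set.extremePoints ℝ H ∧ x ∉ G}.Finite := hH.ext_finite.subset fun x h => h.1
  set W := hfin.toFinset with hW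
  have hWm : ∀ x, x ∈ W ↔ x ∈ Set.extremePoints ℝ H ∧ x ∉ G := by
    intro x; rw [hW, Set.Finite.mem_toFinset]; rfl
  have hWn : W.Nonempty := by
    by_contra h
    rw [Finset.not_nonempty_iff_eq_empty] at h
    have h1 : ∀ x ∈ Set.extremePoints ℝ H, x ∈ G ∧ x ∈ G' := by
      intro x hxe
      rcases hx x hxe with h2 | h2
      · exact h2
      · have : x ∈ W := (hWm x).2 ⟨hxe, h2.1⟩
        rw [h] at this; simp at this
    apply hne
    rw [sG.antisymm (hH.subset_of_ext hG.convex fun x hxe => (h1 x hxe).1),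
      sG'.antisymm (hH.subset_of_ext hG'.convex fun x hxe => (h1 x hxe).2)]
  obtain ⟨l0, hl0, hl0p⟩ := hH.expose ha
  have hWpos : ∀ w ∈ W, ev l0 a < ev l0 w := by
    intro w hw
    rw [hl0]
    exact hl0p w ((hWm w).1 hw).1.1 (by rintro rfl; exact ((hWm _).1 hw).2 aG)
  obtain ⟨z, hzW, hzmin⟩ := dir_order hWn hWpos
  obtain ⟨y, hyW, hymax⟩ := dir_order' hWn hWpos
  have data : ∀ w ∈ W, w ∈ Set.extremePoints ℝ H ∧ w ∉ G ∧ w ∉ G' ∧ EqLen w G G' := by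
    intro w hw
    obtain ⟨h1, h2⟩ := (hWm w).1 hw
    rcases hx w h1 with h | h
    · exact absurd h.1 h2
    · exact ⟨h1, h⟩
  obtain ⟨zH, zG, zG', zE⟩ := data z hzW
  obtain ⟨yH, yG, yG', yE⟩ := data y hyW
  have notW : ∀ v ∈ Set.extremePoints ℝ H, v ∉ W → v ∈ G ∧ v ∈ G' := by
    intro v hv hvW
    rcases hx v hv with h | h
    · exact h
    · exact absurd ((hWm v).2 ⟨hv, h.1⟩) hvW
  have Dz : ∀ x ∈ D, 0 < ev (dl a z) x := by
    intro x hxD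
    by_contra hcon
    push Not at hcon
    refine hDno x hxD (S3a hH hG hG' sG sG' zH ha zG zG' zE aG aG' (l := dl a z)
      (by rw [ev_dl, dt_self_right]) (by rw [ev_dl, dt_self_left])
      (fun p hp => by rw [ev_dl] at hp; rw [dt_swap, hp, neg_zero]) ?_ x (hDH hxD) hcon)
    intro v hv hv0
    refine notW v hv (fun h => ?_)
    have := hzmin v h
    rw [ev_dl] at hv0; linarith
  have Dy : ∀ x ∈ D, 0 < ev (dl y a) x := by
    intro x hxD
    by_contra hcon
    push Not at hcon
    refine hDno x hxD (S3a hH hG hG' sG sG' yH ha yG yG' yE aG aG' (l := dl y a)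
      (by rw [ev_dl, dt_self_left]) (by rw [ev_dl, dt_self_right])
      (fun p hp => by rw [ev_dl] at hp; exact hp) ?_ x (hDH hxD) hcon)
    intro v hv hv0
    refine notW v hv (fun h => ?_)
    have := hymax v h
    rw [ev_dl, dt_swap] at hv0; linarith
  have hzy : z ≠ y := by
    rintro rfl
    obtain ⟨x, hxD⟩ := hDne
    have h1 := Dz x hxD
    have h2 := Dy x hxD
    rw [ev_dl] at h1 h2
    rw [dt_swap] at h2; linarith
  have hfa : ∀ w ∈ Set.extremePoints ℝ H, w ∉ G → ∀ f : ℝ × ℝ × ℝ, ev f w = 0 →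
      (∀ p ∈ H, p ≠ w → 0 < ev f p) → ∀ x ∈ G, dt w a x = 0 → ev f x ≤ ev f a := by
    intro w hw hwG f fw fp x hxG hd
    have hwa : w ≠ a := by rintro rfl; exact hwG aG
    obtain ⟨t, ht⟩ := on_line hwa hd
    have t1 : t ≤ 1 := ext_ray ha hw.1 hwa (by
        have : w + t • (a - w) = x := by rw [ht]; module
        rw [this]; exact sG hxG)
    rw [ht, ev_combo _ _ _ (by ring), fw]
    have := fp a ha.1 hwa.symm
    nlinarith
  have ne : ∀ (K : Set Pl) (w : Pl), w ∉ K → ∀ p ∈ K, p ≠ w := by rintro K w hK p hp rfl; exact hK hp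
  obtain ⟨f, fz, fp⟩ := hH.expose zH
  obtain ⟨g, gy, gp⟩ := hH.expose yH
  obtain ⟨m, p, q, mz, ma, mD, pD, qD, pq, mp, mq, pG, qG, mseg, mline, mab, mab'⟩ :=
    S3b hG hG' zE aG aG' hD hDne haD fz (fun x hx => fp x (sG hx) (ne G z zG x hx))
      (fun x hx => fp x (sG' hx) (ne G' z zG' x hx)) (l := dl a z)
      (by rw [ev_dl, dt_self_right]) (by rw [ev_dl, dt_self_left]) Dz
      (fun x hxG h0 => hfa z zH zG f fz fp x hxG (by rw [ev_dl] at h0; rw [dt_swap, h0, neg_zero]))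
  obtain ⟨n, p', q', ny, na, nD, pD', qD', pq', np, nq, pG', qG', nseg, nline, nab, nab'⟩ :=
    S3b hG hG' yE aG aG' hD hDne haD gy (fun x hx => gp x (sG hx) (ne G y yG x hx))
      (fun x hx => gp x (sG' hx) (ne G' y yG' x hx)) (l := dl y a)
      (by rw [ev_dl, dt_self_left]) (by rw [ev_dl, dt_self_right]) Dy
      (fun x hxG h0 => hfa y yH yG g gy gp x hxG (by rw [ev_dl] at h0; exact h0))
  have crossing : ∀ P ∈ G, P ∈ closure D → ev n P = 0 → ev m P = 0 := by
    intro P hPG hPD hnP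
    by_contra hcon
    have hpos : 0 < ev m P := lt_of_le_of_ne (mD P hPD) (Ne.symm hcon)
    set θ := (- ev m a) / (ev m P - ev m a) with hθ
    have hden : 0 < ev m P - ev m a := by linarith
    have h0 : 0 < θ := div_pos (by linarith) hden
    have h1 : θ < 1 := by rw [hθ, div_lt_one hden]; linarith
    have hxG : (1-θ) • a + θ • P ∈ G := hG.convex aG hPG (by linarith) h0.le (by ring)
    have hxm : ev m ((1-θ) • a + θ • P) = 0 := by
      rw [ev_combo _ _ _ (by ring), hθ]; field_simp; ring
    have hxn : ev n ((1-θ) • a + θ • P) < 0 := by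
      rw [ev_combo _ _ _ (by ring), hnP]; nlinarith
    have : (1-θ) • a + θ • P ∈ {x | 0 ≤ ev n x} :=
      (convex_ge n 0).segment_subset (nD p pD) (nD q qD) (mseg _ hxG hxm)
    simp only [Set.mem_ofPred_eq] at this
    linarith
  have mp' := crossing p' pG' pD' np
  have mq' := crossing q' qG' qD' nq
  have my : ev m y = 0 := by
    obtain ⟨t, ht⟩ := on_line pq' (line_dt na.ne np nq ny)
    rw [ht, ev_combo _ _ _ (by ring), mp', mq']; ring
  -- coordinate t along zy
  set N := (y.1 - z.1)^2 + (y.2 - z.2)^2 with hN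
  have hN0 : 0 < N := by
    rcases lt_or_eq_of_le (by positivity : 0 ≤ N) with h | h
    · exact h
    · exfalso; apply hzy
      have a1 : (y.1 - z.1)^2 = 0 := by nlinarith [sq_nonneg (y.1-z.1), sq_nonneg (y.2-z.2)]
      have a2 : (y.2 - z.2)^2 = 0 := by nlinarith [sq_nonneg (y.1-z.1), sq_nonneg (y.2-z.2)]
      rw [sq_eq_zero_iff, sub_eq_zero] at a1 a2
      exact Prod.ext a1.symm a2.symm
  set t : ℝ × ℝ × ℝ := ((y.1 - z.1)/N, (y.2 - z.2)/N, -((y.1 - z.1)*z.1 + (y.2-z.2)*z.2)/N) with ht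
  have tz : ev t z = 0 := by simp only [ev, ht]; ring
  have ty : ev t y = 1 := by
    have : ev t y = ((y.1 - z.1)^2 + (y.2 - z.2)^2)/N := by simp only [ev, ht]; ring
    rw [this, ← hN, div_self hN0.ne']
  have hdet : ldet t m ≠ 0 := by
    have h1 := ldet_id tz mz y a
    rw [ty, my] at h1
    intro h0; rw [h0] at h1; linarith
  have hseg : ∀ x ∈ G, ev m x = 0 → 0 < ev t x ∧ ev t x < 1 := by
    intro x hxG hx0
    obtain ⟨r, hr⟩ := on_line hzy (line_dt ma.ne mz my hx0)
    have r1 : r ≤ 1 := ext_ray yH zH.1 hzy (by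
        have : z + r • (y - z) = x := by rw [hr]; module
        rw [this]; exact sG hxG)
    have r0 : 1 - r ≤ 1 := ext_ray zH yH.1 hzy.symm (by
        have : y + (1 - r) • (z - y) = x := by rw [hr]; module
        rw [this]; exact sG hxG)
    have e : ev t x = r := by rw [hr, ev_combo _ _ _ (by ring), tz, ty]; ring
    rw [e]
    constructor
    · rcases (by linarith : 0 ≤ r).lt_or_eq with h | h
      · exact h
      · exfalso; apply zG; rw [← h] at hr; simp at hr; exact hr ▸ hxG
    · rcases r1.lt_or_eq with h | h
      · exact h
      · exfalso; apply yG; rw [h] at hr; simp at hr; exact hr ▸ hxG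
  have hcL : IsCompact (G ∩ {x | ev m x = 0}) := hG.compact.inter_right (closed_eq m 0)
  have hnL : (G ∩ {x | ev m x = 0}).Nonempty := ⟨p, pG, mp⟩
  obtain ⟨P, ⟨hP, hP0⟩, hPm⟩ := hcL.exists_isMinOn hnL (ev_cont t).continuousOn
  obtain ⟨Q, ⟨hQ, hQ0⟩, hQm⟩ := hcL.exists_isMaxOn hnL (ev_cont t).continuousOn
  simp only [Set.mem_ofPred_eq] at hP0 hQ0
  have hPm' : ∀ x ∈ G, ev m x = 0 → ev t P ≤ ev t x := fun x hx h0 => hPm ⟨hx, h0⟩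
  have hQm' : ∀ x ∈ G, ev m x = 0 → ev t x ≤ ev t Q := fun x hx h0 => hQm ⟨hx, h0⟩
  have hlt : ev t P < ev t Q := by
    by_contra hcon
    push Not at hcon
    apply pq
    have a1 := hPm' p pG mp
    have a2 := hQm' p pG mp
    have a3 := hPm' q qG mq
    have a4 := hQm' q qG mq
    exact coord_inj hdet (by linarith) (by rw [mp, mq])
  obtain ⟨η1, α, β, hη1, hs1⟩ := exists_slab hG hdet hP hQ hP0 hQ0 hPm' hQm' mab
  obtain ⟨η2, α', β', hη2, hs2⟩ := exists_slab hG' hdet ((mline P hP0).1 hP)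
    ((mline Q hQ0).1 hQ) hP0 hQ0 (fun x hx h0 => hPm' x ((mline x h0).2 hx) h0)
    (fun x hx h0 => hQm' x ((mline x h0).2 hx) h0) mab'
  set η := min η1 η2
  have hη : 0 < η := lt_min hη1 hη2
  have s1 := hs1.mono (min_le_left η1 η2)
  have s2 := hs2.mono (min_le_right η1 η2)
  have hc0 := (hseg P hP hP0).1
  have hd1 := (hseg Q hQ hQ0).2
  have rel1 := eqLen_slab hdet hG.compact hG'.compact zE tz mz hη s1 s2 hc0 hlt
  have hdet' : ldet ((0,0,1) - t) m ≠ 0 := by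
    have : ldet ((0,0,1) - t) m = - ldet t m := by
      simp only [ldet, Prod.fst_sub, Prod.snd_sub]; ring
    rw [this]; exact neg_ne_zero.2 hdet
  have ty' : ev ((0,0,1) - t) y = 0 := by rw [ev_sub, ty]; simp [ev]
  have rel2 := eqLen_slab hdet' hG.compact hG'.compact yE ty' my hη (s1.flip 1) (s2.flip 1)
    (by linarith) (by linarith)
  generalize ev t P = c at *
  generalize ev t Q = d at *
  have hd0 : 0 < d := by linarith
  have hd1' : 0 < 1 - d := by linarith
  have hc1' : 0 < 1 - c := by linarith
  have k1 : (α - α') * d = (β - β') * c := by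
    field_simp at rel1; linarith
  have k2 : (β - β') * (1 - c) = (α - α') * (1 - d) := by
    field_simp at rel2; linarith
  have k3 : β - β' = α - α' := by linarith
  have k4 : (α - α') * (d - c) = 0 := by rw [k3] at k1; linarith
  have k5 : α = α' := by
    rcases mul_eq_zero.1 k4 with h | h <;> linarith
  have k6 : β = β' := by linarith
  obtain ⟨x, hx1, hx2⟩ := mem_closure_iff.1 pD {x | ev m x < η}
    (isOpen_lt (ev_cont m) continuous_const) (by simp only [Set.mem_ofPred_eq]; rw [mp]; exact hη)
  have x0 := mD x (subset_closure hx2)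
  have e1 := s1 x x0 (le_of_lt hx1)
  have e2 := s2 x x0 (le_of_lt hx1)
  rw [← k5, ← k6, ← e1] at e2
  exact hDno x hx2 e2.symm

end CC

end

section

open MeasureTheory Pointwise Topology

namespace CC

/-- vertex `z` lies in `F`, `F'` only, and these coincide near `z` -/
def Ty (F G F' G' : Set Pl) (z : Pl) : Prop :=
  z ∈ F ∧ z ∈ F' ∧ z ∉ G ∧ z ∉ G' ∧ ∃ U ∈ 𝓝 z, F ∩ U = F' ∩ U

def Wt (F G F' G' : Set Pl) (z : Pl) : Prop := z ∈ F ∧ z ∈ G ∧ z ∈ F' ∧ z ∈ G'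

structure Dat (F G F' G' H : Set Pl) : Prop where
  hF : IsPoly F
  hG : IsPoly G
  hF' : IsPoly F'
  hG' : IsPoly G'
  hH : IsPoly H
  sF : F ⊆ H
  sG : G ⊆ H
  sF' : F' ⊆ H
  sG' : G' ⊆ H
  hid : ID F G F' G'
  cl : ∀ z ∈ Set.extremePoints ℝ H, Wt F G F' G' z ∨ (Ty F G F' G' z ∨ Ty G F G' F' z) ∨
    (Ty F G G' F' z ∨ Ty G F F' G' z)
  h2 : ∀ z ∈ Set.extremePoints ℝ H, ∀ y ∈ Set.extremePoints ℝ H, z ≠ y →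
    (∀ v ∈ Set.extremePoints ℝ H, v ≠ z → v ≠ y → 0 < dt z y v) →
    (((z ∈ F ∧ y ∈ F) ∨ (z ∈ G ∧ y ∈ G)) ↔ ((z ∈ F' ∧ y ∈ F') ∨ (z ∈ G' ∧ y ∈ G')))

lemma Ty.symm {F G F' G' : Set Pl} {z : Pl} (h : Ty F G F' G' z) : Ty F' G' F G z := by
  obtain ⟨a, b, c, d, U, hU, e⟩ := h
  exact ⟨b, a, d, c, U, hU, e.symm⟩

lemma Dat.swapFG {F G F' G' H : Set Pl} (h : Dat F G F' G' H) : Dat G F G' F' H where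
  hF := h.hG
  hG := h.hF
  hF' := h.hG'
  hG' := h.hF'
  hH := h.hH
  sF := h.sG
  sG := h.sF
  sF' := h.sG'
  sG' := h.sF'
  hid := h.hid.comm
  cl := by
    intro z hz
    rcases h.cl z hz with ⟨a, b, c, d⟩ | (a | a) | (a | a)
    · exact Or.inl ⟨b, a, d, c⟩
    · exact Or.inr (Or.inl (Or.inr a))
    · exact Or.inr (Or.inl (Or.inl a))
    · exact Or.inr (Or.inr (Or.inr a))
    · exact Or.inr (Or.inr (Or.inl a))
  h2 := by
    intro z hz y hy hne he
    have := h.h2 z hz y hy hne he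
    tauto

lemma Dat.swapP {F G F' G' H : Set Pl} (h : Dat F G F' G' H) : Dat F' G' F G H where
  hF := h.hF'
  hG := h.hG'
  hF' := h.hF
  hG' := h.hG
  hH := h.hH
  sF := h.sF'
  sG := h.sG'
  sF' := h.sF
  sG' := h.sG
  hid := h.hid.symm
  cl := by
    intro z hz
    rcases h.cl z hz with ⟨a, b, c, d⟩ | (a | a) | (a | a)
    · exact Or.inl ⟨c, d, a, b⟩
    · exact Or.inr (Or.inl (Or.inl a.symm))
    · exact Or.inr (Or.inl (Or.inr a.symm))
    · exact Or.inr (Or.inr (Or.inr a.symm))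
    · exact Or.inr (Or.inr (Or.inl a.symm))
  h2 := by
    intro z hz y hy hne he
    exact (h.h2 z hz y hy hne he).symm

lemma Dat.swapOne {F G F' G' H : Set Pl} (h : Dat F G F' G' H) : Dat F G G' F' H where
  hF := h.hF
  hG := h.hG
  hF' := h.hG'
  hG' := h.hF'
  hH := h.hH
  sF := h.sF
  sG := h.sG
  sF' := h.sG'
  sG' := h.sF'
  hid := h.hid.comm'
  cl := by
    intro z hz
    rcases h.cl z hz with ⟨a, b, c, d⟩ | (a | a) | (a | a)
    · exact Or.inl ⟨a, b, d, c⟩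
    · exact Or.inr (Or.inr (Or.inl a))
    · exact Or.inr (Or.inr (Or.inr a))
    · exact Or.inr (Or.inl (Or.inl a))
    · exact Or.inr (Or.inl (Or.inr a))
  h2 := by
    intro z hz y hy hne he
    have := h.h2 z hz y hy hne he
    tauto

lemma Dat.eqLen {F G F' G' H : Set Pl} (h : Dat F G F' G' H) {z : Pl}
    (hz : z ∈ Set.extremePoints ℝ H) (ht : Ty F G F' G' z) : EqLen z G G' := by
  obtain ⟨a, b, c, d, U, hU, e⟩ := ht
  exact eqLen_of_local h.hF h.hG h.hF' h.hG' h.hH h.sF h.sG h.sF' h.sG' h.hid hz a c d hU e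

lemma ext_collinear {H : Set Pl} {z y v : Pl} (hz : z ∈ Set.extremePoints ℝ H)
    (hy : y ∈ Set.extremePoints ℝ H) (hv : v ∈ Set.extremePoints ℝ H) (hzy : z ≠ y)
    (h : dt z y v = 0) : v = z ∨ v = y := by
  obtain ⟨t, ht⟩ := on_line hzy h
  have t1 : t ≤ 1 := ext_ray hy hz.1 hzy (by
    have : z + t • (y - z) = v := by rw [ht]; module
    rw [this]; exact hv.1)
  have t0 : 1 - t ≤ 1 := ext_ray hz hy.1 hzy.symm (by
    have : y + (1 - t) • (z - y) = v := by rw [ht]; module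
    rw [this]; exact hv.1)
  rcases t1.lt_or_eq with h1 | h1
  · rcases (by linarith : 0 ≤ t).lt_or_eq with h0 | h0
    · exact Or.inl (hv.2 hz.1 hy.1 ⟨1 - t, t, by linarith, h0, by ring, ht.symm⟩).symm
    · left; rw [ht, ← h0]; simp
  · right; rw [ht, h1]; simp

lemma side1 {H : Set Pl} (hH : Convex ℝ H) {z y x v : Pl} (hz : z ∈ Set.extremePoints ℝ H)
    (hy : y ∈ Set.extremePoints ℝ H) (hx : x ∈ Set.extremePoints ℝ H)
    (hv : v ∈ Set.extremePoints ℝ H) (h1 : 0 < dt z y x) (h2 : 0 < dt x y v) : 0 < dt z y v := by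
  by_contra hcon
  push Not at hcon
  have e1 : 0 ≤ dt z v y := by rw [dt_swap']; linarith
  have e2 : 0 < dt x z y := by
    have e : dt x z y = dt z y x := by simp only [dt]; ring
    rw [e]; exact h1
  have e3 : 0 < dt v x y := by have := dt_rot v x y; rw [← this]; exact h2
  have e4 : 0 < dt z v x := by
    have : dt z v x = dt z v y + dt x z y + dt v x y := by simp only [dt]; ring
    linarith
  have hm := mem_tri e4 e1 e2.le e3.le
  refine ext_not_mem_hull hH hy (S := {z, v, x}) ?_ ?_ hm
  · rintro w (rfl | rfl | rfl)
    · exact hz.1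
    · exact hv.1
    · exact hx.1
  · rintro (rfl | rfl | rfl)
    · rw [dt_self] at h1; exact lt_irrefl _ h1
    · rw [dt_self_right] at h2; exact lt_irrefl _ h2
    · rw [dt_self_right] at h1; exact lt_irrefl _ h1

lemma side2 {H : Set Pl} (hH : Convex ℝ H) {z y x v : Pl} (hz : z ∈ Set.extremePoints ℝ H)
    (hy : y ∈ Set.extremePoints ℝ H) (hx : x ∈ Set.extremePoints ℝ H)
    (hv : v ∈ Set.extremePoints ℝ H) (h1 : 0 < dt z y x) (h2 : 0 < dt z x v) : 0 < dt z y v := by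
  by_contra hcon
  push Not at hcon
  have e1 : 0 < dt y x z := by rw [dt_rot]; exact h1
  have e2 : 0 ≤ dt v y z := by rw [dt_rot, dt_swap']; linarith
  have e3 : 0 < dt x v z := by rw [dt_rot]; exact h2
  have e4 : 0 < dt y x v := by
    have : dt y x v = dt y x z + dt v y z + dt x v z := by simp only [dt]; ring
    linarith
  have hm := mem_tri e4 e1.le e2 e3.le
  refine ext_not_mem_hull hH hz (S := {y, x, v}) ?_ ?_ hm
  · rintro w (rfl | rfl | rfl)
    · exact hy.1
    · exact hx.1
    · exact hv.1
  · rintro (rfl | rfl | rfl)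
    · rw [dt_self] at h1; exact lt_irrefl _ h1
    · rw [dt_self] at h2; exact lt_irrefl _ h2
    · rw [dt_self_left] at h2; exact lt_irrefl _ h2

/-- good/bad mixed pair -/
def Mixed (F G F' G' : Set Pl) (z y : Pl) : Prop :=
  ((Ty F G F' G' z ∨ Ty G F G' F' z) ∧ (Ty F G G' F' y ∨ Ty G F F' G' y)) ∨
  ((Ty F G F' G' y ∨ Ty G F G' F' y) ∧ (Ty F G G' F' z ∨ Ty G F F' G' z))

lemma Mixed.comm {F G F' G' : Set Pl} {z y : Pl} (h : Mixed F G F' G' z y) :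
    Mixed F G F' G' y z := Or.symm h

lemma mixed_no_edge {F G F' G' H : Set Pl} (h : Dat F G F' G' H) {z y : Pl}
    (hz : z ∈ Set.extremePoints ℝ H) (hy : y ∈ Set.extremePoints ℝ H) (hzy : z ≠ y)
    (hm : Mixed F G F' G' z y)
    (he : ∀ v ∈ Set.extremePoints ℝ H, v ≠ z → v ≠ y → 0 < dt z y v) : False := by
  have := h.h2 z hz y hy hzy he
  unfold Mixed Ty at hm
  tauto

lemma sideW {F G F' G' H : Set Pl} (h : Dat F G F' G' H) (n : ℕ) : ∀ {z y : Pl},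
    z ∈ Set.extremePoints ℝ H → y ∈ Set.extremePoints ℝ H → z ≠ y → Mixed F G F' G' z y →
    {v | v ∈ Set.extremePoints ℝ H ∧ 0 < dt z y v}.ncard ≤ n →
    ∃ w ∈ Set.extremePoints ℝ H, Wt F G F' G' w ∧ 0 < dt z y w := by
  induction n with
  | zero =>
    intro z y hz hy hzy hm hn
    exfalso
    have hfin : {v | v ∈ Set.extremePoints ℝ H ∧ 0 < dt z y v}.Finite := h.hH.ext_finite.subset fun v hv => hv.1
    have hem := (Set.ncard_eq_zero hfin).1 (Nat.le_zero.1 hn)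
    refine mixed_no_edge h hy hz hzy.symm hm.comm (fun v hv hvy hvz => ?_)
    have h1 : ¬ 0 < dt z y v := fun h0 => by
      have : v ∈ {v | v ∈ Set.extremePoints ℝ H ∧ 0 < dt z y v} := ⟨hv, h0⟩
      rw [hem] at this; exact this
    have h2 : dt z y v ≠ 0 := fun h0 => by
      rcases ext_collinear hz hy hv hzy h0 with h3 | h3
      · exact hvz h3
      · exact hvy h3
    rw [dt_swap]
    have := lt_of_le_of_ne (not_lt.1 h1) h2
    linarith
  | succ n ih =>
    intro z y hz hy hzy hm hn
    have hfin : {v | v ∈ Set.extremePoints ℝ H ∧ 0 < dt z y v}.Finite := h.hH.ext_finite.subset fun v hv => hv.1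
    rcases Set.eq_empty_or_nonempty {v | v ∈ Set.extremePoints ℝ H ∧ 0 < dt z y v} with hem | ⟨x, hx, hx0⟩
    · exfalso
      refine mixed_no_edge h hy hz hzy.symm hm.comm (fun v hv hvy hvz => ?_)
      have h1 : ¬ 0 < dt z y v := fun h0 => by
        have : v ∈ {v | v ∈ Set.extremePoints ℝ H ∧ 0 < dt z y v} := ⟨hv, h0⟩
        rw [hem] at this; exact this
      have h2 : dt z y v ≠ 0 := fun h0 => by
        rcases ext_collinear hz hy hv hzy h0 with h3 | h3
        · exact hvz h3
        · exact hvy h3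
      rw [dt_swap]
      have := lt_of_le_of_ne (not_lt.1 h1) h2
      linarith
    · have hxy : x ≠ y := by rintro rfl; rw [dt_self_right] at hx0; exact lt_irrefl _ hx0
      have hzx : z ≠ x := by rintro rfl; rw [dt_self_left] at hx0; exact lt_irrefl _ hx0
      have goxy : Mixed F G F' G' x y → ∃ w ∈ Set.extremePoints ℝ H, Wt F G F' G' w ∧ 0 < dt z y w := by
        intro hm'
        obtain ⟨w, hw, hwW, hw0⟩ := ih hx hy hxy hm' (by
          have hss : {v | v ∈ Set.extremePoints ℝ H ∧ 0 < dt x y v} ⊂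
              {v | v ∈ Set.extremePoints ℝ H ∧ 0 < dt z y v} := by
            refine ⟨fun v hv => ⟨hv.1, side1 h.hH.convex hz hy hx hv.1 hx0 hv.2⟩, fun hcon => ?_⟩
            have := (hcon ⟨hx, hx0⟩).2
            rw [dt_self_left] at this; exact lt_irrefl _ this
          have := Set.ncard_lt_ncard hss hfin
          omega)
        exact ⟨w, hw, hwW, side1 h.hH.convex hz hy hx hw hx0 hw0⟩
      have gozx : Mixed F G F' G' z x → ∃ w ∈ Set.extremePoints ℝ H, Wt F G F' G' w ∧ 0 < dt z y w := by
        intro hm'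
        obtain ⟨w, hw, hwW, hw0⟩ := ih hz hx hzx hm' (by
          have hss : {v | v ∈ Set.extremePoints ℝ H ∧ 0 < dt z x v} ⊂
              {v | v ∈ Set.extremePoints ℝ H ∧ 0 < dt z y v} := by
            refine ⟨fun v hv => ⟨hv.1, side2 h.hH.convex hz hy hx hv.1 hx0 hv.2⟩, fun hcon => ?_⟩
            have := (hcon ⟨hx, hx0⟩).2
            rw [dt_self_right] at this; exact lt_irrefl _ this
          have := Set.ncard_lt_ncard hss hfin
          omega)
        exact ⟨w, hw, hwW, side2 h.hH.convex hz hy hx hw hx0 hw0⟩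
      rcases h.cl x hx with hW | hg | hb
      · exact ⟨x, hx, hW, hx0⟩
      · rcases hm with ⟨a, b⟩ | ⟨a, b⟩
        · exact goxy (Or.inl ⟨hg, b⟩)
        · exact gozx (Or.inr ⟨hg, b⟩)
      · rcases hm with ⟨a, b⟩ | ⟨a, b⟩
        · exact gozx (Or.inl ⟨a, hb⟩)
        · exact goxy (Or.inr ⟨a, hb⟩)

lemma core4 {F G F' G' H : Set Pl} (h : Dat F G F' G' H) {z y u b : Pl}
    (hz : z ∈ Set.extremePoints ℝ H) (hy : y ∈ Set.extremePoints ℝ H)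
    (hu : u ∈ Set.extremePoints ℝ H) (hb : b ∈ Set.extremePoints ℝ H)
    (tz : Ty F G F' G' z) (ty : Ty F G G' F' y) (wu : Wt F G F' G' u) (wb : Wt F G F' G' b)
    (hsu : dt z y u < 0) (hsb : 0 < dt z y b) : False :=
  step4 h.hF h.hG h.hF' h.hG' h.sF h.sG h.sF' h.sG' h.hid hz hy hu hb tz.1 tz.2.1 tz.2.2.1 tz.2.2.2.1
    (h.eqLen hz tz) ty.1 ty.2.1 ty.2.2.1 ty.2.2.2.1 (h.swapOne.eqLen hy ty) wu.1 wu.2.1 wu.2.2.1 wu.2.2.2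
    wb.1 wb.2.1 wb.2.2.1 wb.2.2.2 hsu hsb

lemma no_mixed {F G F' G' H : Set Pl} (h : Dat F G F' G' H) {z y : Pl}
    (hz : z ∈ Set.extremePoints ℝ H) (hy : y ∈ Set.extremePoints ℝ H)
    (gz : Ty F G F' G' z ∨ Ty G F G' F' z) (by_ : Ty F G G' F' y ∨ Ty G F F' G' y) : False := by
  have hzy : z ≠ y := by
    rintro rfl
    unfold Ty at gz by_
    tauto
  have hm : Mixed F G F' G' z y := Or.inl ⟨gz, by_⟩
  obtain ⟨b, hb, wb, hb0⟩ := sideW h _ hz hy hzy hm le_rfl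
  obtain ⟨u, hu, wu, hu0⟩ := sideW h _ hy hz hzy.symm hm.comm le_rfl
  rw [dt_swap] at hu0
  have hu0' : dt z y u < 0 := by linarith
  have w1 : ∀ {v}, Wt F G F' G' v → Wt G F G' F' v := fun ⟨a, b, c, d⟩ => ⟨b, a, d, c⟩
  have w2 : ∀ {v}, Wt F G F' G' v → Wt F' G' F G v := fun ⟨a, b, c, d⟩ => ⟨c, d, a, b⟩
  have w3 : ∀ {v}, Wt F G F' G' v → Wt G' F' G F v := fun ⟨a, b, c, d⟩ => ⟨d, c, b, a⟩
  rcases gz with gz | gz <;> rcases by_ with yb | yb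
  · exact core4 h hz hy hu hb gz yb wu wb hu0' hb0
  · exact core4 h.swapP hz hy hu hb gz.symm yb.symm (w2 wu) (w2 wb) hu0' hb0
  · exact core4 h.swapFG.swapP hz hy hu hb gz.symm yb.symm (w3 wu) (w3 wb) hu0' hb0
  · exact core4 h.swapFG hz hy hu hb gz yb (w1 wu) (w1 wb) hu0' hb0

lemma all_good {F G F' G' H : Set Pl} (h : Dat F G F' G' H)
    (hg : ∀ z ∈ Set.extremePoints ℝ H, Wt F G F' G' z ∨ (Ty F G F' G' z ∨ Ty G F G' F' z)) :
    F = F' ∧ G = G' := by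
  by_cases hex : ∃ a ∈ Set.extremePoints ℝ H, Ty G F G' F' a
  · obtain ⟨a, ha, aG, aG', -, -, U, hU, hloc⟩ := hex
    have e : G = G' := by
      refine S3 h.hH h.hG h.hG' h.sG h.sG' ?_ ha aG aG' hU hloc
      intro x hx
      rcases hg x hx with hw | ht | ht
      · exact Or.inl ⟨hw.2.1, hw.2.2.2⟩
      · exact Or.inr ⟨ht.2.2.1, ht.2.2.2.1, h.eqLen hx ht⟩
      · exact Or.inl ⟨ht.1, ht.2.1⟩
    subst e
    exact ⟨fin_cancel h.hF h.hG h.hF' h.hid, rfl⟩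
  · push Not at hex
    have hall : ∀ z ∈ Set.extremePoints ℝ H, z ∈ F ∧ z ∈ F' := by
      intro z hz
      rcases hg z hz with hw | ht | ht
      · exact ⟨hw.1, hw.2.2.1⟩
      · exact ⟨ht.1, ht.2.1⟩
      · exact absurd ht (hex z hz)
    have e1 : F = H := h.sF.antisymm (h.hH.subset_of_ext h.hF.convex fun z hz => (hall z hz).1)
    have e2 : F' = H := h.sF'.antisymm (h.hH.subset_of_ext h.hF'.convex fun z hz => (hall z hz).2)
    have e : F = F' := e1.trans e2.symm
    refine ⟨e, ?_⟩
    have := h.hid.comm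
    rw [← e] at this
    exact fin_cancel h.hG h.hF h.hG' this

theorem planar {F G F' G' H : Set Pl} (h : Dat F G F' G' H) :
    (F = F' ∧ G = G') ∨ (F = G' ∧ G = F') := by
  by_cases hb : ∃ y ∈ Set.extremePoints ℝ H, Ty F G G' F' y ∨ Ty G F F' G' y
  · obtain ⟨y, hy, by_⟩ := hb
    right
    refine all_good h.swapOne (fun z hz => ?_)
    rcases h.cl z hz with hw | hg | hb
    · exact Or.inl ⟨hw.1, hw.2.1, hw.2.2.2, hw.2.2.1⟩
    · exact (no_mixed h hz hy hg by_).elim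
    · exact Or.inr hb
  · left
    push Not at hb
    refine all_good h (fun z hz => ?_)
    rcases h.cl z hz with hw | hg | hb'
    · exact Or.inl hw
    · exact Or.inr hg
    · rcases hb' with h1 | h1
      · exact absurd h1 (hb z hz).1
      · exact absurd h1 (hb z hz).2

end CC

end

section

open MeasureTheory Pointwise Topology

namespace CC

abbrev Sp := EuclideanSpace ℝ (Fin 3)

/-- point with given coordinates -/
noncomputable def mk3 (p : Pl) (t : ℝ) : Sp := !₂[p.1, p.2, t]

@[simp] lemma mk3_0 (p : Pl) (t : ℝ) : mk3 p t 0 = p.1 := by simp [mk3]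
@[simp] lemma mk3_1 (p : Pl) (t : ℝ) : mk3 p t 1 = p.2 := by simp [mk3]
@[simp] lemma mk3_2 (p : Pl) (t : ℝ) : mk3 p t 2 = t := by simp [mk3]

lemma sp_ext {x y : Sp} (h0 : x 0 = y 0) (h1 : x 1 = y 1) (h2 : x 2 = y 2) : x = y := by
  ext i; fin_cases i <;> assumption

lemma mk3_smul (c : ℝ) (p : Pl) (t : ℝ) : c • mk3 p t = mk3 (c • p) (c * t) := by
  apply sp_ext <;> simp

lemma mk3_add (p q : Pl) (s t : ℝ) : mk3 p s + mk3 q t = mk3 (p + q) (s + t) := by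
  apply sp_ext <;> simp

lemma mk3_cont : Continuous (fun x : Pl × ℝ => mk3 x.1 x.2) := by
  unfold mk3
  apply (PiLp.continuous_toLp 2 _).comp
  refine continuous_pi fun i => ?_
  fin_cases i <;> simp <;> fun_prop

lemma mk3_cont1 (t : ℝ) : Continuous (fun p : Pl => mk3 p t) :=
  mk3_cont.comp (by fun_prop : Continuous fun p : Pl => (p, t))

lemma mk3_inj {p q : Pl} {s t : ℝ} (h : mk3 p s = mk3 q t) : p = q := by
  have h0 := congrArg (fun x : Sp => x 0) h
  have h1 := congrArg (fun x : Sp => x 1) h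
  simp at h0 h1
  exact Prod.ext h0 h1

/-- linear form -/
def Lf (l : ℝ × ℝ × ℝ) (x : Sp) : ℝ := l.1 * x 0 + l.2.1 * x 1 + l.2.2 * x 2

lemma Lf_mk (l : ℝ × ℝ × ℝ) (p : Pl) : Lf l (mk3 p 1) = ev l p := by simp [Lf, ev]
lemma Lf_mk' (l : ℝ × ℝ × ℝ) (p : Pl) (t : ℝ) : Lf l (mk3 (t • p) t) = t * ev l p := by
  simp [Lf, ev]; ring
lemma Lf_add (l : ℝ × ℝ × ℝ) (x y : Sp) : Lf l (x + y) = Lf l x + Lf l y := by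
  simp [Lf]; ring
lemma Lf_smul (l : ℝ × ℝ × ℝ) (c : ℝ) (x : Sp) : Lf l (c • x) = c * Lf l x := by
  simp [Lf]; ring
lemma Lf_cont (l : ℝ × ℝ × ℝ) : Continuous (Lf l) := by unfold Lf; fun_prop
lemma inner_eq (s x : Sp) : @inner ℝ _ _ s x = Lf (s 0, s 1, s 2) x := by
  simp [PiLp.inner_apply, Fin.sum_univ_three, Lf]; ring

/-- full pointed upward polyhedral cone -/
structure Cn (A : Set Sp) : Prop where
  poly : IsPolyhedralCone A
  int : (interior A).Nonempty
  up : ∀ x ∈ A, 0 ≤ x 2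
  zero : ∀ x ∈ A, x 2 = 0 → x = 0

/-- slice at height one -/
def sl (A : Set Sp) : Set Pl := {p | mk3 p 1 ∈ A}

lemma cn_neg {B : Set Sp} (h : IsPolyhedralCone B) (hi : (interior B).Nonempty)
    (hd : -B ⊆ {x | 0 ≤ x 2}) (h0 : B ∩ {x | x 2 = 0} = {0}) : Cn (-B) := by
  refine ⟨?_, ?_, fun x hx => hd hx, ?_⟩
  · obtain ⟨S, rfl⟩ := h
    refine ⟨S.image (fun x => -x), ?_⟩
    ext x
    simp
  · obtain ⟨x, hx⟩ := hi
    refine ⟨-x, ?_⟩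
    refine interior_maximal (s := -B) (t := -interior B) ?_ isOpen_interior.neg (by simpa using hx)
    intro y hy
    exact interior_subset (s := B) hy
  · intro x hx h
    have : -x ∈ B ∩ {x | x 2 = 0} := ⟨hx, by simpa using h⟩
    rw [h0] at this
    simpa using this

lemma cn_pos {A : Set Sp} (h : IsPolyhedralCone A) (hi : (interior A).Nonempty)
    (hd : A ⊆ {x | 0 ≤ x 2}) (h0 : A ∩ {x | x 2 = 0} = {0}) : Cn A := by
  refine ⟨h, hi, fun x hx => hd hx, ?_⟩
  intro x hx h
  have : x ∈ A ∩ {x | x 2 = 0} := ⟨hx, h⟩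
  rw [h0] at this
  exact this

section
variable {A : Set Sp}

lemma Cn.smul (h : Cn A) {x : Sp} (hx : x ∈ A) {t : ℝ} (ht : 0 ≤ t) : t • x ∈ A := by
  obtain ⟨S, rfl⟩ := h.poly
  intro s hs
  rw [inner_smul_right]
  exact mul_nonpos_of_nonneg_of_nonpos ht (hx s hs)

lemma Cn.zero_mem (h : Cn A) : (0 : Sp) ∈ A := by
  obtain ⟨S, rfl⟩ := h.poly
  intro s hs
  simp

lemma Cn.closed (h : Cn A) : IsClosed A := by
  obtain ⟨S, rfl⟩ := h.poly
  have : {x : Sp | ∀ s ∈ S, @inner ℝ _ _ s x ≤ (0 : ℝ)} =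
      ⋂ s ∈ S, {x | @inner ℝ _ _ s x ≤ (0 : ℝ)} := by ext; simp
  rw [this]
  refine isClosed_biInter fun s _ => isClosed_le (by fun_prop) continuous_const

lemma Cn.convex (h : Cn A) : Convex ℝ A := by
  obtain ⟨S, rfl⟩ := h.poly
  intro x hx y hy a b ha hb _ s hs
  rw [inner_add_right, inner_smul_right, inner_smul_right]
  have := hx s hs
  have := hy s hs
  nlinarith [mul_nonpos_of_nonneg_of_nonpos ha (hx s hs), mul_nonpos_of_nonneg_of_nonpos hb (hy s hs)]

lemma Cn.mem_iff (h : Cn A) {p : Pl} {t : ℝ} (ht : 0 < t) : mk3 (t • p) t ∈ A ↔ p ∈ sl A := by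
  have e : mk3 (t • p) t = t • mk3 p 1 := by rw [mk3_smul, mul_one]
  constructor
  · intro hx
    have := h.smul hx (inv_nonneg.2 ht.le)
    rw [e, smul_smul, inv_mul_cancel₀ ht.ne', one_smul] at this
    exact this
  · intro hx
    rw [e]
    exact h.smul hx ht.le

lemma eq_mk3 {x : Sp} (hx : 0 < x 2) : x = mk3 (x 2 • ((x 2)⁻¹ • (x 0, x 1))) (x 2) := by
  rw [smul_smul, mul_inv_cancel₀ hx.ne', one_smul]
  apply sp_ext <;> simp

lemma Cn.ext_of_sl {A' : Set Sp} (h : Cn A) (h' : Cn A') (e : sl A = sl A') : A = A' := by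
  ext x
  rcases lt_trichotomy (x 2) 0 with hx | hx | hx
  · exact ⟨fun q => absurd (h.up x q) (not_le.2 hx), fun q => absurd (h'.up x q) (not_le.2 hx)⟩
  · constructor
    · intro q
      rw [h.zero x q hx]; exact h'.zero_mem
    · intro q
      rw [h'.zero x q hx]; exact h.zero_mem
  · rw [eq_mk3 hx, h.mem_iff hx, h'.mem_iff hx, e]

lemma Cn.lower (h : Cn A) : ∃ c : ℝ, 0 < c ∧ ∀ x ∈ A, c * ‖x‖ ≤ x 2 := by
  have hc : IsCompact (A ∩ Metric.sphere (0 : Sp) 1) :=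
    (isCompact_sphere _ _).inter_left h.closed
  have key : ∃ c : ℝ, 0 < c ∧ ∀ x ∈ A ∩ Metric.sphere (0 : Sp) 1, c ≤ x 2 := by
    rcases (A ∩ Metric.sphere (0 : Sp) 1).eq_empty_or_nonempty with he | hne
    · exact ⟨1, one_pos, by simp [he]⟩
    · obtain ⟨y, hy, hmin⟩ := hc.exists_isMinOn hne
        (by fun_prop : ContinuousOn (fun x : Sp => x 2) _)
      refine ⟨y 2, ?_, fun x hx => hmin hx⟩
      refine (h.up y hy.1).lt_of_ne fun e => ?_
      have := h.zero y hy.1 e.symm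
      have h2 := hy.2
      rw [this] at h2
      simp at h2
  obtain ⟨c, c0, hc⟩ := key
  refine ⟨c, c0, fun x hx => ?_⟩
  by_cases h0 : x = 0
  · simp [h0]
  have hn : 0 < ‖x‖ := norm_pos_iff.2 h0
  have := hc (‖x‖⁻¹ • x) ⟨h.smul hx (inv_nonneg.2 hn.le), by simp [norm_smul, hn.ne']⟩
  simp only [PiLp.smul_apply, smul_eq_mul] at this
  rw [inv_mul_eq_div, le_div_iff₀ hn] at this
  exact this

lemma Cn.sl_compact (h : Cn A) : IsCompact (sl A) := by
  obtain ⟨c, c0, hc⟩ := h.lower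
  refine Metric.isCompact_of_isClosed_isBounded (h.closed.preimage (mk3_cont1 1)) ?_
  refine (Metric.isBounded_closedBall (x := (0 : Pl)) (r := 1 / c)).subset ?_
  intro p hp
  have h1 := hc _ hp
  rw [mk3_2] at h1
  have h2 : ‖mk3 p 1‖ ≤ 1 / c := by rw [le_div_iff₀ c0, mul_comm]; exact h1
  rw [mem_closedBall_zero_iff, Prod.norm_def]
  refine max_le ?_ ?_
  · have := PiLp.norm_apply_le (mk3 p 1) 0
    rw [mk3_0] at this; linarith
  · have := PiLp.norm_apply_le (mk3 p 1) 1
    rw [mk3_1] at this; linarith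

lemma Cn.sl_convex (h : Cn A) : Convex ℝ (sl A) := by
  intro x hx y hy a b ha hb hab
  have := h.convex hx hy ha hb hab
  rw [mk3_smul, mk3_smul, mk3_add, mul_one, mul_one, hab] at this
  exact this

lemma Cn.sl_interior (h : Cn A) : (interior (sl A)).Nonempty := by
  obtain ⟨c, c0, hc⟩ := h.lower
  obtain ⟨x, hx, hx0⟩ := (dense_compl_singleton (0 : Sp)).inter_open_nonempty _ isOpen_interior h.int
  have hxA := interior_subset hx
  have hx2 : 0 < x 2 := lt_of_lt_of_le (mul_pos c0 (norm_pos_iff.2 hx0)) (hc x hxA)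
  refine ⟨(x 2)⁻¹ • (x 0, x 1), ?_⟩
  rw [mem_interior]
  refine ⟨{p | mk3 (x 2 • p) (x 2) ∈ interior A}, ?_, ?_, ?_⟩
  · intro p hp
    exact (h.mem_iff hx2).1 (interior_subset hp)
  · exact isOpen_interior.preimage ((mk3_cont1 (x 2)).comp (continuous_const_smul (x 2)))
  · change mk3 (x 2 • ((x 2)⁻¹ • (x 0, x 1))) (x 2) ∈ interior A
    rw [← eq_mk3 hx2]; exact hx

lemma Cn.sl_ext_finite (h : Cn A) : (Set.extremePoints ℝ (sl A)).Finite := by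
  obtain ⟨S, hS⟩ := h.poly
  have hsl : ∀ p, p ∈ sl A ↔ ∀ s ∈ S, ev (s 0, s 1, s 2) p ≤ 0 := by
    intro p
    show mk3 p 1 ∈ A ↔ _
    rw [hS]
    simp only [Set.mem_ofPred_eq, inner_eq, Lf_mk]
  classical
  refine Set.Finite.of_finite_image (f := fun p : Pl => S.filter (fun s => ev (s 0, s 1, s 2) p = 0))
    ((S.powerset.finite_toSet).subset ?_) ?_
  · rintro _ ⟨p, _, rfl⟩
    exact Finset.mem_coe.2 (Finset.mem_powerset.2 (Finset.filter_subset _ _))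
  · intro p hp q hq hpq
    by_contra hne
    have hact : ∀ s ∈ S, ev (s 0, s 1, s 2) p = 0 → ev (s 0, s 1, s 2) q = 0 := by
      intro s hs e
      have : s ∈ S.filter (fun s => ev (s 0, s 1, s 2) p = 0) := Finset.mem_filter.2 ⟨hs, e⟩
      simp only at hpq
      rw [hpq] at this
      exact (Finset.mem_filter.1 this).2
    have hev : ∀ᶠ e in 𝓝 (0 : ℝ), p + e • (p - q) ∈ sl A := by
      simp only [hsl]
      rw [Filter.eventually_all_finset]
      intro s hs
      have ee : ∀ e : ℝ, ev (s 0, s 1, s 2) (p + e • (p - q)) =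
          ev (s 0, s 1, s 2) p + e * (ev (s 0, s 1, s 2) p - ev (s 0, s 1, s 2) q) := by
        intro e; simp [ev]; ring
      simp only [ee]
      by_cases e0 : ev (s 0, s 1, s 2) p = 0
      · rw [e0, hact s hs e0]; simp
      · have lt : ev (s 0, s 1, s 2) p < 0 := lt_of_le_of_ne ((hsl p).1 hp.1 s hs) e0
        have : Filter.Tendsto (fun e : ℝ => ev (s 0, s 1, s 2) p +
            e * (ev (s 0, s 1, s 2) p - ev (s 0, s 1, s 2) q)) (𝓝 0) (𝓝 (ev (s 0, s 1, s 2) p)) := by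
          have := (by fun_prop : Continuous (fun e : ℝ => ev (s 0, s 1, s 2) p +
            e * (ev (s 0, s 1, s 2) p - ev (s 0, s 1, s 2) q))).tendsto 0
          simpa using this
        exact (this.eventually (eventually_lt_nhds lt)).mono fun _ h => h.le
    obtain ⟨d, d0, hd⟩ := Metric.eventually_nhds_iff.1 hev
    have m1 := hd (y := d / 2) (by simp [abs_of_pos d0]; linarith)
    have m2 := hd (y := -(d / 2)) (by simp [abs_of_pos d0]; linarith)
    have := hp.2 m1 m2 ⟨1 / 2, 1 / 2, by norm_num, by norm_num, by norm_num, by module⟩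
    have h0 : (d / 2) • (p - q) = 0 := by simpa using this
    rcases smul_eq_zero.1 h0 with h0 | h0
    · linarith
    · exact hne (sub_eq_zero.1 h0)

lemma Cn.isPoly (h : Cn A) : IsPoly (sl A) := by
  refine ⟨⟨h.sl_ext_finite.toFinset, ?_⟩, h.sl_interior⟩
  rw [Set.Finite.coe_toFinset]
  rw [← (h.sl_ext_finite.isClosed_convexHull ℝ).closure_eq]
  exact (closure_convexHull_extremePoints h.sl_compact h.sl_convex).symm

end

lemma isPoly_hull {K L : Set Pl} (hK : IsPoly K) (hL : IsPoly L) :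
    IsPoly (convexHull ℝ (K ∪ L)) := by
  obtain ⟨⟨V, hV⟩, hi⟩ := hK
  obtain ⟨⟨W, hW⟩, -⟩ := hL
  classical
  refine ⟨⟨V ∪ W, ?_⟩, hi.mono (interior_mono (Set.subset_union_left.trans (subset_convexHull ℝ _)))⟩
  rw [hV, hW, convexHull_convexHull_union_left, convexHull_convexHull_union_right, Finset.coe_union]

end CC

end

section

open MeasureTheory Pointwise Topology

namespace CC

lemma mp3 : MeasurePreserving (fun x : ℝ × Pl => mk3 x.2 x.1) (volume : Measure (ℝ × Pl)) volume := by
  have a : MeasurePreserving (WithLp.toLp 2 : (Fin 3 → ℝ) → Sp) := PiLp.volume_preserving_toLp (Fin 3)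
  have b := (volume_preserving_piFinSuccAbove (fun _ : Fin 3 => ℝ) 2).symm
  have c := (volume_preserving_finTwoArrow ℝ).symm
  have d : MeasurePreserving (Prod.map id (MeasurableEquiv.finTwoArrow (α := ℝ)).symm)
      (volume : Measure (ℝ × Pl)) (volume : Measure (ℝ × (Fin 2 → ℝ))) :=
    (MeasurePreserving.id volume).prod c
  have := a.comp (b.comp d)
  have e : (fun x : ℝ × Pl => mk3 x.2 x.1) = (WithLp.toLp 2 : (Fin 3 → ℝ) → Sp) ∘
      (MeasurableEquiv.piFinSuccAbove (fun _ : Fin 3 => ℝ) 2).symm ∘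
      (Prod.map id (MeasurableEquiv.finTwoArrow (α := ℝ)).symm) := by
    funext x
    apply sp_ext <;> simp [mk3] <;> rfl
  rw [e]
  exact this

lemma lint3 {f : Sp → ENNReal} (hf : Measurable f) :
    ∫⁻ x, f x = ∫⁻ t : ℝ, ∫⁻ p : Pl, f (mk3 p t) := by
  rw [← mp3.lintegral_comp hf, Measure.volume_eq_prod, lintegral_prod]
  exact (hf.comp mp3.measurable).aemeasurable

lemma lint_scale {f : Pl → ENNReal} (hf : Measurable f) {t : ℝ} (ht : 0 < t) :
    ∫⁻ p, f p = ENNReal.ofReal (t ^ 2) * ∫⁻ p, f (t • p) := by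
  have h := Measure.map_addHaar_smul (volume : Measure Pl) ht.ne'
  have h1 : ∫⁻ p, f (t • p) = ENNReal.ofReal (abs (t ^ Module.finrank ℝ Pl)⁻¹) * ∫⁻ p, f p := by
    rw [← lintegral_map hf (by fun_prop : Measurable fun p : Pl => t • p), h, lintegral_smul_measure]
    rfl
  have hr : Module.finrank ℝ Pl = 2 := by simp
  rw [h1, hr, ← mul_assoc, ← ENNReal.ofReal_mul (by positivity), abs_of_pos (by positivity),
    mul_inv_cancel₀ (by positivity), ENNReal.ofReal_one, one_mul]

lemma gamma_int {c : ℝ} (hc : 0 < c) :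
    ∫⁻ t in Set.Ioi (0 : ℝ), ENNReal.ofReal (t ^ 2) * ENNReal.ofReal (Real.exp (-(t * c))) =
      ENNReal.ofReal (2 * (c⁻¹) ^ 3) := by
  have h := Real.integral_rpow_mul_exp_neg_mul_Ioi (a := 3) (r := c) (by norm_num) hc
  have g3 : Real.Gamma 3 = 2 := by
    have := Real.Gamma_nat_eq_factorial 2
    rw [show ((2 : ℕ) : ℝ) + 1 = 3 by norm_num] at this
    rw [this]; simp [Nat.factorial]
  have e : ∀ t ∈ Set.Ioi (0 : ℝ), t ^ ((3 : ℝ) - 1) * Real.exp (-(c * t)) =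
      t ^ 2 * Real.exp (-(t * c)) := by
    intro t _
    have : (3 : ℝ) - 1 = (2 : ℕ) := by norm_num
    rw [this, Real.rpow_natCast, mul_comm c t]
  rw [setIntegral_congr_fun measurableSet_Ioi e, g3] at h
  have hv : (1 / c) ^ (3 : ℝ) * 2 = 2 * (c⁻¹) ^ 3 := by
    have : (3 : ℝ) = (3 : ℕ) := by norm_num
    rw [this, Real.rpow_natCast, one_div, mul_comm]
  rw [hv] at h
  have hitg : IntegrableOn (fun t : ℝ => t ^ 2 * Real.exp (-(t * c))) (Set.Ioi 0) := by
    by_contra hn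
    rw [integral_undef hn] at h
    have : 0 < 2 * (c⁻¹) ^ 3 := by positivity
    linarith
  rw [← h, ofReal_integral_eq_lintegral_ofReal hitg]
  · refine lintegral_congr fun t => ?_
    rw [ENNReal.ofReal_mul (by positivity)]
  · exact Filter.Eventually.of_forall fun t => by positivity

/-- Laplace transform of the indicator function of a cone -/
noncomputable def La (A : Set Sp) (l : ℝ × ℝ × ℝ) : ENNReal :=
  ∫⁻ x, A.indicator (fun x => ENNReal.ofReal (Real.exp (-Lf l x))) x

lemma exp_meas (l : ℝ × ℝ × ℝ) : Measurable (fun x => ENNReal.ofReal (Real.exp (-Lf l x))) :=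
  ENNReal.measurable_ofReal.comp (Real.continuous_exp.comp (Lf_cont l).neg).measurable

lemma La_eq {A : Set Sp} (h : Cn A) {l : ℝ × ℝ × ℝ} (hl : ∀ p ∈ sl A, 0 < ev l p) :
    La A l = ENNReal.ofReal (2 * Phi (sl A) l) := by
  have hm : Measurable (A.indicator (fun x => ENNReal.ofReal (Real.exp (-Lf l x)))) :=
    (exp_meas l).indicator h.closed.measurableSet
  have hms : MeasurableSet (sl A) := h.sl_compact.isClosed.measurableSet
  unfold La
  rw [lint3 hm]
  have hmt : ∀ t, Measurable (fun p => A.indicator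
      (fun x => ENNReal.ofReal (Real.exp (-Lf l x))) (mk3 p t)) :=
    fun t => hm.comp (mk3_cont1 t).measurable
  have s1 : ∀ᵐ t : ℝ, ∫⁻ p : Pl, A.indicator (fun x => ENNReal.ofReal (Real.exp (-Lf l x))) (mk3 p t) =
      (Set.Ioi (0 : ℝ)).indicator (fun t => ∫⁻ p in sl A,
        ENNReal.ofReal (t ^ 2) * ENNReal.ofReal (Real.exp (-(t * ev l p)))) t := by
    have : ∀ᵐ t : ℝ, t ≠ 0 := by simp [ae_iff]
    filter_upwards [this] with t ht
    rcases lt_or_gt_of_ne ht with h0 | h0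
    · rw [Set.indicator_of_notMem (by simp; exact h0.le)]
      rw [lintegral_eq_zero_iff (hmt t)]
      refine Filter.Eventually.of_forall fun p => ?_
      refine Set.indicator_of_notMem (fun hp => ?_) _
      have := h.up _ hp
      rw [mk3_2] at this
      linarith
    · rw [Set.indicator_of_mem (by exact h0), lint_scale (hmt t) h0,
        lintegral_const_mul' _ _ ENNReal.ofReal_ne_top, ← lintegral_indicator hms]
      congr 1
      refine lintegral_congr fun p => ?_
      by_cases hp : p ∈ sl A
      · rw [Set.indicator_of_mem hp]
        rw [Set.indicator_of_mem ((h.mem_iff h0).2 hp), Lf_mk']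
      · rw [Set.indicator_of_notMem hp]
        rw [Set.indicator_of_notMem (fun q => hp ((h.mem_iff h0).1 q))]
  rw [lintegral_congr_ae s1, lintegral_indicator measurableSet_Ioi, lintegral_lintegral_swap]
  · have : ∫⁻ p in sl A, ∫⁻ t in Set.Ioi (0 : ℝ), ENNReal.ofReal (t ^ 2) *
        ENNReal.ofReal (Real.exp (-(t * ev l p))) =
        ∫⁻ p in sl A, ENNReal.ofReal (2 * ((ev l p)⁻¹) ^ 3) :=
      setLIntegral_congr_fun hms fun p hp => gamma_int (hl p hp)
    rw [this, ← ofReal_integral_eq_lintegral_ofReal]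
    · rw [integral_const_mul]; rfl
    · exact (integrable_inv h.sl_compact hl).const_mul 2
    · filter_upwards [ae_restrict_mem hms] with p hp
      have := hl p hp
      positivity
  · apply Measurable.aemeasurable
    have : Continuous (fun x : ℝ × Pl => ev l x.2) := (ev_cont l).comp continuous_snd
    refine Measurable.mul (f := fun x : ℝ × Pl => ENNReal.ofReal (x.1 ^ 2))
      (g := fun x : ℝ × Pl => ENNReal.ofReal (Real.exp (-(x.1 * ev l x.2)))) ?_ ?_
    · exact ENNReal.measurable_ofReal.comp (by fun_prop)
    · exact ENNReal.measurable_ofReal.comp (Real.continuous_exp.comp (continuous_fst.mul this).neg).measurable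

lemma mem_tr {B : Set Sp} {x u : Sp} : u ∈ (x + ·) '' B ↔ x - u ∈ -B := by
  constructor
  · rintro ⟨b, hb, rfl⟩
    simpa using hb
  · intro h
    refine ⟨-(x - u), h, by simp⟩

lemma vol_fin {A B : Set Sp} (hA : Cn A) (hB : Cn (-B)) (x : Sp) :
    volume (A ∩ ((x + ·) '' B)) < ⊤ := by
  obtain ⟨c, c0, hc⟩ := hA.lower
  refine lt_of_le_of_lt (measure_mono ?_) (measure_closedBall_lt_top (x := (0 : Sp)) (r := x 2 / c))
  rintro u ⟨hu, hu2⟩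
  rw [mem_tr] at hu2
  have h1 := hB.up _ hu2
  have h2 := hc u hu
  rw [mem_closedBall_zero_iff, le_div_iff₀ c0]
  simp only [PiLp.sub_apply] at h1
  linarith

lemma La_mul {A B : Set Sp} (hA : Cn A) (hB : Cn (-B)) (l : ℝ × ℝ × ℝ) :
    ∫⁻ x, volume (A ∩ ((x + ·) '' B)) * ENNReal.ofReal (Real.exp (-Lf l x)) =
      La A l * La (-B) l := by
  have mA := hA.closed.measurableSet
  have mB := hB.closed.measurableSet
  set fA := A.indicator (fun x => ENNReal.ofReal (Real.exp (-Lf l x))) with hfA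
  set fB := (-B).indicator (fun x => ENNReal.ofReal (Real.exp (-Lf l x))) with hfB
  have meA : Measurable fA := (exp_meas l).indicator mA
  have meB : Measurable fB := (exp_meas l).indicator mB
  have s1 : ∀ x, volume (A ∩ ((x + ·) '' B)) * ENNReal.ofReal (Real.exp (-Lf l x)) =
      ∫⁻ u, fA u * fB (x - u) := by
    intro x
    have ms : MeasurableSet (A ∩ ((x + ·) '' B)) := by
      have : (x + ·) '' B = (fun u => x - u) ⁻¹' (-B) := by ext u; exact mem_tr
      rw [this]
      exact mA.inter (mB.preimage (by fun_prop))
    rw [mul_comm, ← lintegral_indicator_const ms]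
    refine lintegral_congr fun u => ?_
    by_cases h1 : u ∈ A
    · by_cases h2 : x - u ∈ -B
      · rw [Set.indicator_of_mem (show u ∈ A ∩ ((x + ·) '' B) from ⟨h1, mem_tr.2 h2⟩), hfA, hfB, Set.indicator_of_mem h1,
          Set.indicator_of_mem h2, ← ENNReal.ofReal_mul (Real.exp_pos _).le, ← Real.exp_add]
        congr 2
        have := Lf_add l u (x - u)
        rw [add_sub_cancel] at this
        rw [this]; ring
      · rw [Set.indicator_of_notMem (fun q => h2 (mem_tr.1 q.2)), hfB, Set.indicator_of_notMem h2,
          mul_zero]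
    · rw [Set.indicator_of_notMem (fun q => h1 q.1), hfA, Set.indicator_of_notMem h1, zero_mul]
  simp only [s1]
  rw [lintegral_lintegral_swap]
  · have : ∀ u, ∫⁻ x, fA u * fB (x - u) = fA u * ∫⁻ x, fB x := by
      intro u
      rw [lintegral_const_mul _ (show Measurable fun x => fB (x - u) from
        meB.comp (measurable_id.sub_const u)), lintegral_sub_right_eq_self fB u]
    simp only [this]
    rw [lintegral_mul_const _ meA]
    rfl
  · apply Measurable.aemeasurable
    unfold Function.uncurry
    exact (meA.comp measurable_snd).mul (meB.comp (measurable_fst.sub measurable_snd))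

lemma cov_ID {A B A' B' : Set Sp} (hA : Cn A) (hB : Cn (-B)) (hA' : Cn A') (hB' : Cn (-B'))
    (h : crossCovariogram A B = crossCovariogram A' B') :
    ID (sl A) (sl (-B)) (sl A') (sl (-B')) := by
  intro l a b c d
  have hv : ∀ x, volume (A ∩ ((x + ·) '' B)) = volume (A' ∩ ((x + ·) '' B')) := by
    intro x
    have := congrFun h x
    unfold crossCovariogram at this
    exact (ENNReal.toReal_eq_toReal_iff' (vol_fin hA hB x).ne (vol_fin hA' hB' x).ne).1 this
  have e : La A l * La (-B) l = La A' l * La (-B') l := by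
    rw [← La_mul hA hB, ← La_mul hA' hB']
    simp only [hv]
  rw [La_eq hA a, La_eq hB b, La_eq hA' c, La_eq hB' d] at e
  have p1 := Phi_pos hA.isPoly a
  have p2 := Phi_pos hB.isPoly b
  have p3 := Phi_pos hA'.isPoly c
  have p4 := Phi_pos hB'.isPoly d
  rw [← ENNReal.ofReal_mul (by positivity), ← ENNReal.ofReal_mul (by positivity),
    ENNReal.ofReal_eq_ofReal_iff (by positivity) (by positivity)] at e
  linarith

/-- support comparison -/
lemma cov_nonneg {A B A' B' : Set Sp} (hA : Cn A) (hB : Cn (-B)) (hA' : Cn A') (hB' : Cn (-B'))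
    (h : crossCovariogram A B = crossCovariogram A' B') {l : ℝ × ℝ × ℝ}
    (h1 : ∀ x ∈ A, 0 ≤ Lf l x) (h2 : ∀ x ∈ -B, 0 ≤ Lf l x) :
    ∀ x ∈ A', ∀ y ∈ -B', 0 ≤ Lf l (x + y) := by
  have key : interior A' ×ˢ interior (-B') ⊆ {q : Sp × Sp | 0 ≤ Lf l (q.1 + q.2)} := by
    rintro ⟨y, c⟩ ⟨hy, hc⟩
    simp only at hy hc
    show 0 ≤ Lf l (y + c)
    have hpos : 0 < volume (A' ∩ (((y + c) + ·) '' B')) := by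
      have ho : IsOpen (interior A' ∩ (fun u => (y + c) - u) ⁻¹' (interior (-B'))) :=
        isOpen_interior.inter (isOpen_interior.preimage (by fun_prop))
      refine lt_of_lt_of_le (ho.measure_pos volume ⟨y, hy, ?_⟩) (measure_mono ?_)
      · change y + c - y ∈ interior (-B')
        simpa using hc
      · rintro u ⟨q1, q2⟩
        exact ⟨interior_subset q1, mem_tr.2 (interior_subset q2)⟩
    have hne : 0 < crossCovariogram A B (y + c) := by
      rw [h]
      exact ENNReal.toReal_pos hpos.ne' (vol_fin hA' hB' _).ne
    have hne' : (A ∩ (((y + c) + ·) '' B)).Nonempty := by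
      by_contra he
      rw [Set.not_nonempty_iff_eq_empty] at he
      unfold crossCovariogram at hne
      rw [he] at hne
      simp at hne
    obtain ⟨u, u1, u2⟩ := hne'
    have a1 := h1 u u1
    have a2 := h2 _ (mem_tr.1 u2)
    have := Lf_add l u (y + c - u)
    rw [add_sub_cancel] at this
    rw [this]; linarith
  have hcl : IsClosed {q : Sp × Sp | 0 ≤ Lf l (q.1 + q.2)} :=
    isClosed_le continuous_const ((Lf_cont l).comp (continuous_fst.add continuous_snd))
  have := closure_minimal key hcl
  rw [closure_prod_eq, hA'.convex.closure_interior_eq_closure_of_nonempty_interior hA'.int,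
    hB'.convex.closure_interior_eq_closure_of_nonempty_interior hB'.int,
    hA'.closed.closure_eq, hB'.closed.closure_eq] at this
  intro x hx y hy
  exact this (show (x, y) ∈ A' ×ˢ (-B') from ⟨hx, hy⟩)

lemma Cn.nonneg {A : Set Sp} (h : Cn A) {l : ℝ × ℝ × ℝ} (hl : ∀ p ∈ sl A, 0 < ev l p) :
    ∀ x ∈ A, 0 ≤ Lf l x := by
  intro x hx
  rcases (h.up x hx).eq_or_lt with h0 | h0
  · rw [h.zero x hx h0.symm]; simp [Lf]
  · rw [eq_mk3 h0] at hx ⊢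
    rw [Lf_mk']
    exact mul_nonneg (by simpa using h0.le) (hl _ ((h.mem_iff h0).1 hx)).le

lemma cov_hull {A B A' B' : Set Sp} (hA : Cn A) (hB : Cn (-B)) (hA' : Cn A') (hB' : Cn (-B'))
    (h : crossCovariogram A B = crossCovariogram A' B') :
    sl A' ⊆ convexHull ℝ (sl A ∪ sl (-B)) ∧ sl (-B') ⊆ convexHull ℝ (sl A ∪ sl (-B)) := by
  have hH := isPoly_hull hA.isPoly hB.isPoly
  have key : ∀ f, f ∉ convexHull ℝ (sl A ∪ sl (-B)) → ∃ l, ev l f < 0 ∧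
      ∀ x ∈ A', ∀ y ∈ -B', 0 ≤ Lf l (x + y) := by
    intro f hf
    obtain ⟨l, l1, l2⟩ := sep hH.compact hH.convex hf
    refine ⟨l, l1, cov_nonneg hA hB hA' hB' h (hA.nonneg fun p hp => ?_) (hB.nonneg fun p hp => ?_)⟩
    · exact l2 p (subset_convexHull ℝ _ (Or.inl hp))
    · exact l2 p (subset_convexHull ℝ _ (Or.inr hp))
  constructor
  · intro f hf
    by_contra hn
    obtain ⟨l, l1, l2⟩ := key f hn
    have := l2 _ hf 0 hB'.zero_mem
    rw [add_zero, Lf_mk] at this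
    linarith
  · intro f hf
    by_contra hn
    obtain ⟨l, l1, l2⟩ := key f hn
    have := l2 0 hA'.zero_mem _ hf
    rw [zero_add, Lf_mk] at this
    linarith

end CC

end

section

open MeasureTheory Pointwise Topology

namespace CC

/-- the embedding of the plane at height one -/
noncomputable def emb : Pl →ᵃ[ℝ] Sp where
  toFun p := mk3 p 1
  linear :=
    { toFun := fun p => mk3 p 0
      map_add' := fun p q => by rw [mk3_add, add_zero]
      map_smul' := fun c p => by rw [RingHom.id_apply, mk3_smul, mul_zero] }
  map_vadd' p v := by
    change mk3 (v + p) 1 = mk3 v 0 + mk3 p 1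
    rw [mk3_add, zero_add]

lemma emb_apply (p : Pl) : emb p = mk3 p 1 := rfl

lemma emb_inj : Function.Injective emb := fun _ _ h => mk3_inj h

lemma emb_cont : Continuous emb := mk3_cont1 1

lemma slice_eq (A : Set Sp) : A ∩ {x | x 2 = 1} = emb '' sl A := by
  ext x
  constructor
  · rintro ⟨h1, h2⟩
    have e : mk3 (x 0, x 1) 1 = x := by
      have h2' : x 2 = 1 := h2
      apply sp_ext <;> simp [h2']
    exact ⟨(x 0, x 1), by change mk3 _ _ ∈ A; rw [e]; exact h1, e⟩
  · rintro ⟨p, hp, rfl⟩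
    exact ⟨hp, by simp [emb_apply]⟩

lemma emb_ext {K : Set Pl} {z : Pl} (hz : z ∈ Set.extremePoints ℝ K) :
    emb z ∈ Set.extremePoints ℝ (emb '' K) := by
  refine ⟨⟨z, hz.1, rfl⟩, ?_⟩
  rintro _ ⟨p, hp, rfl⟩ _ ⟨q, hq, rfl⟩ hs
  rw [← image_openSegment] at hs
  obtain ⟨r, hr, e⟩ := hs
  rw [emb_inj e] at hr
  rw [hz.2 hp hq hr]

lemma edge_seg {H : Set Pl} (hH : IsPoly H) {z y : Pl}
    (h : ∀ v ∈ Set.extremePoints ℝ H, v ≠ z → v ≠ y → 0 < dt z y v) {p : Pl} (hp : p ∈ H) :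
    0 < ev (dl z y) p ∨ p ∈ segment ℝ z y := by
  have hseg : ∀ q ∈ segment ℝ z y, ev (dl z y) q = 0 := by
    rintro q ⟨a, b, _, _, hab, rfl⟩
    rw [ev_combo _ _ _ hab, ev_dl, ev_dl, dt_self_left, dt_self_right]; ring
  have hconv : Convex ℝ {q | 0 < ev (dl z y) q ∨ q ∈ segment ℝ z y} := by
    intro q1 h1 q2 h2 a b ha hb hab
    have g : ∀ q, (0 < ev (dl z y) q ∨ q ∈ segment ℝ z y) → 0 ≤ ev (dl z y) q := by
      rintro q (h | h)
      · exact h.le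
      · exact (hseg q h).ge
    have g1 := g q1 h1
    have g2 := g q2 h2
    rcases ha.eq_or_lt with a0 | a0
    · have : b = 1 := by linarith
      rw [← a0, this]; simpa using h2
    rcases hb.eq_or_lt with b0 | b0
    · have : a = 1 := by linarith
      rw [← b0, this]; simpa using h1
    rcases h1 with h1 | h1
    · left; rw [ev_combo _ _ _ hab]; nlinarith [mul_pos a0 h1, mul_nonneg hb g2]
    rcases h2 with h2 | h2
    · left; rw [ev_combo _ _ _ hab]; nlinarith [mul_pos b0 h2, mul_nonneg ha g1]
    · right; exact convex_segment z y h1 h2 ha hb hab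
  refine hH.subset_of_ext hconv (fun v hv => ?_) hp
  by_cases e1 : v = z
  · right; rw [e1]; exact left_mem_segment ℝ z y
  by_cases e2 : v = y
  · right; rw [e2]; exact right_mem_segment ℝ z y
  left; rw [ev_dl]; exact h v hv e1 e2

lemma finrank_seg {z y : Pl} (hzy : z ≠ y) :
    Module.finrank ℝ (vectorSpan ℝ (emb '' segment ℝ z y)) = 1 := by
  rw [image_segment, ← convexHull_pair, ← direction_affineSpan, affineSpan_convexHull,
    direction_affineSpan, vectorSpan_pair]
  refine finrank_span_singleton ?_
  rw [vsub_ne_zero]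
  exact fun e => hzy (emb_inj e)

lemma isEdge {H K : Set Pl} (hH : IsPoly H) {z y : Pl} (hzy : z ≠ y)
    (h : ∀ v ∈ Set.extremePoints ℝ H, v ≠ z → v ≠ y → 0 < dt z y v) (hK : Convex ℝ K)
    (hKH : K ⊆ H) (hz : z ∈ K) (hy : y ∈ K) : IsEdgeOf (emb '' K) (emb '' segment ℝ z y) := by
  refine ⟨⟨mk3 (-(dl z y).1, -(dl z y).2.1) (-(dl z y).2.2), ?_, ?_⟩, finrank_seg hzy⟩
  · intro h0
    have a := congrArg (fun x : Sp => x 0) h0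
    have b := congrArg (fun x : Sp => x 1) h0
    simp [dl] at a b
    exact hzy (Prod.ext (by linarith) (by linarith))
  · have hin : ∀ p, @inner ℝ _ _ (mk3 (-(dl z y).1, -(dl z y).2.1) (-(dl z y).2.2)) (emb p) =
        - ev (dl z y) p := by
      intro p
      rw [inner_eq, emb_apply, Lf_mk]
      simp [ev]; ring
    have hseg : ∀ q ∈ segment ℝ z y, ev (dl z y) q = 0 := by
      rintro q ⟨a, b, _, _, hab, rfl⟩
      rw [ev_combo _ _ _ hab, ev_dl, ev_dl, dt_self_left, dt_self_right]; ring
    ext x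
    constructor
    · rintro ⟨p, hp, rfl⟩
      refine ⟨⟨p, hK.segment_subset hz hy hp, rfl⟩, ?_⟩
      rintro _ ⟨q, hq, rfl⟩
      rw [hin, hin, hseg p hp]
      rcases edge_seg hH h (hKH hq) with hq | hq
      · linarith
      · rw [hseg q hq]
    · rintro ⟨⟨p, hp, rfl⟩, hmax⟩
      have := hmax (emb z) ⟨z, hz, rfl⟩
      rw [hin, hin, ev_dl z y z, dt_self_left] at this
      rcases edge_seg hH h (hKH hp) with hq | hq
      · linarith
      · exact ⟨p, hq, rfl⟩

lemma edge_mem {K : Set Pl} {z y : Pl} (h : IsEdgeOf (emb '' K) (emb '' segment ℝ z y)) :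
    z ∈ K ∧ y ∈ K := by
  obtain ⟨⟨w, -, hw⟩, -⟩ := h
  have hs : emb '' segment ℝ z y ⊆ emb '' K := by rw [hw]; exact fun x hx => hx.1
  rw [Set.image_subset_image_iff emb_inj] at hs
  exact ⟨hs (left_mem_segment ℝ z y), hs (right_mem_segment ℝ z y)⟩

lemma edge_iff {H K L : Set Pl} (hH : IsPoly H) {z y : Pl} (hzy : z ≠ y)
    (h : ∀ v ∈ Set.extremePoints ℝ H, v ≠ z → v ≠ y → 0 < dt z y v) (hK : Convex ℝ K)
    (hKH : K ⊆ H) (hL : Convex ℝ L) (hLH : L ⊆ H) :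
    ((z ∈ K ∧ y ∈ K) ∨ (z ∈ L ∧ y ∈ L)) ↔
    (IsEdgeOf (emb '' K) (emb '' segment ℝ z y) ∨ IsEdgeOf (emb '' L) (emb '' segment ℝ z y)) := by
  constructor
  · rintro (⟨a, b⟩ | ⟨a, b⟩)
    · exact Or.inl (isEdge hH hzy h hK hKH a b)
    · exact Or.inr (isEdge hH hzy h hL hLH a b)
  · rintro (a | a)
    · exact Or.inl (edge_mem a)
    · exact Or.inr (edge_mem a)

lemma nb {K L : Set Pl} {z : Pl} {U : Set Sp} (hU : U ∈ 𝓝 (emb z))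
    (h : emb '' K ∩ U = emb '' L ∩ U) : ∃ V ∈ 𝓝 z, K ∩ V = L ∩ V := by
  refine ⟨emb ⁻¹' U, emb_cont.continuousAt.preimage_mem_nhds hU, ?_⟩
  ext p
  have := Set.ext_iff.1 h (emb p)
  simpa [emb_inj.mem_set_image] using this

theorem final (A B A' B' : Set Sp) (hA : Cn A) (hB : Cn (-B)) (hA' : Cn A') (hB' : Cn (-B'))
    (hcov : crossCovariogram A B = crossCovariogram A' B')
    (F G F' G' H : Set Sp)
    (hF : F = A ∩ {x | x 2 = 1}) (hG : G = (-B) ∩ {x | x 2 = 1})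
    (hF' : F' = A' ∩ {x | x 2 = 1}) (hG' : G' = (-B') ∩ {x | x 2 = 1})
    (hH : H = convexHull ℝ (F ∪ G))
    (h1 : ∀ z ∈ Set.extremePoints ℝ H, (z ∈ F ∩ G ↔ z ∈ F' ∩ G'))
    (h2 : ∀ S, IsEdgeOf H S →
      ((IsEdgeOf F S ∨ IsEdgeOf G S) ↔ (IsEdgeOf F' S ∨ IsEdgeOf G' S)))
    (h3 : ∀ z ∈ Set.extremePoints ℝ H, z ∉ F ∩ G →
      ∃ U ∈ nhds z,
        (z ∈ F → (z ∈ F' ∧ F ∩ U = F' ∩ U) ∨ (z ∈ G' ∧ F ∩ U = G' ∩ U)) ∧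
        (z ∈ G → (z ∈ F' ∧ G ∩ U = F' ∩ U) ∨ (z ∈ G' ∧ G ∩ U = G' ∩ U))) :
    (A = A' ∧ B = B') ∨ (A = -B' ∧ B = -A') := by
  rw [slice_eq] at hF hG hF' hG'
  have hHe : H = emb '' convexHull ℝ (sl A ∪ sl (-B)) := by
    rw [hH, hF, hG, ← Set.image_union, AffineMap.image_convexHull]
  have pH := isPoly_hull hA.isPoly hB.isPoly
  have sF : sl A ⊆ convexHull ℝ (sl A ∪ sl (-B)) :=
    Set.subset_union_left.trans (subset_convexHull ℝ _)
  have sG : sl (-B) ⊆ convexHull ℝ (sl A ∪ sl (-B)) :=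
    Set.subset_union_right.trans (subset_convexHull ℝ _)
  obtain ⟨sF', sG'⟩ := cov_hull hA hB hA' hB' hcov
  have dat : Dat (sl A) (sl (-B)) (sl A') (sl (-B')) (convexHull ℝ (sl A ∪ sl (-B))) := by
    refine ⟨hA.isPoly, hB.isPoly, hA'.isPoly, hB'.isPoly, pH, sF, sG, sF', sG',
      cov_ID hA hB hA' hB' hcov, ?_, ?_⟩
    · intro z hz
      have hzH : emb z ∈ Set.extremePoints ℝ H := by rw [hHe]; exact emb_ext hz
      have hzu : z ∈ sl A ∪ sl (-B) := extremePoints_convexHull_subset hz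
      have a1 := h1 _ hzH
      have a3 := h3 _ hzH
      rw [hF, hG, hF', hG'] at a1 a3
      simp only [Set.mem_inter_iff, emb_inj.mem_set_image] at a1 a3
      by_cases hb : z ∈ sl A ∧ z ∈ sl (-B)
      · exact Or.inl ⟨hb.1, hb.2, (a1.1 hb).1, (a1.1 hb).2⟩
      · right
        have hb' : ¬ (z ∈ sl A' ∧ z ∈ sl (-B')) := fun q => hb (a1.2 q)
        obtain ⟨U, hU, u1, u2⟩ := a3 hb
        rcases hzu with hz1 | hz1
        · rcases u1 hz1 with ⟨c1, c2⟩ | ⟨c1, c2⟩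
          · exact Or.inl (Or.inl ⟨hz1, c1, fun q => hb ⟨hz1, q⟩, fun q => hb' ⟨c1, q⟩, nb hU c2⟩)
          · exact Or.inr (Or.inl ⟨hz1, c1, fun q => hb ⟨hz1, q⟩, fun q => hb' ⟨q, c1⟩, nb hU c2⟩)
        · rcases u2 hz1 with ⟨c1, c2⟩ | ⟨c1, c2⟩
          · exact Or.inr (Or.inr ⟨hz1, c1, fun q => hb ⟨q, hz1⟩, fun q => hb' ⟨c1, q⟩, nb hU c2⟩)
          · exact Or.inl (Or.inr ⟨hz1, c1, fun q => hb ⟨q, hz1⟩, fun q => hb' ⟨q, c1⟩, nb hU c2⟩)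
    · intro z hz y hy hzy hl
      rw [edge_iff pH hzy hl hA.sl_convex sF hB.sl_convex sG,
        edge_iff pH hzy hl hA'.sl_convex sF' hB'.sl_convex sG', ← hF, ← hG, ← hF', ← hG']
      apply h2
      rw [hHe]
      exact isEdge pH hzy hl pH.convex subset_rfl hz.1 hy.1
  rcases planar dat with ⟨e1, e2⟩ | ⟨e1, e2⟩
  · exact Or.inl ⟨hA.ext_of_sl hA' e1, neg_inj.1 (hB.ext_of_sl hB' e2)⟩
  · exact Or.inr ⟨hA.ext_of_sl hB' e1, neg_eq_iff_eq_neg.1 (hB.ext_of_sl hA' e2)⟩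

end CC

end

/-- The cross covariogram determines pairs of convex polyhedral cones in `ℝ³` satisfying
assumptions (1)–(3), up to the exchange `(A,B) ↦ (−B,−A)`. -/
theorem crossCovariogram_determines_cones
    (A B A' B' : Set (EuclideanSpace ℝ (Fin 3)))
    (hA : IsPolyhedralCone A) (hB : IsPolyhedralCone B)
    (hA' : IsPolyhedralCone A') (hB' : IsPolyhedralCone B')
    (hAint : (interior A).Nonempty) (hBint : (interior B).Nonempty)
    (hA'int : (interior A').Nonempty) (hB'int : (interior B').Nonempty)
    (hAup : A ⊆ {x | 0 ≤ x 2}) (hBdown : -B ⊆ {x | 0 ≤ x 2})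
    (hA'up : A' ⊆ {x | 0 ≤ x 2}) (hB'down : -B' ⊆ {x | 0 ≤ x 2})
    (hA0 : A ∩ {x | x 2 = 0} = {0}) (hB0 : B ∩ {x | x 2 = 0} = {0})
    (hA'0 : A' ∩ {x | x 2 = 0} = {0}) (hB'0 : B' ∩ {x | x 2 = 0} = {0})
    (hcov : crossCovariogram A B = crossCovariogram A' B')
    (F G F' G' H : Set (EuclideanSpace ℝ (Fin 3)))
    (hF : F = A ∩ {x | x 2 = 1}) (hG : G = (-B) ∩ {x | x 2 = 1})
    (hF' : F' = A' ∩ {x | x 2 = 1}) (hG' : G' = (-B') ∩ {x | x 2 = 1})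
    (hH : H = convexHull ℝ (F ∪ G))
    -- hypothesis (1): a vertex of `H` belongs to `F ∩ G` iff it belongs to `F' ∩ G'`
    (h1 : ∀ z ∈ Set.extremePoints ℝ H, (z ∈ F ∩ G ↔ z ∈ F' ∩ G'))
    -- hypothesis (2): an edge of `H` is an edge of `F` or of `G` iff it is an edge of
    -- `F'` or of `G'`
    (h2 : ∀ S, IsEdgeOf H S →
      ((IsEdgeOf F S ∨ IsEdgeOf G S) ↔ (IsEdgeOf F' S ∨ IsEdgeOf G' S)))
    -- hypothesis (3): at a vertex `z ∉ F ∩ G`, the polygon among `F, G` containing `z`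
    -- coincides near `z` with the polygon among `F', G'` containing `z`
    (h3 : ∀ z ∈ Set.extremePoints ℝ H, z ∉ F ∩ G →
      ∃ U ∈ nhds z,
        (z ∈ F → (z ∈ F' ∧ F ∩ U = F' ∩ U) ∨ (z ∈ G' ∧ F ∩ U = G' ∩ U)) ∧
        (z ∈ G → (z ∈ F' ∧ G ∩ U = F' ∩ U) ∨ (z ∈ G' ∧ G ∩ U = G' ∩ U))) :
    (A = A' ∧ B = B') ∨ (A = -B' ∧ B = -A') := by
  exact CC.final A B A' B' (CC.cn_pos hA hAint hAup hA0) (CC.cn_neg hB hBint hBdown hB0)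
    (CC.cn_pos hA' hA'int hA'up hA'0) (CC.cn_neg hB' hB'int hB'down hB'0) hcov
    F G F' G' H hF hG hF' hG' hH h1 h2 h3
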